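/- arXiv:1404.6022 — 3 statements merged into one kernel-verified Lean document; each statement's English description precedes it below -/
import Mathlib

section
/- (Sieving arithmetic progressions in the large sieve regime.) For every positive integer k and every real ε > 0 there exist constants c > 0, C > 0 and an integer N₀ such that the following holds for all N ≥ N₀. Let A ⊆ [N] be a subset and let 𝒫 be a set of primes p ≤ N^{1/2k} satisfying Σ_{p ≤ N^{1/2k}, p ∉ 𝒫} (log p / p) < c · log N. If for each p ∈ 𝒫 the set A mod p is contained in an arithmetic progression S_p ⊆ ℤ/pℤ of length at most (1−ε)p, then |A| ≤ C · N^{1/2 − c}. -/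
/-- `A` reduced modulo `p`. -/
def modImage (A : Finset ℕ) (p : ℕ) : Finset (ZMod p) :=
  A.image (fun a => (Nat.cast a : ZMod p))

/-- The primes `p ≤ P` (for a real bound `P ≥ 0`). -/
noncomputable def primesUpTo (P : ℝ) : Finset ℕ :=
  (Finset.range (⌊P⌋₊ + 1)).filter Nat.Prime

/-- `S` is contained in an arithmetic progression in `ZMod p` of length at most `t`. -/
def InAP {p : ℕ} (S : Finset (ZMod p)) (t : ℝ) : Prop :=
  ∃ (L : ℕ) (x d : ZMod p), d ≠ 0 ∧ (L : ℝ) ≤ t ∧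
    S ⊆ (Finset.range L).image (fun j => x + (Nat.cast j : ZMod p) * d)

open Finset

theorem sum_log_le_log_of_dvd {Q : Finset ℕ} (hQ : ∀ p ∈ Q, p.Prime) {n : ℕ} (hn : n ≠ 0) :
    ∑ p ∈ Q with p ∣ n, Real.log p ≤ Real.log n := by
  have hsub : Q.filter (· ∣ n) ⊆ n.primeFactors := by
    intro p hp
    rw [mem_filter] at hp
    exact Nat.mem_primeFactors.2 ⟨hQ p hp.1, hp.2, hn⟩
  calc ∑ p ∈ Q with p ∣ n, Real.log p ≤ ∑ p ∈ n.primeFactors, Real.log p :=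
        sum_le_sum_of_subset_of_nonneg hsub fun p _ _ => Real.log_natCast_nonneg p
    _ = Real.log (∏ p ∈ n.primeFactors, p : ℕ) := by
        rw [Nat.cast_prod, Real.log_prod]
        intro p hp
        exact_mod_cast (Nat.prime_of_mem_primeFactors hp).ne_zero
    _ ≤ Real.log n := by
        apply Real.log_le_log
        · exact_mod_cast prod_pos fun p hp => (Nat.prime_of_mem_primeFactors hp).pos
        · exact_mod_cast Nat.le_of_dvd (Nat.pos_of_ne_zero hn) (Nat.prod_primeFactors_dvd n)

theorem sum_log_div_le (n : ℕ) :
    ∑ p ∈ range (n + 1) with p.Prime, Real.log p / p ≤ Real.log n + 2 := by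
  rcases Nat.eq_zero_or_pos n with rfl | hn
  · simp [filter_singleton, Nat.not_prime_zero]
  have hn' : (0 : ℝ) < n := by exact_mod_cast hn
  set P := (range (n + 1)).filter Nat.Prime with hP
  have hθ : ∑ p ∈ P, Real.log p ≤ 2 * n := by
    have h := Chebyshev.theta_le_log4_mul_x (x := (n : ℝ)) hn'.le
    have h4 : Real.log 4 ≤ 2 := by
      rw [show (4 : ℝ) = 2 ^ 2 by norm_num, Real.log_pow]
      have := Real.log_two_lt_d9
      push_cast; linarith
    rw [Chebyshev.theta_eq_log_primorial, Nat.floor_natCast, primorial, Nat.cast_prod,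
      Real.log_prod] at h
    · nlinarith
    · intro p hp
      exact_mod_cast (mem_filter.1 hp).2.ne_zero
  have hcount (p : ℕ) : (n : ℝ) / p - 1 ≤ ((Ioc 0 n).filter (p ∣ ·)).card := by
    rw [Nat.Ioc_filter_dvd_card_eq_div, ← Nat.floor_div_eq_div (K := ℝ)]
    exact (Nat.sub_one_lt_floor _).le
  have h1 : ∑ p ∈ P, ((n : ℝ) / p - 1) * Real.log p ≤ n * Real.log n := by
    calc ∑ p ∈ P, ((n : ℝ) / p - 1) * Real.log p
        ≤ ∑ p ∈ P, ∑ m ∈ Ioc 0 n, if p ∣ m then Real.log p else 0 := by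
          refine sum_le_sum fun p _ => ?_
          rw [← sum_filter, sum_const, nsmul_eq_mul]
          exact mul_le_mul_of_nonneg_right (hcount p) (Real.log_natCast_nonneg p)
      _ = ∑ m ∈ Ioc 0 n, ∑ p ∈ P with p ∣ m, Real.log p := by
          rw [sum_comm]; simp only [sum_filter]
      _ ≤ ∑ m ∈ Ioc 0 n, Real.log n := by
          refine sum_le_sum fun m hm => ?_
          rw [mem_Ioc] at hm
          refine (sum_log_le_log_of_dvd (fun p hp => (mem_filter.1 hp).2) (by omega)).trans ?_
          exact Real.log_le_log (by exact_mod_cast hm.1) (by exact_mod_cast hm.2)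
      _ = n * Real.log n := by simp
  have h2 : ∑ p ∈ P, ((n : ℝ) / p - 1) * Real.log p
      = n * ∑ p ∈ P, Real.log p / p - ∑ p ∈ P, Real.log p := by
    rw [mul_sum, ← sum_sub_distrib]
    refine sum_congr rfl fun p _ => by ring
  have h3 : n * ∑ p ∈ P, Real.log p / p ≤ n * (Real.log n + 2) := by linarith
  exact le_of_mul_le_mul_left h3 hn'

theorem exists_log_sub_le_sum_log_div :
    ∃ C : ℝ, ∀ n : ℕ, 0 < n →
      Real.log n - C ≤ ∑ p ∈ range (n + 1) with p.Prime, Real.log p / p := by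
  have hs : Summable fun m : ℕ => 4 * ((m : ℝ) ^ (3 / 2 : ℝ))⁻¹ :=
    (Real.summable_nat_rpow_inv.2 (by norm_num)).mul_left 4
  refine ⟨(∑' m : ℕ, 4 * ((m : ℝ) ^ (3 / 2 : ℝ))⁻¹) + 1, fun n hn => ?_⟩
  have hn' : (0 : ℝ) < n := by exact_mod_cast hn
  set P := (range (n + 1)).filter Nat.Prime with hP
  have hterm (p : ℕ) (hp : p.Prime) :
      Real.log p / (p - 1) ≤ Real.log p / p + 4 * ((p : ℝ) ^ (3 / 2 : ℝ))⁻¹ := by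
    have hp2 : (2 : ℝ) ≤ p := by exact_mod_cast hp.two_le
    have hlog : Real.log p ≤ 2 * (p : ℝ) ^ (1 / 2 : ℝ) := by
      have := Real.log_le_rpow_div (x := (p : ℝ)) (by positivity) (ε := 1 / 2) (by norm_num)
      linarith
    have hpow : (p : ℝ) ^ (3 / 2 : ℝ) * (p : ℝ) ^ (1 / 2 : ℝ) = p ^ 2 := by
      rw [← Real.rpow_add (by linarith), ← Real.rpow_natCast]; norm_num
    have h32 : (0 : ℝ) < (p : ℝ) ^ (3 / 2 : ℝ) := by positivity
    rw [← sub_le_iff_le_add']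
    have heq : Real.log p / (p - 1) - Real.log p / p = Real.log p / (p * (p - 1)) := by
      have : (p : ℝ) - 1 ≠ 0 := by linarith
      field_simp; ring
    rw [heq, ← div_eq_mul_inv, div_le_div_iff₀ (by nlinarith) h32]
    nlinarith [mul_le_mul_of_nonneg_right hlog h32.le]
  have hfac : Real.log (n.factorial) ≤ n * ∑ p ∈ P, Real.log p / (p - 1) := by
    have : (n.factorial : ℝ) = ∏ p ∈ P, (p : ℝ) ^ padicValNat p n.factorial := by
      have key := Nat.prod_pow_prime_padicValNat n.factorial n.factorial_ne_zero
        (n.factorial + 1) (by omega)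
      rw [show (n.factorial : ℝ) = _ from congrArg Nat.cast key.symm]
      push_cast
      symm
      refine prod_subset_one_on_sdiff ?_ ?_ fun _ _ => ?_
      · intro p hp
        simp only [hP, mem_filter, mem_range] at hp ⊢
        exact ⟨by have := n.self_le_factorial; omega, hp.2⟩
      · intro p hp
        simp only [hP, mem_sdiff, mem_filter, mem_range, not_and] at hp
        have : ¬ p ∣ n.factorial := fun h => by
          have := (hp.1.2.dvd_factorial).1 h
          exact hp.2 (by omega) hp.1.2
        rw [padicValNat.eq_zero_of_not_dvd this, pow_zero]
      · rfl
    rw [this, Real.log_prod, mul_sum]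
    · refine sum_le_sum fun p hp => ?_
      have hpp := (mem_filter.1 hp).2
      have hp2 : (2 : ℝ) ≤ p := by exact_mod_cast hpp.two_le
      have := Fact.mk hpp
      have hleg := sub_one_mul_padicValNat_factorial (p := p) n
      have hle : (p - 1) * padicValNat p n.factorial ≤ n := by rw [hleg]; omega
      have hle' : ((p : ℝ) - 1) * padicValNat p n.factorial ≤ n := by
        have := hpp.one_le
        exact_mod_cast hle
      rw [Real.log_pow, ← mul_div_assoc, le_div_iff₀ (by linarith)]
      nlinarith [Real.log_natCast_nonneg p]
    · intro p hp
      have hpp := (mem_filter.1 hp).2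
      exact pow_ne_zero _ (by exact_mod_cast hpp.ne_zero)
  have hst : n * Real.log n - n ≤ Real.log n.factorial := by
    have h := Stirling.le_log_factorial_stirling hn.ne'
    have h1 : 0 ≤ Real.log n := Real.log_natCast_nonneg n
    have h2 : 0 ≤ Real.log (2 * Real.pi) :=
      Real.log_nonneg (by have := Real.pi_gt_three; linarith)
    linarith
  have hsum : ∑ p ∈ P, Real.log p / (p - 1)
      ≤ ∑ p ∈ P, Real.log p / p + ∑' m : ℕ, 4 * ((m : ℝ) ^ (3 / 2 : ℝ))⁻¹ := by
    refine (sum_le_sum fun p hp => hterm p (mem_filter.1 hp).2).trans ?_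
    rw [sum_add_distrib]
    gcongr
    exact hs.sum_le_tsum _ fun _ _ => by positivity
  have h3 : n * (Real.log n - 1) ≤ n * ∑ p ∈ P, Real.log p / (p - 1) := by linarith
  have := le_of_mul_le_mul_left h3 hn'
  linarith

/-- The elements `a` of `A` with `a + n ∈ A`. -/
def shiftInter (A : Finset ℤ) (n : ℤ) : Finset ℤ := A.filter fun a => a + n ∈ A

/-- The set of differences of elements of `A`. -/
def diffSet (A : Finset ℤ) : Finset ℤ := (A ×ˢ A).image fun x => x.2 - x.1

/-- The additive energy of `A`, written through its difference counts. -/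
def diffEnergy (A : Finset ℤ) : ℕ := ∑ n ∈ diffSet A, (shiftInter A n).card ^ 2

/-- The part of the additive energy of `A` carried by the differences divisible by `p`. -/
def diffEnergyMod (A : Finset ℤ) (p : ℕ) : ℕ :=
  ∑ n ∈ diffSet A with ((n : ℤ) : ZMod p) = 0, (shiftInter A n).card ^ 2

/-- The image of a set of integers modulo `p`. -/
def residues (A : Finset ℤ) (p : ℕ) : Finset (ZMod p) := A.image fun a : ℤ => (a : ZMod p)

theorem mem_shiftInter {A : Finset ℤ} {n a : ℤ} : a ∈ shiftInter A n ↔ a ∈ A ∧ a + n ∈ A :=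
  mem_filter

theorem shiftInter_subset (A : Finset ℤ) (n : ℤ) : shiftInter A n ⊆ A := filter_subset _ _

theorem sub_mem_diffSet {A : Finset ℤ} {x y : ℤ} (hx : x ∈ A) (hy : y ∈ A) : y - x ∈ diffSet A :=
  mem_image.2 ⟨(x, y), mem_product.2 ⟨hx, hy⟩, rfl⟩

theorem sum_card_shiftInter_mul {R : Type*} [CommSemiring R] (A : Finset ℤ) (φ : ℤ → R) :
    ∑ n ∈ diffSet A, ((shiftInter A n).card : R) * φ n = ∑ x ∈ A ×ˢ A, φ (x.2 - x.1) := by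
  rw [← sum_fiberwise_of_maps_to (s := A ×ˢ A) (t := diffSet A) (g := fun x => x.2 - x.1)
    fun x hx => sub_mem_diffSet (mem_product.1 hx).1 (mem_product.1 hx).2]
  refine sum_congr rfl fun n _ => ?_
  rw [sum_congr rfl (g := fun _ => φ n) fun x hx => by rw [(mem_filter.1 hx).2], sum_const,
    nsmul_eq_mul]
  congr 2
  refine card_nbij' (fun a => (a, a + n)) (fun x => x.1) ?_ ?_ ?_ ?_
  · intro a ha
    simpa [mem_shiftInter] using ha
  · rintro ⟨x, y⟩ h
    simp only [coe_filter, mem_product, Set.mem_ofPred_eq] at h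
    obtain ⟨⟨hx, hy⟩, rfl⟩ := h
    simpa [mem_shiftInter, hx] using hy
  · intro a _; rfl
  · rintro ⟨x, y⟩ h
    simp only [coe_filter, mem_product, Set.mem_ofPred_eq] at h
    simp [← h.2]

theorem sum_card_shiftInter (A : Finset ℤ) :
    ∑ n ∈ diffSet A, ((shiftInter A n).card : ℝ) = (A.card : ℝ) ^ 2 := by
  have := sum_card_shiftInter_mul A fun _ => (1 : ℝ)
  simp only [mul_one, sum_const, card_product, nsmul_eq_mul, Nat.cast_mul] at this
  rw [this, sq]

theorem sum_card_shiftInter_sq (A : Finset ℤ) (P : ℤ → Prop) [DecidablePred P] :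
    ∑ n ∈ diffSet A with P n, (shiftInter A n).card ^ 2
      = ∑ t ∈ diffSet A,
        ((shiftInter A t ×ˢ shiftInter A t).filter fun x => P (x.2 - x.1)).card := by
  have h (n : ℤ) : (shiftInter A n).card ^ 2 = (shiftInter A n ×ˢ shiftInter A n).card := by
    rw [card_product, sq]
  simp_rw [h]
  rw [← card_sigma, ← card_sigma]
  refine card_nbij' (fun x => ⟨x.2.2 - x.2.1, (x.2.1, x.2.1 + x.1)⟩)
    (fun x => ⟨x.2.2 - x.2.1, (x.2.1, x.2.1 + x.1)⟩) ?_ ?_ ?_ ?_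
  · rintro ⟨n, x, y⟩ h
    simp only [coe_sigma, Set.mem_sigma_iff, mem_coe, mem_filter, mem_product,
      mem_shiftInter] at h ⊢
    obtain ⟨⟨_, hP⟩, ⟨hx, hxn⟩, hy, hyn⟩ := h
    refine ⟨sub_mem_diffSet hx hy, ⟨⟨hx, ?_⟩, hxn, ?_⟩, ?_⟩
    · convert hy using 1; ring
    · convert hyn using 1; ring
    · convert hP using 1; ring
  · rintro ⟨n, x, y⟩ h
    simp only [coe_sigma, Set.mem_sigma_iff, mem_coe, mem_filter, mem_product,
      mem_shiftInter] at h ⊢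
    obtain ⟨_, ⟨⟨hx, hxn⟩, hy, hyn⟩, hP⟩ := h
    refine ⟨⟨sub_mem_diffSet hx hy, hP⟩, ⟨hx, ?_⟩, hxn, ?_⟩
    · convert hy using 1; ring
    · convert hyn using 1; ring
  · rintro ⟨n, x, y⟩ h
    simp
  · rintro ⟨n, x, y⟩ h
    simp

/-- The number of elements of `B` in each residue class modulo `p`. -/
def residueCount (B : Finset ℤ) (p : ℕ) (c : ZMod p) : ℕ :=
  (B.filter fun a : ℤ => (a : ZMod p) = c).card

theorem card_pairs_sub_eq (B : Finset ℤ) (p : ℕ) [NeZero p] (b : ZMod p) :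
    ((B ×ˢ B).filter fun x => ((x.2 - x.1 : ℤ) : ZMod p) = b).card
      = ∑ c, residueCount B p c * residueCount B p (c + b) := by
  rw [card_eq_sum_card_fiberwise (f := fun x => (x.1 : ZMod p)) (t := univ) (by simp)]
  refine sum_congr rfl fun c _ => ?_
  rw [residueCount, residueCount, ← card_product]
  congr 1
  ext ⟨x, y⟩
  simp only [mem_filter, mem_product, Int.cast_sub, sub_eq_iff_eq_add]
  constructor
  · rintro ⟨⟨⟨hx, hy⟩, h⟩, rfl⟩
    exact ⟨⟨hx, rfl⟩, hy, by rw [h, add_comm]⟩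
  · rintro ⟨⟨hx, rfl⟩, hy, h⟩
    exact ⟨⟨⟨hx, hy⟩, by rw [h, add_comm]⟩, rfl⟩

theorem card_pairs_sub_eq_le (B : Finset ℤ) (p : ℕ) [NeZero p] (b : ZMod p) :
    ((B ×ˢ B).filter fun x => ((x.2 - x.1 : ℤ) : ZMod p) = b).card
      ≤ ((B ×ˢ B).filter fun x => ((x.2 - x.1 : ℤ) : ZMod p) = 0).card := by
  rw [card_pairs_sub_eq, card_pairs_sub_eq]
  simp only [add_zero]
  have h1 : ∑ c, residueCount B p (c + b) * residueCount B p (c + b)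
      = ∑ c, residueCount B p c * residueCount B p c :=
    Fintype.sum_equiv (Equiv.addRight b) _ _ fun _ => rfl
  have h2 : ∑ c, 2 * (residueCount B p c * residueCount B p (c + b))
      ≤ ∑ c, (residueCount B p c * residueCount B p c
        + residueCount B p (c + b) * residueCount B p (c + b)) :=
    sum_le_sum fun c _ => by
      nlinarith [two_mul_le_add_sq (residueCount B p c) (residueCount B p (c + b))]
  rw [← mul_sum, sum_add_distrib, h1] at h2
  omega

theorem card_sq_le_card_residues_mul (B : Finset ℤ) (p : ℕ) [NeZero p] :
    B.card ^ 2 ≤ (residues B p).card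
      * ((B ×ˢ B).filter fun x => ((x.2 - x.1 : ℤ) : ZMod p) = 0).card := by
  rw [card_pairs_sub_eq]
  simp only [add_zero]
  have h1 : B.card = ∑ c ∈ residues B p, residueCount B p c :=
    card_eq_sum_card_fiberwise fun x hx => mem_image_of_mem _ hx
  calc B.card ^ 2 = (∑ c ∈ residues B p, residueCount B p c) ^ 2 := by rw [h1]
    _ ≤ (residues B p).card * ∑ c ∈ residues B p, residueCount B p c ^ 2 :=
        sq_sum_le_card_mul_sum_sq
    _ ≤ _ := by
        gcongr
        simp only [sq]
        exact sum_le_sum_of_subset (subset_univ _)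

theorem diffEnergy_le_card_residues_mul (A : Finset ℤ) (p : ℕ) [NeZero p] :
    diffEnergy A ≤ (residues A p).card * diffEnergyMod A p := by
  rw [diffEnergy, diffEnergyMod, sum_card_shiftInter_sq, mul_sum]
  refine sum_le_sum fun t _ => (card_sq_le_card_residues_mul _ p).trans ?_
  gcongr
  exact image_subset_image (shiftInter_subset A t)

theorem sum_sq_residues_le (A : Finset ℤ) (p : ℕ) [NeZero p] (S : Finset (ZMod p)) :
    ∑ n ∈ diffSet A with ((n : ℤ) : ZMod p) ∈ S, (shiftInter A n).card ^ 2
      ≤ S.card * diffEnergyMod A p := by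
  rw [sum_filter, ← smul_eq_mul, ← sum_const]
  calc ∑ n ∈ diffSet A, (if ((n : ℤ) : ZMod p) ∈ S then (shiftInter A n).card ^ 2 else 0)
      = ∑ n ∈ diffSet A, ∑ b ∈ S,
          if ((n : ℤ) : ZMod p) = b then (shiftInter A n).card ^ 2 else 0 := by
        simp
    _ = ∑ b ∈ S, ∑ n ∈ diffSet A with ((n : ℤ) : ZMod p) = b, (shiftInter A n).card ^ 2 := by
        rw [sum_comm]; simp only [sum_filter]
    _ ≤ ∑ b ∈ S, diffEnergyMod A p := by
        refine sum_le_sum fun b _ => ?_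
        rw [diffEnergyMod, sum_card_shiftInter_sq, sum_card_shiftInter_sq]
        exact sum_le_sum fun t _ => card_pairs_sub_eq_le _ p b

theorem sum_log_mul_diffEnergyMod_le {A : Finset ℤ} {N : ℕ} (hA : A ⊆ Icc 1 (N : ℤ))
    {Q : Finset ℕ} (hQ : ∀ p ∈ Q, p.Prime) :
    ∑ p ∈ Q, Real.log p * diffEnergyMod A p
      ≤ diffEnergy A * Real.log N + (A.card : ℝ) ^ 2 * ∑ p ∈ Q, Real.log p := by
  have hr0 : (shiftInter A 0).card = A.card := by
    congr 1; ext a; simp [mem_shiftInter]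
  have hterm : ∀ n ∈ diffSet A,
      ((shiftInter A n).card : ℝ) ^ 2 * ∑ p ∈ Q with ((n : ℤ) : ZMod p) = 0,
      Real.log p ≤ ((shiftInter A n).card : ℝ) ^ 2 * Real.log N
        + if n = 0 then (A.card : ℝ) ^ 2 * ∑ p ∈ Q, Real.log p else 0 := by
    intro n hn
    rcases eq_or_ne n 0 with rfl | hne
    · simp only [Int.cast_zero, filter_true, if_true, hr0]
      have : 0 ≤ (A.card : ℝ) ^ 2 * Real.log N :=
        mul_nonneg (by positivity) (Real.log_natCast_nonneg N)
      linarith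
    · rw [if_neg hne, add_zero]
      refine mul_le_mul_of_nonneg_left ?_ (by positivity)
      have hna : n.natAbs ≠ 0 := by omega
      have hle : n.natAbs ≤ N := by
        obtain ⟨⟨x, y⟩, hxy, rfl⟩ := mem_image.1 hn
        rw [mem_product] at hxy
        have h1 := mem_Icc.1 (hA hxy.1)
        have h2 := mem_Icc.1 (hA hxy.2)
        simp only at h1 h2 ⊢
        omega
      have hf : Q.filter (fun p : ℕ => ((n : ℤ) : ZMod p) = 0) = Q.filter (· ∣ n.natAbs) := by
        refine filter_congr fun p _ => ?_
        rw [ZMod.intCast_zmod_eq_zero_iff_dvd, Int.natCast_dvd]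
      rw [hf]
      refine (sum_log_le_log_of_dvd hQ hna).trans (Real.log_le_log ?_ (by exact_mod_cast hle))
      exact_mod_cast Nat.pos_of_ne_zero hna
  have hswap : ∑ p ∈ Q, Real.log p * diffEnergyMod A p
      = ∑ n ∈ diffSet A, ((shiftInter A n).card : ℝ) ^ 2 * ∑ p ∈ Q with ((n : ℤ) : ZMod p) = 0,
        Real.log p := by
    simp only [diffEnergyMod, Nat.cast_sum, Nat.cast_pow, mul_sum, sum_filter, mul_ite, mul_zero,
      Nat.cast_ite, Nat.cast_zero]
    rw [sum_comm]
    simp only [mul_comm]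
  rw [hswap]
  refine (sum_le_sum hterm).trans ?_
  rw [sum_add_distrib, ← sum_mul, sum_ite_eq']
  have : (∑ n ∈ diffSet A, ((shiftInter A n).card : ℝ) ^ 2) = diffEnergy A := by
    simp [diffEnergy]
  rw [this]
  gcongr
  split_ifs
  · exact le_rfl
  · exact mul_nonneg (by positivity) (sum_nonneg fun p _ => Real.log_natCast_nonneg p)

/-- The number of elements of `G` that leave `G` when translated by `n`. -/
def exitCount {p : ℕ} (G : Finset (ZMod p)) (n : ZMod p) : ℕ := (G.filter fun x => x + n ∉ G).card

theorem exitCount_add_le {p : ℕ} (G : Finset (ZMod p)) (a b : ZMod p) :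
    exitCount G (a + b) ≤ exitCount G a + exitCount G b := by
  have hsub : (G.filter fun x => x + (a + b) ∉ G) ⊆ (G.filter fun x => x + a ∉ G)
      ∪ (G.filter fun x => x + b ∉ G).image fun x => x - a := by
    intro x hx
    rw [mem_filter] at hx
    by_cases h : x + a ∈ G
    · refine mem_union_right _ (mem_image.2 ⟨x + a, mem_filter.2 ⟨h, ?_⟩, by ring⟩)
      rw [add_assoc]; exact hx.2
    · exact mem_union_left _ (mem_filter.2 ⟨hx.1, h⟩)
  exact (card_le_card hsub).trans ((card_union_le _ _).trans (Nat.add_le_add_left card_image_le _))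

theorem sum_exitCount {p : ℕ} [NeZero p] (G : Finset (ZMod p)) :
    ∑ n, exitCount G n = G.card * (p - G.card) := by
  simp only [exitCount, card_filter]
  rw [sum_comm, ← smul_eq_mul, ← sum_const]
  refine sum_congr rfl fun x _ => ?_
  rw [← card_filter]
  have : (univ.filter fun n => x + n ∉ G) = (Gᶜ).image fun y => y - x := by
    ext n
    simp only [mem_filter, mem_univ, true_and, mem_image, mem_compl]
    exact ⟨fun h => ⟨x + n, h, by ring⟩, by rintro ⟨y, hy, rfl⟩; simpa using hy⟩
  rw [this, card_image_of_injective _ (sub_left_injective), card_compl, ZMod.card]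

/-- A subset of `ZMod p` that is neither small nor almost everything is moved substantially by
all but a small proportion of the translations. -/
theorem card_exitCount_le_mul_le {p : ℕ} [Fact p.Prime] (G : Finset (ZMod p)) {ε η C : ℝ} {D : ℕ}
    (hC : 0 < C) (hε : 0 < ε) (hDp : D ≤ p) (hηC : η * (2 * D) * C ≤ ε)
    (hG : (p : ℝ) < G.card * C) (hG' : (G.card : ℝ) ≤ (1 - ε) * p) :
    (univ.filter fun n => (exitCount G n : ℝ) ≤ η * p).card * D ≤ p := by
  by_contra! hlt
  set B := univ.filter fun n => (exitCount G n : ℝ) ≤ η * p with hB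
  have hpos : 0 < p := (Fact.out : p.Prime).pos
  have hp' : (0 : ℝ) < p := by exact_mod_cast hpos
  have hB2 : 2 ≤ B.card := by
    by_contra! h
    have : B.card ≤ 1 := by omega
    have := Nat.mul_le_mul_right D this
    omega
  have hBne : B.Nonempty := card_pos.1 (by omega)
  have hsum (m : ℕ) : ∃ T : Finset (ZMod p), T.Nonempty ∧
      (∀ t ∈ T, (exitCount G t : ℝ) ≤ m * (η * p)) ∧ min p (m * (B.card - 1) + 1) ≤ T.card := by
    induction m with
    | zero =>
      refine ⟨{0}, by simp, ?_, by simp⟩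
      intro t ht
      rw [mem_singleton.1 ht]
      simp [exitCount]
    | succ m ih =>
      obtain ⟨T, hTne, hT, hTc⟩ := ih
      refine ⟨image₂ (· + ·) T B, hTne.image₂ hBne, ?_, ?_⟩
      · intro t ht
        obtain ⟨a, ha, b, hb, rfl⟩ := mem_image₂.1 ht
        have h1 := hT a ha
        have h2 := (mem_filter.1 hb).2
        have h3 : (exitCount G (a + b) : ℝ) ≤ exitCount G a + exitCount G b := by
          exact_mod_cast exitCount_add_le G a b
        push_cast
        linarith
      · have hcd : min p (T.card + B.card - 1) ≤ (image₂ (· + ·) T B).card :=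
          ZMod.cauchy_davenport Fact.out hTne hBne
        rw [Nat.add_mul, Nat.one_mul]
        omega
  obtain ⟨T, -, hT, hTc⟩ := hsum (2 * D)
  have hcov : T = univ := by
    rw [← card_eq_iff_eq_univ, ZMod.card]
    refine le_antisymm (by simpa [ZMod.card] using card_le_univ T) ?_
    refine le_trans (le_min le_rfl ?_) hTc
    have : B.card * D ≤ 2 * D * (B.card - 1) := by
      obtain ⟨b, hb⟩ := Nat.exists_eq_add_of_le hB2
      rw [hb, show 2 + b - 1 = 1 + b by omega]
      nlinarith
    omega
  have hle : (∑ n, exitCount G n : ℝ) ≤ p * ((2 * D) * (η * p)) := by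
    calc (∑ n, exitCount G n : ℝ) ≤ ∑ n : ZMod p, (2 * D) * (η * p) :=
          sum_le_sum fun n _ => by simpa using hT n (hcov ▸ mem_univ n)
      _ = _ := by rw [sum_const, card_univ, ZMod.card, nsmul_eq_mul]
  have hGp : G.card ≤ p := by simpa [ZMod.card] using card_le_univ G
  have heq : (∑ n, exitCount G n : ℝ) = G.card * (p - G.card) := by
    rw [← Nat.cast_sum, sum_exitCount, Nat.cast_mul, Nat.cast_sub hGp]
  rw [heq] at hle
  have h1 : (G.card : ℝ) * (ε * p) ≤ G.card * (p - G.card) :=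
    mul_le_mul_of_nonneg_left (by linarith) (by positivity)
  have h2 : (p : ℝ) * (ε * p) < G.card * C * (ε * p) :=
    mul_lt_mul_of_pos_right hG (by positivity)
  have h3 : p * ((2 * D) * (η * p)) * C ≤ p * (ε * p) := by
    have := mul_le_mul_of_nonneg_left hηC (show (0 : ℝ) ≤ p * p by positivity)
    linarith
  nlinarith

/-- The total relative size of the images of `A` modulo the primes of `Q`, with logarithmic
weights. -/
noncomputable def logDensity (Q : Finset ℕ) (A : Finset ℤ) : ℝ :=
  ∑ p ∈ Q, Real.log p / p * ((residues A p).card / p)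

theorem card_residues_shiftInter_add_le (A : Finset ℤ) (p : ℕ) (n : ℤ) :
    (residues (shiftInter A n) p).card + exitCount (residues A p) (n : ZMod p)
      ≤ (residues A p).card := by
  have hsub : residues (shiftInter A n) p
      ⊆ (residues A p).filter fun x => x + (n : ZMod p) ∈ residues A p := by
    intro x hx
    obtain ⟨a, ha, rfl⟩ := mem_image.1 hx
    rw [mem_shiftInter] at ha
    exact mem_filter.2 ⟨mem_image_of_mem _ ha.1,
      mem_image.2 ⟨a + n, ha.2, by push_cast; rfl⟩⟩
  have h := card_filter_add_card_filter_not (s := residues A p)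
    (fun x => x + (n : ZMod p) ∈ residues A p)
  have := card_le_card hsub
  rw [exitCount]
  omega

theorem le_sum_sq_shiftInter_of_bad_le {A : Finset ℤ} {P : ℤ → Prop} [DecidablePred P]
    (hP : 4 * ∑ n ∈ diffSet A with P n, (shiftInter A n).card ^ 2 ≤ diffEnergy A) :
    (diffEnergy A : ℝ) / 2 ≤ ∑ n ∈ diffSet A with
      (diffEnergy A ≤ 4 * A.card ^ 2 * (shiftInter A n).card ∧ ¬ P n),
      ((shiftInter A n).card : ℝ) ^ 2 := by
  set E := diffEnergy A with hE
  have hP' : 4 * ∑ n ∈ diffSet A with P n, ((shiftInter A n).card : ℝ) ^ 2 ≤ E := by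
    exact_mod_cast hP
  have htot : (∑ n ∈ diffSet A, ((shiftInter A n).card : ℝ) ^ 2) = E := by
    rw [hE, diffEnergy]; push_cast; rfl
  have hlow : 4 * ∑ n ∈ diffSet A with ¬ E ≤ 4 * A.card ^ 2 * (shiftInter A n).card,
      ((shiftInter A n).card : ℝ) ^ 2 ≤ E := by
    rcases Nat.eq_zero_or_pos A.card with h0 | hpos
    · have : A = ∅ := card_eq_zero.1 h0
      subst this
      simp [diffSet]
    have hX : (0 : ℝ) < (A.card : ℝ) ^ 2 := by positivity
    have h1 : ∀ n ∈ (diffSet A).filter fun n => ¬ E ≤ 4 * A.card ^ 2 * (shiftInter A n).card,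
        4 * (A.card : ℝ) ^ 2 * ((shiftInter A n).card : ℝ) ^ 2
          ≤ E * (shiftInter A n).card := by
      intro n hn
      have h : (4 * A.card ^ 2 * (shiftInter A n).card : ℝ) ≤ E := by
        exact_mod_cast (not_le.1 (mem_filter.1 hn).2).le
      nlinarith [Nat.cast_nonneg (α := ℝ) (shiftInter A n).card]
    have h2 := sum_le_sum h1
    rw [← mul_sum, ← mul_sum] at h2
    have h3 : (∑ n ∈ diffSet A with ¬ E ≤ 4 * A.card ^ 2 * (shiftInter A n).card,
        ((shiftInter A n).card : ℝ)) ≤ (A.card : ℝ) ^ 2 := by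
      rw [← sum_card_shiftInter]
      exact sum_le_sum_of_subset_of_nonneg (filter_subset _ _) fun _ _ _ => by positivity
    have h4 := mul_le_mul_of_nonneg_left h3 (Nat.cast_nonneg (α := ℝ) E)
    nlinarith
  have hsplit : (∑ n ∈ diffSet A, ((shiftInter A n).card : ℝ) ^ 2)
      ≤ (∑ n ∈ diffSet A with (E ≤ 4 * A.card ^ 2 * (shiftInter A n).card ∧ ¬ P n),
          ((shiftInter A n).card : ℝ) ^ 2)
        + (∑ n ∈ diffSet A with ¬ E ≤ 4 * A.card ^ 2 * (shiftInter A n).card,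
          ((shiftInter A n).card : ℝ) ^ 2)
        + ∑ n ∈ diffSet A with P n, ((shiftInter A n).card : ℝ) ^ 2 := by
    simp only [sum_filter]
    rw [← sum_add_distrib, ← sum_add_distrib]
    refine sum_le_sum fun n _ => ?_
    have : 0 ≤ ((shiftInter A n).card : ℝ) ^ 2 := by positivity
    by_cases h1 : E ≤ 4 * A.card ^ 2 * (shiftInter A n).card <;> by_cases h2 : P n <;>
      simp [h1, h2, this]
  linarith

theorem exists_shift_logDensity_le {A : Finset ℤ} {N : ℕ} (hA : A ⊆ Icc 1 (N : ℤ))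
    (hne : A.Nonempty) {Q : Finset ℕ} {ε η : ℝ} {C : ℕ} (hC : 0 < C) (hε : 0 < ε) (hη : 0 ≤ η)
    (hηC : η * (2 * (4 * C)) * C ≤ ε) (hQ : ∀ p ∈ Q, p.Prime) (hQC : ∀ p ∈ Q, 4 * C ≤ p)
    (hres : ∀ p ∈ Q, ((residues A p).card : ℝ) ≤ (1 - ε) * p)
    (hdiag : (A.card : ℝ) ^ 2 * ∑ p ∈ Q, Real.log p ≤ diffEnergy A)
    (hlog : 2 * (Real.log N + 1) ≤ C * ∑ p ∈ Q, Real.log p / p) :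
    ∃ n : ℤ, (diffEnergy A : ℝ) ≤ 4 * (A.card : ℝ) ^ 2 * (shiftInter A n).card ∧
      logDensity Q (shiftInter A n)
        ≤ logDensity Q A - η / 4 * ∑ p ∈ Q, Real.log p / p := by
  classical
  set E := diffEnergy A with hE
  set lam : ℝ := ∑ p ∈ Q, Real.log p / p with hlam
  have hEpos : (0 : ℝ) < E := by
    obtain ⟨a, ha⟩ := hne
    have h0 : (0 : ℤ) ∈ diffSet A := by simpa using sub_mem_diffSet ha ha
    have h1 : 0 < (shiftInter A 0).card :=
      card_pos.2 ⟨a, mem_shiftInter.2 ⟨ha, by simpa using ha⟩⟩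
    have h2 : (shiftInter A 0).card ^ 2 ≤ E :=
      single_le_sum (f := fun n => (shiftInter A n).card ^ 2) (fun _ _ => Nat.zero_le _) h0
    exact_mod_cast lt_of_lt_of_le (pow_pos h1 2) h2
  have hw (p : ℕ) : 0 ≤ Real.log p / p := div_nonneg (Real.log_natCast_nonneg p) (by positivity)
  let stuck (p : ℕ) (n : ℤ) : Prop := (exitCount (residues A p) (n : ZMod p) : ℝ) ≤ η * p
  let good (p : ℕ) : Prop :=
    4 * ∑ n ∈ diffSet A with stuck p n, (shiftInter A n).card ^ 2 ≤ E
  have hbad : ∀ p ∈ Q, ¬ good p → C * E ≤ p * diffEnergyMod A p := by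
    intro p hp hng
    have : Fact p.Prime := ⟨hQ p hp⟩
    by_cases hsmall : (residues A p).card * C ≤ p
    · calc C * E ≤ C * ((residues A p).card * diffEnergyMod A p) := by
            gcongr; exact diffEnergy_le_card_residues_mul A p
        _ = (residues A p).card * C * diffEnergyMod A p := by ring
        _ ≤ _ := by gcongr
    · set S := univ.filter fun n : ZMod p => (exitCount (residues A p) n : ℝ) ≤ η * p with hS
      have hcard : S.card * (4 * C) ≤ p :=
        card_exitCount_le_mul_le (residues A p) (C := C) (by exact_mod_cast hC) hε (hQC p hp)
          (by push_cast; exact hηC) (by exact_mod_cast not_le.1 hsmall) (hres p hp)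
      have hsum : ∑ n ∈ diffSet A with stuck p n, (shiftInter A n).card ^ 2
          ≤ S.card * diffEnergyMod A p := by
        refine le_trans (le_of_eq ?_) (sum_sq_residues_le A p S)
        refine sum_congr (filter_congr fun n _ => ?_) fun _ _ => rfl
        simp [hS, stuck]
      have hlt : E < 4 * (S.card * diffEnergyMod A p) :=
        lt_of_lt_of_le (not_le.1 hng) (Nat.mul_le_mul_left 4 hsum)
      calc C * E ≤ C * (4 * (S.card * diffEnergyMod A p)) := by gcongr
        _ = S.card * (4 * C) * diffEnergyMod A p := by ring
        _ ≤ _ := by gcongr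
  have hbadsum : C * ∑ p ∈ Q with ¬ good p, Real.log p / p ≤ Real.log N + 1 := by
    have h1 : E * (C * ∑ p ∈ Q with ¬ good p, Real.log p / p)
        ≤ ∑ p ∈ Q, Real.log p * diffEnergyMod A p := by
      rw [← mul_assoc, mul_sum]
      refine le_trans (sum_le_sum (g := fun p : ℕ => Real.log p * diffEnergyMod A p) ?_)
        (sum_le_sum_of_subset_of_nonneg (filter_subset _ _) fun p _ _ =>
          mul_nonneg (Real.log_natCast_nonneg p) (by positivity))
      intro p hp
      rw [mem_filter] at hp
      have hpp : (0 : ℝ) < p := by exact_mod_cast (hQ p hp.1).pos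
      have hb : (C * E : ℝ) ≤ p * diffEnergyMod A p := by exact_mod_cast hbad p hp.1 hp.2
      rw [← mul_div_assoc, div_le_iff₀ hpp]
      nlinarith [Real.log_natCast_nonneg p]
    have h2 := sum_log_mul_diffEnergyMod_le hA hQ
    have h3 : (E : ℝ) * (C * ∑ p ∈ Q with ¬ good p, Real.log p / p)
        ≤ E * (Real.log N + 1) := by linarith
    exact le_of_mul_le_mul_left h3 hEpos
  have hgood : lam / 2 ≤ ∑ p ∈ Q with good p, Real.log p / p := by
    have h := sum_filter_add_sum_filter_not Q good fun p : ℕ => Real.log p / p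
    have hC' : (0 : ℝ) < C := by exact_mod_cast hC
    have : (C : ℝ) * ∑ p ∈ Q with ¬ good p, Real.log p / p ≤ C * (lam / 2) := by linarith
    have := le_of_mul_le_mul_left this hC'
    linarith
  set R := (diffSet A).filter fun n => E ≤ 4 * A.card ^ 2 * (shiftInter A n).card with hR
  have hex : ∃ n ∈ R, lam / 4 ≤ ∑ p ∈ Q with good p ∧ ¬ stuck p n, Real.log p / p := by
    by_contra! hcon
    have h1 : ∑ n ∈ R, ((shiftInter A n).card : ℝ) ^ 2 *
        ∑ p ∈ Q with good p ∧ ¬ stuck p n, Real.log p / p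
        = ∑ p ∈ Q with good p, Real.log p / p *
          ∑ n ∈ diffSet A with (E ≤ 4 * A.card ^ 2 * (shiftInter A n).card ∧ ¬ stuck p n),
          ((shiftInter A n).card : ℝ) ^ 2 := by
      simp only [mul_sum]
      rw [sum_comm' (t' := Q.filter good) (s' := fun p => (diffSet A).filter fun n =>
        E ≤ 4 * A.card ^ 2 * (shiftInter A n).card ∧ ¬ stuck p n)]
      · simp only [mul_comm]
      · intro n p
        simp only [hR, mem_filter]
        tauto
    have h2 : E * (lam / 4) ≤ ∑ p ∈ Q with good p, Real.log p / p *
          ∑ n ∈ diffSet A with (E ≤ 4 * A.card ^ 2 * (shiftInter A n).card ∧ ¬ stuck p n),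
          ((shiftInter A n).card : ℝ) ^ 2 := by
      calc E * (lam / 4) = lam / 2 * (E / 2) := by ring
        _ ≤ (∑ p ∈ Q with good p, Real.log p / p) * (E / 2) := by gcongr
        _ = ∑ p ∈ Q with good p, Real.log p / p * (E / 2 : ℝ) := by rw [sum_mul]
        _ ≤ _ := by
          refine sum_le_sum fun p hp => mul_le_mul_of_nonneg_left ?_ (hw p)
          exact le_sum_sq_shiftInter_of_bad_le (mem_filter.1 hp).2
    have hRne : R.Nonempty := by
      by_contra! hempty
      have := le_sum_sq_shiftInter_of_bad_le (A := A) (P := fun _ => False) (by simp)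
      simp only [not_false_eq_true, and_true] at this
      rw [← hE, ← hR, hempty, sum_empty] at this
      linarith
    have h3 : ∑ n ∈ R, ((shiftInter A n).card : ℝ) ^ 2 *
        ∑ p ∈ Q with good p ∧ ¬ stuck p n, Real.log p / p
        < ∑ n ∈ R, ((shiftInter A n).card : ℝ) ^ 2 * (lam / 4) := by
      refine sum_lt_sum_of_nonempty hRne fun n hn => mul_lt_mul_of_pos_left (hcon n hn) ?_
      have h := (mem_filter.1 hn).2
      have : (shiftInter A n).card ≠ 0 := fun h0 => by
        rw [h0, mul_zero] at h
        have : (E : ℝ) ≤ 0 := by exact_mod_cast h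
        linarith
      positivity
    have h4 : ∑ n ∈ R, ((shiftInter A n).card : ℝ) ^ 2 * (lam / 4) ≤ E * (lam / 4) := by
      rw [← sum_mul]
      refine mul_le_mul_of_nonneg_right ?_ (div_nonneg (sum_nonneg fun p _ => hw p) (by norm_num))
      rw [hE, diffEnergy]
      push_cast
      exact sum_le_sum_of_subset_of_nonneg (filter_subset _ _) fun _ _ _ => by positivity
    linarith
  obtain ⟨n, hnR, hn⟩ := hex
  refine ⟨n, by exact_mod_cast (mem_filter.1 hnR).2, ?_⟩
  have hdrop : η * ∑ p ∈ Q with good p ∧ ¬ stuck p n, Real.log p / p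
      ≤ ∑ p ∈ Q, (Real.log p / p * ((residues A p).card / p)
        - Real.log p / p * ((residues (shiftInter A n) p).card / p)) := by
    rw [mul_sum, sum_filter]
    refine sum_le_sum fun p hp => ?_
    have hpp : (0 : ℝ) < p := by exact_mod_cast (hQ p hp).pos
    have hle : ((residues (shiftInter A n) p).card : ℝ)
        + exitCount (residues A p) (n : ZMod p) ≤ (residues A p).card := by
      exact_mod_cast card_residues_shiftInter_add_le A p n
    rw [← mul_sub, ← sub_div]
    split_ifs with h
    · rw [mul_comm]
      refine mul_le_mul_of_nonneg_left ?_ (hw p)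
      rw [le_div_iff₀ hpp]
      have := not_le.1 h.2
      linarith
    · refine mul_nonneg (hw p) (div_nonneg ?_ hpp.le)
      have : (0 : ℝ) ≤ exitCount (residues A p) (n : ZMod p) := by positivity
      linarith
  rw [sum_sub_distrib] at hdrop
  have := mul_le_mul_of_nonneg_left hn hη
  rw [logDensity, logDensity]
  linarith

/-- The additive character `x ↦ exp (2πix)`. -/
noncomputable def unitExp (x : ℝ) : ℂ := Complex.exp (Complex.I * ((2 * Real.pi * x : ℝ) : ℂ))

theorem unitExp_zero : unitExp 0 = 1 := by simp [unitExp]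

theorem unitExp_add (x y : ℝ) : unitExp (x + y) = unitExp x * unitExp y := by
  rw [unitExp, unitExp, unitExp, ← Complex.exp_add]
  push_cast
  ring_nf

theorem norm_unitExp (x : ℝ) : ‖unitExp x‖ = 1 := by
  rw [unitExp, mul_comm, Complex.norm_exp_ofReal_mul_I]

theorem conj_unitExp (x : ℝ) : (starRingEnd ℂ) (unitExp x) = unitExp (-x) := by
  rw [unitExp, unitExp, ← Complex.exp_conj, map_mul, Complex.conj_I, Complex.conj_ofReal]
  push_cast
  ring_nf

theorem unitExp_natCast_mul (n : ℕ) (x : ℝ) : unitExp (n * x) = unitExp x ^ n := by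
  rw [unitExp, unitExp, ← Complex.exp_nat_mul]
  push_cast
  ring_nf

theorem le_norm_unitExp_sub_one {x δ : ℝ} {m : ℤ} (h0 : 0 ≤ δ) (h1 : δ ≤ x - m)
    (h2 : x - m ≤ 1 - δ) : 4 * δ ≤ ‖unitExp x - 1‖ := by
  have hper : unitExp x = unitExp (x - m) := by
    have hm : unitExp (m : ℝ) = 1 := by
      rw [unitExp, Complex.exp_eq_one_iff]
      exact ⟨m, by push_cast; ring⟩
    rw [show x = (x - m) + m by ring, unitExp_add, hm]
    simp
  set t := x - m with ht
  have hsin : 2 * δ ≤ Real.sin (Real.pi * t) := by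
    have key : ∀ y : ℝ, δ ≤ y → y ≤ 1 / 2 → 2 * δ ≤ Real.sin (Real.pi * y) := by
      intro y hy hy2
      have h := Real.mul_le_sin (x := Real.pi * y)
        (mul_nonneg Real.pi_pos.le (h0.trans hy)) (by nlinarith [Real.pi_pos])
      have : 2 / Real.pi * (Real.pi * y) = 2 * y := by
        field_simp
      linarith
    rcases le_total t (1 / 2) with h | h
    · exact key t h1 h
    · have := key (1 - t) (by linarith) (by linarith)
      rwa [mul_sub, mul_one, Real.sin_pi_sub] at this
  rw [hper, unitExp, Complex.norm_exp_I_mul_ofReal_sub_one, Real.norm_eq_abs, abs_mul,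
    show 2 * Real.pi * t / 2 = Real.pi * t by ring, abs_of_pos (by norm_num : (0 : ℝ) < 2)]
  have := le_abs_self (Real.sin (Real.pi * t))
  linarith

theorem norm_sum_unitExp_le {x δ : ℝ} {m : ℤ} (n : ℕ) (h0 : 0 < δ) (h1 : δ ≤ x - m)
    (h2 : x - m ≤ 1 - δ) : ‖∑ j ∈ range n, unitExp (j * x)‖ ≤ 1 / (2 * δ) := by
  have hgeom : (∑ j ∈ range n, unitExp (j * x)) * (unitExp x - 1) = unitExp x ^ n - 1 := by
    simp only [unitExp_natCast_mul]
    exact geom_sum_mul _ _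
  have hnorm : ‖∑ j ∈ range n, unitExp (j * x)‖ * ‖unitExp x - 1‖ ≤ 2 := by
    rw [← norm_mul, hgeom]
    refine (norm_sub_le _ _).trans ?_
    rw [norm_pow, norm_unitExp]
    norm_num
  have h4 := le_norm_unitExp_sub_one h0.le h1 h2
  rw [le_div_iff₀ (by positivity)]
  nlinarith [norm_nonneg (∑ j ∈ range n, unitExp (j * x))]

/-- The exponential sum of `A` at the frequency `θ`. -/
noncomputable def expSum (A : Finset ℤ) (θ : ℝ) : ℂ := ∑ a ∈ A, unitExp (a * θ)

theorem sum_inv_range_le (n : ℕ) : ∑ b ∈ range n, ((b : ℝ))⁻¹ ≤ 1 + Real.log n := by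
  rcases n with _ | n
  · simp
  rw [sum_range_succ']
  have h := harmonic_le_one_add_log n
  have h1 : ∑ k ∈ range n, (((k + 1 : ℕ) : ℝ))⁻¹ = ((harmonic n : ℚ) : ℝ) := by
    simp [harmonic]
  rw [h1]
  have h2 : Real.log n ≤ Real.log (n + 1 : ℕ) := by
    rcases Nat.eq_zero_or_pos n with rfl | hn
    · simp
    · exact Real.log_le_log (by exact_mod_cast hn) (by push_cast; linarith)
  simp only [Nat.cast_zero, inv_zero, add_zero]
  linarith

/-- Frequencies that are `1 / N`-separated modulo `1`. -/
def Separated {ι : Type*} (T : Finset ι) (θ : ι → ℝ) (N : ℕ) : Prop :=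
  ∀ s ∈ T, ∀ t ∈ T, s ≠ t → ∀ m : ℤ, 1 / (N : ℝ) ≤ |θ s - θ t - m|

theorem sum_norm_kernel_le {ι : Type*} {T : Finset ι} {θ : ι → ℝ} {N : ℕ} (hN : 0 < N)
    (hsep : Separated T θ N) (s : ι) :
    ∑ t ∈ T, ‖∑ j ∈ range (2 * N + 1), unitExp (j * (θ s - θ t))‖
      ≤ 8 * N * (1 + Real.log N) := by
  have hN' : (0 : ℝ) < N := by exact_mod_cast hN
  let bin (t : ι) : ℕ := ⌊N * Int.fract (θ s - θ t)⌋₊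
  have hbin0 (t : ι) : (bin t : ℝ) ≤ N * Int.fract (θ s - θ t) :=
    Nat.floor_le (mul_nonneg hN'.le (Int.fract_nonneg _))
  have hbin1 (t : ι) : N * Int.fract (θ s - θ t) < bin t + 1 := Nat.lt_floor_add_one _
  have hbinlt (t : ι) : bin t < N := by
    have h := Int.fract_lt_one (θ s - θ t)
    have : (bin t : ℝ) < N := by nlinarith [hbin0 t]
    exact_mod_cast this
  have hinj : Set.InjOn bin T := by
    intro t ht t' ht' heq
    by_contra hne
    have h := hsep t ht t' ht' hne (⌊θ s - θ t'⌋ - ⌊θ s - θ t⌋)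
    have e : θ t - θ t' - ((⌊θ s - θ t'⌋ - ⌊θ s - θ t⌋ : ℤ) : ℝ)
        = Int.fract (θ s - θ t') - Int.fract (θ s - θ t) := by
      rw [Int.fract, Int.fract]; push_cast; ring
    rw [e, div_le_iff₀ hN'] at h
    have heq' : (bin t : ℝ) = bin t' := by exact_mod_cast heq
    rw [← abs_of_pos hN', ← abs_mul] at h
    have : |(Int.fract (θ s - θ t') - Int.fract (θ s - θ t)) * N| < 1 := by
      rw [abs_lt]
      constructor <;> linarith [hbin0 t, hbin1 t, hbin0 t', hbin1 t']
    linarith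
  let g (b : ℕ) : ℝ := (if b = 0 then (2 * N + 1 : ℝ) else 0)
    + (if b = N - 1 then (2 * N + 1 : ℝ) else 0) + N * (b : ℝ)⁻¹ + N * ((N - 1 - b : ℕ) : ℝ)⁻¹
  have hg0 (b : ℕ) : 0 ≤ g b := by
    simp only [g]
    positivity
  have hterm (t : ι) :
      ‖∑ j ∈ range (2 * N + 1), unitExp (j * (θ s - θ t))‖ ≤ g (bin t) := by
    have hi1 : (0 : ℝ) ≤ N * (bin t : ℝ)⁻¹ := by positivity
    have hi2 : (0 : ℝ) ≤ N * ((N - 1 - bin t : ℕ) : ℝ)⁻¹ := by positivity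
    have htriv : ‖∑ j ∈ range (2 * N + 1), unitExp (j * (θ s - θ t))‖ ≤ 2 * N + 1 := by
      refine (norm_sum_le _ _).trans ?_
      simp [norm_unitExp]
    by_cases h0 : bin t = 0
    · have : g (bin t) ≥ 2 * N + 1 := by
        simp only [g]
        rw [if_pos h0]
        have : (0 : ℝ) ≤ if bin t = N - 1 then (2 * N + 1 : ℝ) else 0 := by positivity
        linarith
      linarith
    by_cases h1 : bin t = N - 1
    · have : g (bin t) ≥ 2 * N + 1 := by
        simp only [g]
        rw [if_pos h1]
        have : (0 : ℝ) ≤ if bin t = 0 then (2 * N + 1 : ℝ) else 0 := by positivity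
        linarith
      linarith
    have hlt := hbinlt t
    set b := bin t with hb
    set c := N - 1 - b with hc
    have hbpos : (1 : ℝ) ≤ b := by exact_mod_cast Nat.one_le_iff_ne_zero.2 h0
    have hcpos : (1 : ℝ) ≤ c := by
      have : 1 ≤ c := by omega
      exact_mod_cast this
    have hsum : (b : ℝ) + c + 1 = N := by
      have : b + c + 1 = N := by omega
      exact_mod_cast this
    have hfr : Int.fract (θ s - θ t) = θ s - θ t - ⌊θ s - θ t⌋ := rfl
    have hlow : (b : ℝ) / N ≤ θ s - θ t - ⌊θ s - θ t⌋ := by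
      rw [div_le_iff₀ hN', ← hfr]; linarith [hbin0 t]
    have hup : θ s - θ t - ⌊θ s - θ t⌋ ≤ 1 - c / N := by
      rw [le_sub_iff_add_le, ← le_sub_iff_add_le', div_le_iff₀ hN', ← hfr]
      linarith [hbin1 t]
    have hgv : g b = N * (b : ℝ)⁻¹ + N * (c : ℝ)⁻¹ := by
      simp only [g]
      rw [if_neg h0, if_neg h1]
      ring
    rw [hgv]
    rcases le_total b c with hbc | hbc
    · have hbc' : (b : ℝ) / N ≤ c / N := by gcongr
      refine (norm_sum_unitExp_le (2 * N + 1) (by positivity) hlow (by linarith)).trans ?_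
      have : 1 / (2 * ((b : ℝ) / N)) = N * (b : ℝ)⁻¹ / 2 := by field_simp
      linarith
    · have hbc' : (c : ℝ) / N ≤ b / N := by gcongr
      refine (norm_sum_unitExp_le (2 * N + 1) (by positivity) (hbc'.trans hlow) hup).trans ?_
      have : 1 / (2 * ((c : ℝ) / N)) = N * (c : ℝ)⁻¹ / 2 := by field_simp
      linarith
  have hlog : 0 ≤ Real.log N := Real.log_natCast_nonneg N
  have hN1 : (1 : ℝ) ≤ N := by exact_mod_cast hN
  calc ∑ t ∈ T, ‖∑ j ∈ range (2 * N + 1), unitExp (j * (θ s - θ t))‖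
      ≤ ∑ t ∈ T, g (bin t) := sum_le_sum fun t _ => hterm t
    _ = ∑ b ∈ T.image bin, g b := (sum_image hinj).symm
    _ ≤ ∑ b ∈ range N, g b := by
        refine sum_le_sum_of_subset_of_nonneg ?_ fun b _ _ => hg0 b
        intro b hb
        obtain ⟨t, -, rfl⟩ := mem_image.1 hb
        exact mem_range.2 (hbinlt t)
    _ = (2 * N + 1) + (2 * N + 1) + N * ∑ b ∈ range N, (b : ℝ)⁻¹
        + N * ∑ b ∈ range N, (b : ℝ)⁻¹ := by
        have hrefl : ∑ b ∈ range N, ((N - 1 - b : ℕ) : ℝ)⁻¹ = ∑ b ∈ range N, (b : ℝ)⁻¹ :=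
          sum_range_reflect (fun b : ℕ => (b : ℝ)⁻¹) N
        simp only [g]
        rw [sum_add_distrib, sum_add_distrib, sum_add_distrib, ← mul_sum, ← mul_sum, hrefl,
          sum_ite_eq', sum_ite_eq', if_pos (mem_range.2 hN), if_pos (mem_range.2 (by omega))]
    _ ≤ 8 * N * (1 + Real.log N) := by
        have := mul_le_mul_of_nonneg_left (sum_inv_range_le N) hN'.le
        nlinarith

/-- Many well-separated large Fourier coefficients force large additive energy. -/
theorem card_mul_pow_four_le_diffEnergy {ι : Type*} {T : Finset ι} {θ : ι → ℝ} {N : ℕ}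
    (hN : 0 < N) (hsep : Separated T θ N) {A : Finset ℤ} (hA : A ⊆ Icc 1 (N : ℤ)) {V : ℝ}
    (hV : 0 ≤ V) (hlarge : ∀ t ∈ T, V ≤ ‖expSum A (θ t)‖) :
    T.card * V ^ 4 ≤ diffEnergy A * (8 * N * (1 + Real.log N)) := by
  set M : ℝ := 8 * N * (1 + Real.log N) with hM
  have hM0 : 0 ≤ M := mul_nonneg (by positivity) (by linarith [Real.log_natCast_nonneg N])
  rcases T.eq_empty_or_nonempty with rfl | hT
  · simpa using mul_nonneg (Nat.cast_nonneg _) hM0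
  have hTpos : (0 : ℝ) < T.card := by exact_mod_cast hT.card_pos
  let f (n : ℤ) : ℂ := ∑ t ∈ T, unitExp (n * θ t)
  have hsq : ((∑ t ∈ T, ‖expSum A (θ t)‖ ^ 2 : ℝ) : ℂ)
      = ∑ n ∈ diffSet A, ((shiftInter A n).card : ℂ) * f n := by
    rw [sum_card_shiftInter_mul]
    simp only [f]
    rw [sum_comm]
    push_cast
    refine sum_congr rfl fun t _ => ?_
    rw [← Complex.conj_mul', expSum, map_sum, sum_mul_sum, ← sum_product']
    refine sum_congr rfl fun x _ => ?_
    rw [conj_unitExp, ← unitExp_add]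
    ring_nf
  have h1 : T.card * V ^ 2 ≤ ∑ n ∈ diffSet A, ((shiftInter A n).card : ℝ) * ‖f n‖ := by
    calc T.card * V ^ 2 = ∑ t ∈ T, V ^ 2 := by rw [sum_const, nsmul_eq_mul]
      _ ≤ ∑ t ∈ T, ‖expSum A (θ t)‖ ^ 2 :=
          sum_le_sum fun t ht => pow_le_pow_left₀ hV (hlarge t ht) 2
      _ = ‖((∑ t ∈ T, ‖expSum A (θ t)‖ ^ 2 : ℝ) : ℂ)‖ := by
          rw [Complex.norm_of_nonneg (sum_nonneg fun _ _ => by positivity)]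
      _ ≤ _ := by
          rw [hsq]
          refine (norm_sum_le _ _).trans (le_of_eq ?_)
          refine sum_congr rfl fun n _ => ?_
          rw [norm_mul, Complex.norm_natCast]
  have h2 : ∑ n ∈ diffSet A, ‖f n‖ ^ 2 ≤ T.card * M := by
    have hsub : diffSet A ⊆ (range (2 * N + 1)).image fun j : ℕ => (j : ℤ) - N := by
      intro n hn
      obtain ⟨⟨x, y⟩, hxy, rfl⟩ := mem_image.1 hn
      rw [mem_product] at hxy
      have h1 := mem_Icc.1 (hA hxy.1)
      have h2 := mem_Icc.1 (hA hxy.2)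
      simp only at h1 h2
      refine mem_image.2 ⟨(y - x + N).toNat, mem_range.2 (by omega), ?_⟩
      simp only
      omega
    have hexp : ((∑ j ∈ range (2 * N + 1), ‖f ((j : ℤ) - N)‖ ^ 2 : ℝ) : ℂ)
        = ∑ s ∈ T, ∑ t ∈ T, unitExp (-(N * (θ s - θ t))) *
          ∑ j ∈ range (2 * N + 1), unitExp (j * (θ s - θ t)) := by
      push_cast
      simp only [mul_sum]
      rw [sum_congr rfl fun s _ => sum_comm, sum_comm]
      refine sum_congr rfl fun j _ => ?_
      rw [← Complex.mul_conj', map_sum, sum_mul_sum]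
      refine sum_congr rfl fun s _ => sum_congr rfl fun t _ => ?_
      rw [conj_unitExp, ← unitExp_add, ← unitExp_add]
      push_cast
      ring_nf
    calc ∑ n ∈ diffSet A, ‖f n‖ ^ 2
        ≤ ∑ n ∈ (range (2 * N + 1)).image fun j : ℕ => (j : ℤ) - N, ‖f n‖ ^ 2 :=
          sum_le_sum_of_subset_of_nonneg hsub fun _ _ _ => by positivity
      _ = ∑ j ∈ range (2 * N + 1), ‖f ((j : ℤ) - N)‖ ^ 2 :=
          sum_image fun i _ j _ h => by simpa using h
      _ = ‖((∑ j ∈ range (2 * N + 1), ‖f ((j : ℤ) - N)‖ ^ 2 : ℝ) : ℂ)‖ := by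
          rw [Complex.norm_of_nonneg (sum_nonneg fun _ _ => by positivity)]
      _ ≤ ∑ s ∈ T, ∑ t ∈ T, ‖∑ j ∈ range (2 * N + 1), unitExp (j * (θ s - θ t))‖ := by
          rw [hexp]
          refine (norm_sum_le _ _).trans (sum_le_sum fun s _ => ?_)
          refine (norm_sum_le _ _).trans (sum_le_sum fun t _ => ?_)
          rw [norm_mul, norm_unitExp, one_mul]
      _ ≤ ∑ s ∈ T, M := sum_le_sum fun s _ => sum_norm_kernel_le hN hsep s
      _ = T.card * M := by rw [sum_const, nsmul_eq_mul]
  have h3 := sum_mul_sq_le_sq_mul_sq (diffSet A) (fun n => ((shiftInter A n).card : ℝ))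
    fun n => ‖f n‖
  have h4 : ∑ n ∈ diffSet A, ((shiftInter A n).card : ℝ) ^ 2 = diffEnergy A := by
    simp [diffEnergy]
  rw [h4] at h3
  have h5 : (T.card * V ^ 2) ^ 2 ≤ diffEnergy A * (T.card * M) :=
    (pow_le_pow_left₀ (by positivity) h1 2).trans
      (h3.trans (mul_le_mul_of_nonneg_left h2 (by positivity)))
  refine le_of_mul_le_mul_left ?_ hTpos
  nlinarith

/-- Minus the part of the Fejér kernel of order `H` with nonzero frequencies. -/
noncomputable def fejerTail (H : ℕ) (φ : ℝ) : ℝ := H - ‖∑ j ∈ range H, unitExp (j * φ)‖ ^ 2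

theorem ofReal_fejerTail (H : ℕ) (φ : ℝ) :
    (fejerTail H φ : ℂ)
      = -∑ x ∈ (range H).offDiag, unitExp (((x.1 : ℝ) - x.2) * φ) := by
  have hsq : ((‖∑ j ∈ range H, unitExp (j * φ)‖ ^ 2 : ℝ) : ℂ)
      = ∑ x ∈ range H ×ˢ range H, unitExp (((x.1 : ℝ) - x.2) * φ) := by
    push_cast
    rw [← Complex.mul_conj', map_sum, sum_mul_sum, ← sum_product']
    refine sum_congr rfl fun x _ => ?_
    rw [conj_unitExp, ← unitExp_add]
    ring_nf
  have hdiag : ∑ x ∈ (range H).diag, unitExp (((x.1 : ℝ) - x.2) * φ) = H := by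
    rw [sum_diag]
    simp [unitExp_zero]
  rw [fejerTail, Complex.ofReal_sub, hsq, ← diag_union_offDiag,
    sum_union (disjoint_diag_offDiag _), hdiag, Complex.ofReal_natCast]
  ring

theorem half_le_fejerTail {H : ℕ} {φ δ : ℝ} {m : ℤ} (hδ : 0 < δ) (hHδ : 1 ≤ 2 * H * δ ^ 2)
    (h1 : δ ≤ φ - m) (h2 : φ - m ≤ 1 - δ) : (H : ℝ) / 2 ≤ fejerTail H φ := by
  have h := pow_le_pow_left₀ (norm_nonneg _) (norm_sum_unitExp_le H hδ h1 h2) 2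
  have h3 : (1 / (2 * δ)) ^ 2 ≤ (H : ℝ) / 2 := by
    rw [div_pow, div_le_iff₀ (by positivity)]
    nlinarith
  rw [fejerTail]
  linarith

theorem exists_norm_sum_prod_fejerTail_le (A : Finset ℤ) {H : ℕ} (hH : 2 ≤ H) (u : ℕ → ℤ)
    (α : ℕ → ℝ) (s : Finset ℕ) (β : ℝ) :
    ∃ l : ℕ → ℤ, (∀ p ∈ s, l p ≠ 0 ∧ |l p| < H) ∧
      ‖∑ a ∈ A, ((∏ p ∈ s, fejerTail H (u p * a / p - α p) : ℝ) : ℂ) * unitExp (a * β)‖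
        ≤ ((H : ℝ) ^ 2) ^ s.card * ‖expSum A (β + ∑ p ∈ s, (l p * u p / p : ℝ))‖ := by
  induction s using Finset.induction_on generalizing β with
  | empty => exact ⟨fun _ => 0, by simp, by simp [expSum]⟩
  | insert q s hq ih =>
    let G (β : ℝ) : ℂ :=
      ∑ a ∈ A, ((∏ p ∈ s, fejerTail H (u p * a / p - α p) : ℝ) : ℂ) * unitExp (a * β)
    have hne : ((range H).offDiag).Nonempty :=
      ⟨(0, 1), by simp only [mem_offDiag, mem_range]; omega⟩
    obtain ⟨x, hx, hmax⟩ := exists_max_image (range H).offDiag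
      (fun x => ‖G (β + ((x.1 : ℝ) - x.2) * u q / q)‖) hne
    obtain ⟨l, hl, hle⟩ := ih (β + ((x.1 : ℝ) - x.2) * u q / q)
    simp only [mem_offDiag, mem_range] at hx
    have hexp : ∑ a ∈ A, ((∏ p ∈ insert q s, fejerTail H (u p * a / p - α p) : ℝ) : ℂ)
          * unitExp (a * β)
        = -∑ x ∈ (range H).offDiag, unitExp (-(((x.1 : ℝ) - x.2) * α q))
            * G (β + ((x.1 : ℝ) - x.2) * u q / q) := by
      simp only [G, mul_sum]
      rw [sum_comm, ← sum_neg_distrib]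
      refine sum_congr rfl fun a _ => ?_
      rw [prod_insert hq, Complex.ofReal_mul, ofReal_fejerTail, neg_mul, neg_mul, sum_mul, sum_mul]
      congr 1
      refine sum_congr rfl fun x _ => ?_
      rw [mul_right_comm, ← unitExp_add, mul_left_comm, ← unitExp_add, mul_comm]
      congr 2
      ring
    refine ⟨Function.update l q (x.1 - x.2), ?_, ?_⟩
    · intro p hp
      rcases eq_or_ne p q with rfl | hpq
      · rw [Function.update_self, abs_lt]
        omega
      · rw [Function.update_of_ne hpq]
        exact hl p (mem_of_mem_insert_of_ne hp hpq)
    · have hsum : β + ∑ p ∈ insert q s, (Function.update l q ((x.1 : ℤ) - x.2) p * u p / p : ℝ)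
          = β + ((x.1 : ℝ) - x.2) * u q / q + ∑ p ∈ s, (l p * u p / p : ℝ) := by
        rw [sum_insert hq, Function.update_self, ← add_assoc]
        push_cast
        congr 1
        refine sum_congr rfl fun p hp => ?_
        rw [Function.update_of_ne (ne_of_mem_of_not_mem hp hq)]
      rw [hsum, hexp, norm_neg, card_insert_of_notMem hq, pow_succ', mul_assoc]
      calc ‖∑ x ∈ (range H).offDiag, unitExp (-(((x.1 : ℝ) - x.2) * α q))
            * G (β + ((x.1 : ℝ) - x.2) * u q / q)‖
          ≤ ∑ y ∈ (range H).offDiag, ‖G (β + ((x.1 : ℝ) - x.2) * u q / q)‖ := by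
            refine (norm_sum_le _ _).trans (sum_le_sum fun y hy => ?_)
            rw [norm_mul, norm_unitExp, one_mul]
            exact hmax y hy
        _ ≤ (H : ℝ) ^ 2 * ‖G (β + ((x.1 : ℝ) - x.2) * u q / q)‖ := by
            rw [sum_const, nsmul_eq_mul]
            refine mul_le_mul_of_nonneg_right ?_ (norm_nonneg _)
            rw [offDiag_card, card_range, sq]
            exact_mod_cast Nat.sub_le _ _
        _ ≤ _ := mul_le_mul_of_nonneg_left hle (by positivity)

theorem exists_le_norm_expSum {A : Finset ℤ} {H : ℕ} (hH : 2 ≤ H) {δ : ℝ} (hδ : 0 < δ)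
    (hHδ : 1 ≤ 2 * H * δ ^ 2) {u : ℕ → ℤ} {α : ℕ → ℝ} {s : Finset ℕ}
    (harc : ∀ p ∈ s, ∀ a ∈ A, ∃ m : ℤ,
      δ ≤ u p * a / p - α p - m ∧ u p * a / p - α p - m ≤ 1 - δ) :
    ∃ l : ℕ → ℤ, (∀ p ∈ s, l p ≠ 0 ∧ |l p| < H) ∧
      A.card * (1 / (2 * H : ℝ)) ^ s.card ≤ ‖expSum A (∑ p ∈ s, (l p * u p / p : ℝ))‖ := by
  obtain ⟨l, hl, hle⟩ := exists_norm_sum_prod_fejerTail_le A hH u α s 0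
  refine ⟨l, hl, ?_⟩
  have hH0 : (0 : ℝ) < H := by exact_mod_cast (by omega : 0 < H)
  have hlow : (A.card : ℝ) * ((H : ℝ) / 2) ^ s.card
      ≤ ∑ a ∈ A, ∏ p ∈ s, fejerTail H (u p * a / p - α p) := by
    rw [← nsmul_eq_mul]
    refine card_nsmul_le_sum _ _ _ fun a ha => ?_
    rw [← prod_const]
    refine prod_le_prod (fun _ _ => by positivity) fun p hp => ?_
    obtain ⟨m, h1, h2⟩ := harc p hp a ha
    exact half_le_fejerTail hδ hHδ h1 h2
  have hre : ∑ a ∈ A, ((∏ p ∈ s, fejerTail H (u p * a / p - α p) : ℝ) : ℂ) * unitExp (a * 0)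
      = ((∑ a ∈ A, ∏ p ∈ s, fejerTail H (u p * a / p - α p) : ℝ) : ℂ) := by
    simp only [mul_zero, unitExp_zero, mul_one]
    push_cast
    rfl
  rw [hre, Complex.norm_real, zero_add] at hle
  have h := hlow.trans ((le_abs_self _).trans hle)
  refine le_of_mul_le_mul_left ?_ (by positivity : (0 : ℝ) < ((H : ℝ) ^ 2) ^ s.card)
  refine le_trans (le_of_eq ?_) h
  rw [mul_left_comm, ← mul_pow]
  congr 2
  field_simp

theorem sum_div_mul_prod {s : Finset ℕ} (hs : ∀ p ∈ s, p ≠ 0) (v : ℕ → ℤ) :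
    (∑ p ∈ s, (v p / p : ℝ)) * ∏ p ∈ s, (p : ℝ)
      = ((∑ p ∈ s, v p * ∏ q ∈ s.erase p, (q : ℤ) : ℤ) : ℝ) := by
  push_cast
  rw [sum_mul]
  refine sum_congr rfl fun p hp => ?_
  have : (p : ℝ) ≠ 0 := by exact_mod_cast hs p hp
  rw [← mul_prod_erase s _ hp]
  field_simp

theorem not_dvd_sum_mul_prod_erase {s s' : Finset ℕ} (hs : ∀ p ∈ s, p.Prime)
    (hs' : ∀ p ∈ s', p.Prime) {v : ℕ → ℤ} {q : ℕ} (hq : q ∈ s) (hq' : q ∉ s')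
    (hv : ¬ (q : ℤ) ∣ v q) :
    ¬ (q : ℤ) ∣ (∑ p ∈ s, v p * ∏ r ∈ s.erase p, (r : ℤ)) * ∏ p ∈ s', (p : ℤ) := by
  have hqp := Nat.prime_iff_prime_int.1 (hs q hq)
  have hprod {t : Finset ℕ} (ht : ∀ p ∈ t, p.Prime) (hqt : q ∉ t) :
      ¬ (q : ℤ) ∣ ∏ p ∈ t, (p : ℤ) := by
    intro h
    obtain ⟨p, hp, hdvd⟩ := hqp.exists_mem_finset_dvd h
    rw [Int.natCast_dvd_natCast, Nat.prime_dvd_prime_iff_eq (hs q hq) (ht p hp)] at hdvd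
    exact hqt (hdvd ▸ hp)
  intro h
  rcases hqp.dvd_or_dvd h with h | h
  · rw [← add_sum_erase s _ hq] at h
    have hrest : (q : ℤ) ∣ ∑ p ∈ s.erase q, v p * ∏ r ∈ s.erase p, (r : ℤ) :=
      dvd_sum fun p hp => Dvd.dvd.mul_left
        (dvd_prod_of_mem (fun r : ℕ => (r : ℤ)) (mem_erase.2 ⟨(ne_of_mem_erase hp).symm, hq⟩)) _
    rcases hqp.dvd_or_dvd ((dvd_add_left hrest).1 h) with h | h
    · exact hv h
    · exact hprod (fun p hp => hs p (mem_of_mem_erase hp)) (notMem_erase q s) h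
  · exact hprod hs' hq' h

theorem one_div_le_abs_sum_div_sub {s s' : Finset ℕ} (hs : ∀ p ∈ s, p.Prime)
    (hs' : ∀ p ∈ s', p.Prime) {v v' : ℕ → ℤ} (hv : ∀ p ∈ s, ¬ (p : ℤ) ∣ v p)
    (hcard : s.card = s'.card) (hne : s ≠ s') {N : ℕ}
    (hN : (∏ p ∈ s, p) * ∏ p ∈ s', p ≤ N) (m : ℤ) :
    1 / (N : ℝ) ≤ |∑ p ∈ s, (v p / p : ℝ) - ∑ p ∈ s', (v' p / p : ℝ) - m| := by
  obtain ⟨q, hq, hq'⟩ : ∃ q ∈ s, q ∉ s' := by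
    by_contra! h
    exact hne (eq_of_subset_of_card_le h hcard.ge)
  have hP : (0 : ℝ) < ∏ p ∈ s, (p : ℝ) :=
    prod_pos fun p hp => by exact_mod_cast (hs p hp).pos
  have hP' : (0 : ℝ) < ∏ p ∈ s', (p : ℝ) :=
    prod_pos fun p hp => by exact_mod_cast (hs' p hp).pos
  have hN' : (∏ p ∈ s, (p : ℝ)) * ∏ p ∈ s', (p : ℝ) ≤ N := by
    have := (Nat.cast_le (α := ℝ)).2 hN
    push_cast at this
    exact this
  have hN0 : (0 : ℝ) < N := (mul_pos hP hP').trans_le hN'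
  set z : ℤ := (∑ p ∈ s, v p * ∏ r ∈ s.erase p, (r : ℤ)) * ∏ p ∈ s', (p : ℤ)
    - (∏ p ∈ s, (p : ℤ)) * (∑ p ∈ s', v' p * ∏ r ∈ s'.erase p, (r : ℤ)
      + m * ∏ p ∈ s', (p : ℤ)) with hz
  have hzeq : (∑ p ∈ s, (v p / p : ℝ) - ∑ p ∈ s', (v' p / p : ℝ) - m)
      * ((∏ p ∈ s, (p : ℝ)) * ∏ p ∈ s', (p : ℝ)) = z := by
    have h1 := sum_div_mul_prod (fun p hp => (hs p hp).ne_zero) v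
    have h2 := sum_div_mul_prod (fun p hp => (hs' p hp).ne_zero) v'
    rw [hz, Int.cast_sub, Int.cast_mul, Int.cast_mul, Int.cast_add, ← h1, ← h2]
    push_cast
    ring
  have hz0 : z ≠ 0 := by
    intro h0
    refine not_dvd_sum_mul_prod_erase hs hs' hq hq' (hv q hq) ?_
    rw [sub_eq_zero.1 h0]
    exact Dvd.dvd.mul_right (dvd_prod_of_mem (fun r : ℕ => (r : ℤ)) hq) _
  have h1 : (1 : ℝ) ≤ |(z : ℝ)| := by exact_mod_cast Int.one_le_abs hz0
  rw [← hzeq, abs_mul, abs_of_pos (mul_pos hP hP')] at h1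
  rw [div_le_iff₀ hN0]
  exact h1.trans (mul_le_mul_of_nonneg_left hN' (abs_nonneg _))

theorem InAP.card_le {p : ℕ} {S : Finset (ZMod p)} {t : ℝ} (h : InAP S t) :
    (S.card : ℝ) ≤ t := by
  obtain ⟨L, x, d, -, hL, hS⟩ := h
  refine le_trans ?_ hL
  exact_mod_cast (card_le_card hS).trans (card_image_le.trans (card_range L).le)

/-- After a dilation, a short progression lies on a short arc. -/
theorem InAP.exists_dilate {p : ℕ} (hp : p.Prime) {S : Finset (ZMod p)} {ε : ℝ}
    (h : InAP S ((1 - ε) * p)) :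
    ∃ (u : ℤ) (α : ℝ), ¬ (p : ℤ) ∣ u ∧ ∀ a : ℤ, (a : ZMod p) ∈ S → ∃ m : ℤ,
      ε / 2 ≤ u * a / p - α - m ∧ u * a / p - α - m ≤ 1 - ε / 2 := by
  have : Fact p.Prime := ⟨hp⟩
  obtain ⟨L, x, d, hd, hL, hS⟩ := h
  have hp0 : (0 : ℝ) < p := by exact_mod_cast hp.pos
  refine ⟨(d⁻¹).val, (d⁻¹ * x).val / p - ε / 2, ?_, fun a ha => ?_⟩
  · rw [← ZMod.intCast_zmod_eq_zero_iff_dvd]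
    simpa using hd
  · obtain ⟨j, hj, hja⟩ := mem_image.1 (hS ha)
    have hmod : (((d⁻¹).val * a - (d⁻¹ * x).val - j : ℤ) : ZMod p) = 0 := by
      push_cast
      rw [← hja, ZMod.natCast_zmod_val, ZMod.natCast_zmod_val]
      field_simp
      ring
    obtain ⟨m, hm⟩ := (ZMod.intCast_zmod_eq_zero_iff_dvd _ _).1 hmod
    have hm' : ((d⁻¹).val : ℝ) * a = p * m + j + (d⁻¹ * x).val := by
      have : ((d⁻¹).val : ℝ) * a - (d⁻¹ * x).val - j = p * m := by exact_mod_cast hm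
      linarith
    refine ⟨m, ?_⟩
    have e : ((((d⁻¹).val : ℤ) : ℝ) * a / p - ((d⁻¹ * x).val / p - ε / 2) - m : ℝ)
        = j / p + ε / 2 := by
      rw [Int.cast_natCast, hm']
      generalize ((d⁻¹ * x).val : ℝ) = w
      field_simp
      ring
    rw [e]
    have hj1 : (j : ℝ) / p ≤ 1 - ε := by
      rw [div_le_iff₀ hp0]
      exact le_trans (by exact_mod_cast (mem_range.1 hj).le) hL
    have : (0 : ℝ) ≤ j / p := by positivity
    constructor <;> linarith

theorem exists_le_sum_log_div_filter :
    ∃ C : ℝ, 0 ≤ C ∧ ∀ y w : ℝ, 1 ≤ y → 1 ≤ w → ∀ Ps : Finset ℕ, (∀ p ∈ Ps, p.Prime) →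
      Real.log y - Real.log w - C - ∑ p ∈ primesUpTo y with p ∉ Ps, Real.log p / p
        ≤ ∑ p ∈ Ps with w < (p : ℕ), Real.log p / p := by
  obtain ⟨C, hC⟩ := exists_log_sub_le_sum_log_div
  refine ⟨max C 0 + Real.log 2 + 2, ?_, fun y w hy hw Ps hPs => ?_⟩
  · have := Real.log_nonneg (by norm_num : (1 : ℝ) ≤ 2)
    positivity
  have hnn (p : ℕ) : 0 ≤ Real.log p / p := div_nonneg (Real.log_natCast_nonneg p) p.cast_nonneg
  have hy1 : 1 ≤ ⌊y⌋₊ := Nat.one_le_floor_iff y |>.2 hy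
  have hw1 : 1 ≤ ⌊w⌋₊ := Nat.one_le_floor_iff w |>.2 hw
  have hfy : Real.log y - Real.log 2 ≤ Real.log ⌊y⌋₊ := by
    rw [← Real.log_div (by positivity) (by norm_num)]
    refine Real.log_le_log (by positivity) ?_
    have h1 : (1 : ℝ) ≤ ⌊y⌋₊ := by exact_mod_cast hy1
    linarith [Nat.lt_floor_add_one y]
  have hfw : Real.log ⌊w⌋₊ ≤ Real.log w :=
    Real.log_le_log (by exact_mod_cast hw1) (Nat.floor_le (by positivity))
  have h1 := hC ⌊y⌋₊ hy1
  have h2 := sum_log_div_le ⌊w⌋₊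
  have hcov : primesUpTo y ⊆ ((primesUpTo y).filter (fun p => p ∉ Ps)
      ∪ Ps.filter fun p : ℕ => w < (p : ℝ)) ∪ primesUpTo w := by
    intro p hp
    have hpr : p.Prime := (mem_filter.1 hp).2
    simp only [mem_union, mem_filter]
    by_cases h : p ∈ Ps
    · rcases lt_or_ge w p with hlt | hle
      · exact Or.inl (Or.inr ⟨h, hlt⟩)
      · exact Or.inr (mem_filter.2 ⟨mem_range.2 (Nat.lt_succ_of_le (Nat.le_floor hle)), hpr⟩)
    · exact Or.inl (Or.inl ⟨hp, h⟩)
  have hunion (s t : Finset ℕ) : ∑ p ∈ s ∪ t, Real.log p / p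
      ≤ ∑ p ∈ s, Real.log p / p + ∑ p ∈ t, Real.log p / p := by
    rw [← sum_union_inter]
    exact le_add_of_nonneg_right (sum_nonneg fun p _ => hnn p)
  have h3 := (sum_le_sum_of_subset_of_nonneg hcov fun p _ _ => hnn p).trans
    ((hunion _ _).trans (add_le_add_left (hunion _ _) _))
  unfold primesUpTo at h3 ⊢
  linarith [le_max_left C 0]

theorem choose_mul_le_diffEnergy {A : Finset ℤ} {N : ℕ} (hN : 0 < N) (hA : A ⊆ Icc 1 (N : ℤ))
    {k H : ℕ} (hk : 0 < k) (hH : 2 ≤ H) {ε : ℝ} (hε : 0 < ε) (hHε : 1 ≤ 2 * H * (ε / 2) ^ 2)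
    {Q : Finset ℕ} (hQ : ∀ p ∈ Q, p.Prime) (hQH : ∀ p ∈ Q, H ≤ p)
    (hQN : ∀ p ∈ Q, p ^ (2 * k) ≤ N) (hres : ∀ p ∈ Q, InAP (residues A p) ((1 - ε) * p)) :
    (Q.card.choose k : ℝ) * (A.card * (1 / (2 * H : ℝ)) ^ k) ^ 4
      ≤ diffEnergy A * (8 * N * (1 + Real.log N)) := by
  have harc (p : ℕ) : ∃ (u : ℤ) (α : ℝ), p ∈ Q → ¬ (p : ℤ) ∣ u ∧ ∀ a ∈ A, ∃ m : ℤ,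
      ε / 2 ≤ u * a / p - α - m ∧ u * a / p - α - m ≤ 1 - ε / 2 := by
    by_cases hp : p ∈ Q
    · obtain ⟨u, α, hu, h⟩ := (hres p hp).exists_dilate (hQ p hp)
      exact ⟨u, α, fun _ => ⟨hu, fun a ha => h a (mem_image_of_mem _ ha)⟩⟩
    · exact ⟨0, 0, fun h => absurd h hp⟩
  choose u α harc using harc
  have hfreq (s : Finset ℕ) : ∃ l : ℕ → ℤ, s ⊆ Q → (∀ p ∈ s, l p ≠ 0 ∧ |l p| < H) ∧
      A.card * (1 / (2 * H : ℝ)) ^ s.card ≤ ‖expSum A (∑ p ∈ s, (l p * u p / p : ℝ))‖ := by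
    by_cases hs : s ⊆ Q
    · obtain ⟨l, hl⟩ := exists_le_norm_expSum hH (half_pos hε) hHε
        fun p hp => (harc p (hs hp)).2
      exact ⟨l, fun _ => hl⟩
    · exact ⟨0, fun h => absurd h hs⟩
  choose l hl using hfreq
  have hmem {s : Finset ℕ} (hs : s ∈ powersetCard k Q) : s ⊆ Q ∧ s.card = k := mem_powersetCard.1 hs
  rw [← card_powersetCard]
  refine card_mul_pow_four_le_diffEnergy hN (θ := fun s => ∑ p ∈ s, (l s p * u p / p : ℝ))
    ?_ hA (by positivity) fun s hs => ?_
  · intro s hs s' hs' hne m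
    obtain ⟨hsQ, hsk⟩ := hmem hs
    obtain ⟨hsQ', hsk'⟩ := hmem hs'
    have h := one_div_le_abs_sum_div_sub (fun p hp => hQ p (hsQ hp)) (fun p hp => hQ p (hsQ' hp))
      (v := fun p => l s p * u p) (v' := fun p => l s' p * u p) (N := N) ?_ (hsk.trans hsk'.symm)
      hne ?_ m
    · simpa only [Int.cast_mul] using h
    · intro p hp hdvd
      rcases (Nat.prime_iff_prime_int.1 (hQ p (hsQ hp))).dvd_or_dvd hdvd with h | h
      · obtain ⟨h0, h1⟩ := (hl s hsQ).1 p hp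
        have h2 := Int.le_of_dvd (abs_pos.2 h0) ((dvd_abs _ _).2 h)
        have h3 : (H : ℤ) ≤ p := by exact_mod_cast hQH p (hsQ hp)
        omega
      · exact (harc p (hsQ hp)).1 h
    · have hprod {t : Finset ℕ} (ht : t ⊆ Q) (htk : t.card = k) :
          (∏ p ∈ t, p) ^ (2 * k) ≤ N ^ k := by
        rw [← prod_pow, ← htk]
        exact prod_le_pow_card _ _ _ fun p hp => htk ▸ hQN p (ht hp)
      refine le_of_pow_le_pow_left₀ (n := 2 * k) (by omega) (Nat.zero_le _) ?_
      rw [mul_pow, two_mul k, pow_add N, ← two_mul]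
      exact Nat.mul_le_mul (hprod hsQ hsk) (hprod hsQ' hsk')
  · obtain ⟨hsQ, hsk⟩ := hmem hs
    have h := (hl s hsQ).2
    rwa [hsk] at h

theorem eventually_mul_log_pow_le (c : ℝ) (n : ℕ) {r : ℝ} (hr : 0 < r) :
    ∀ᶠ N : ℕ in Filter.atTop, c * Real.log N ^ n ≤ (N : ℝ) ^ r := by
  have h := (isLittleO_log_rpow_rpow_atTop (n : ℝ) hr).bound
    (by positivity : (0 : ℝ) < 1 / (|c| + 1))
  filter_upwards [tendsto_natCast_atTop_atTop.eventually h] with N hN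
  have h0 := Real.log_natCast_nonneg N
  rw [Real.rpow_natCast, Real.norm_of_nonneg (by positivity), Real.norm_of_nonneg (by positivity),
    div_mul_eq_mul_div, one_mul, le_div_iff₀ (by positivity)] at hN
  nlinarith [le_abs_self c, pow_nonneg h0 n]

theorem eventually_le_log (c : ℝ) : ∀ᶠ N : ℕ in Filter.atTop, c ≤ Real.log N :=
  (Real.tendsto_log_atTop.comp tendsto_natCast_atTop_atTop).eventually_ge_atTop c

theorem eventually_le_diffEnergy {k : ℕ} (hk : 0 < k) {ε δ : ℝ} (hε : 0 < ε) (hδ : 0 < δ)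
    (hδ1 : δ < 1) :
    ∀ᶠ N : ℕ in Filter.atTop, ∀ Ps : Finset ℕ,
      (∀ p ∈ Ps, p.Prime ∧ (p : ℝ) ≤ (N : ℝ) ^ ((1 : ℝ) / (2 * k))) →
      (∑ p ∈ primesUpTo ((N : ℝ) ^ ((1 : ℝ) / (2 * k))) with p ∉ Ps, Real.log p / p)
        ≤ δ / (4 * k) * Real.log N →
      ∀ A : Finset ℤ, A ⊆ Icc 1 (N : ℤ) →
        (∀ p ∈ Ps, InAP (residues A p) ((1 - ε) * p)) →
        (A.card : ℝ) ^ 4 * (N : ℝ) ^ (-(1 / 2) - δ) ≤ diffEnergy A := by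
  obtain ⟨C, hC0, hC⟩ := exists_le_sum_log_div_filter
  obtain ⟨H, hH2, hHε⟩ : ∃ H : ℕ, 2 ≤ H ∧ 1 ≤ 2 * H * (ε / 2) ^ 2 := by
    obtain ⟨H, hH⟩ := exists_nat_ge (max 2 (1 / (2 * (ε / 2) ^ 2)))
    refine ⟨H, by exact_mod_cast (le_max_left _ _).trans hH, ?_⟩
    have := (le_max_right _ _).trans hH
    rw [div_le_iff₀ (by positivity)] at this
    linarith
  have hk0 : (0 : ℝ) < k := by exact_mod_cast hk
  have hr : 0 < (1 - δ) / (2 * k) := div_pos (by linarith) (by positivity)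
  filter_upwards [eventually_mul_log_pow_le (H : ℝ) 0 hr,
    eventually_mul_log_pow_le (2 * k : ℝ) 1 hr,
    eventually_mul_log_pow_le (16 * 2 ^ k * k.factorial * (2 * H) ^ (4 * k)) (k + 1) (half_pos hδ),
    eventually_le_log 1, eventually_le_log ((C + 1) / (δ / (4 * k))),
    Filter.eventually_gt_atTop 0] with N h1 h2 h3 h4 h5 hN Ps hPs hmiss A hA hres
  set L := Real.log N with hL
  set w : ℝ := (N : ℝ) ^ ((1 - δ) / (2 * k)) with hw
  have hN0 : (0 : ℝ) < N := by exact_mod_cast hN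
  have hN1 : (1 : ℝ) ≤ N := by exact_mod_cast hN
  rw [pow_zero, mul_one] at h1
  rw [pow_one] at h2
  rw [div_le_iff₀ (by positivity)] at h5
  have hw1 : 1 ≤ w := Real.one_le_rpow hN1 hr.le
  set Q := Ps.filter fun p : ℕ => w < (p : ℝ) with hQdef
  have hQmem {p : ℕ} (hp : p ∈ Q) : p ∈ Ps ∧ w < p := mem_filter.1 hp
  have hmass : 1 ≤ ∑ p ∈ Q, Real.log p / p := by
    have h := hC ((N : ℝ) ^ ((1 : ℝ) / (2 * k))) w (Real.one_le_rpow hN1 (by positivity)) hw1 Ps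
      fun p hp => (hPs p hp).1
    rw [hw, Real.log_rpow hN0, Real.log_rpow hN0] at h
    have e : 1 / (2 * k) * L - (1 - δ) / (2 * k) * L = 2 * (δ / (4 * k) * L) := by
      field_simp; ring
    rw [← hL, e] at h
    linarith
  have hcardQ : w ≤ Q.card * L := by
    have hle : ∑ p ∈ Q, Real.log p / p ≤ ∑ p ∈ Q, L / w := by
      refine sum_le_sum fun p hp => ?_
      obtain ⟨hpP, hwp⟩ := hQmem hp
      have hpN : (p : ℝ) ≤ N := (hPs p hpP).2.trans <| by
        conv_rhs => rw [← Real.rpow_one (N : ℝ)]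
        refine Real.rpow_le_rpow_of_exponent_le hN1 ?_
        rw [div_le_one (by positivity)]
        have : (1 : ℝ) ≤ k := by exact_mod_cast hk
        linarith
      have hp0 : (0 : ℝ) < p := by linarith
      exact div_le_div₀ (by linarith) (Real.log_le_log hp0 hpN) (by linarith) hwp.le
    rw [sum_const, nsmul_eq_mul] at hle
    have := hmass.trans hle
    rwa [mul_div_assoc', le_div_iff₀ (by linarith), one_mul] at this
  have hL0 : 0 < L := by linarith
  have h2k : 2 * k ≤ Q.card := by
    have : (2 * k : ℝ) ≤ Q.card := le_of_mul_le_mul_right (h2.trans hcardQ) hL0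
    exact_mod_cast this
  have hchoose : (N : ℝ) ^ ((1 - δ) / 2) ≤ (2 * L) ^ k * k.factorial * Q.card.choose k := by
    have hb := Nat.pow_le_choose (α := ℝ) k Q.card
    rw [div_le_iff₀ (by positivity)] at hb
    have hc : w ≤ 2 * L * ((Q.card + 1 - k : ℕ) : ℝ) := by
      have : (Q.card : ℝ) ≤ 2 * ((Q.card + 1 - k : ℕ) : ℝ) := by exact_mod_cast (by omega)
      nlinarith
    have e : (N : ℝ) ^ ((1 - δ) / 2) = w ^ k := by
      rw [hw, ← Real.rpow_natCast, ← Real.rpow_mul hN0.le]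
      congr 1
      field_simp
    rw [e]
    refine (pow_le_pow_left₀ (by linarith) hc k).trans ?_
    rw [mul_pow (2 * L), mul_assoc]
    refine mul_le_mul_of_nonneg_left ?_ (by positivity)
    rw [mul_comm]
    linarith
  have hmain := choose_mul_le_diffEnergy hN hA hk hH2 hε hHε (Q := Q)
    (fun p hp => (hPs p (hQmem hp).1).1)
    (fun p hp => by exact_mod_cast h1.trans (hQmem hp).2.le)
    (fun p hp => by
      have h := pow_le_pow_left₀ p.cast_nonneg (hPs p (hQmem hp).1).2 (2 * k)
      rw [← Real.rpow_natCast ((N : ℝ) ^ _), ← Real.rpow_mul hN0.le] at h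
      push_cast at h
      rw [one_div_mul_cancel (by positivity), Real.rpow_one] at h
      exact_mod_cast h)
    fun p hp => hres p (hQmem hp).1
  set E : ℝ := (diffEnergy A : ℝ)
  set X : ℝ := (A.card : ℝ) ^ 4 with hX
  have hH0 : (0 : ℝ) < 2 * H := by
    have : (2 : ℝ) ≤ H := by exact_mod_cast hH2
    linarith
  have hmain' : (Q.card.choose k : ℝ) * X ≤ E * (8 * N * (1 + L)) * (2 * H) ^ (4 * k) := by
    refine le_trans (le_of_eq ?_) (mul_le_mul_of_nonneg_right hmain (by positivity))
    rw [mul_pow, ← hX, ← pow_mul, mul_comm k 4, one_div, inv_pow]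
    field_simp
  have hE0 : 0 ≤ E := Nat.cast_nonneg _
  have hfin : (N : ℝ) ^ ((1 - δ) / 2) * X ≤ E * N * (N : ℝ) ^ (δ / 2) := by
    calc (N : ℝ) ^ ((1 - δ) / 2) * X
        ≤ (2 * L) ^ k * k.factorial * Q.card.choose k * X :=
          mul_le_mul_of_nonneg_right hchoose (by positivity)
      _ = (2 * L) ^ k * k.factorial * (Q.card.choose k * X) := by ring
      _ ≤ (2 * L) ^ k * k.factorial * (E * (8 * N * (1 + L)) * (2 * H) ^ (4 * k)) :=
          mul_le_mul_of_nonneg_left hmain' (by positivity)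
      _ ≤ (2 * L) ^ k * k.factorial * (E * (8 * N * (2 * L)) * (2 * H) ^ (4 * k)) := by
          gcongr
          linarith
      _ = E * N * (16 * 2 ^ k * k.factorial * (2 * H) ^ (4 * k) * L ^ (k + 1)) := by ring
      _ ≤ E * N * (N : ℝ) ^ (δ / 2) := mul_le_mul_of_nonneg_left h3 (by positivity)
  have hP : 0 < (N : ℝ) ^ (1 + δ / 2) := by positivity
  refine le_of_mul_le_mul_right ?_ hP
  rw [mul_assoc, ← Real.rpow_add hN0, Real.rpow_add hN0 1, Real.rpow_one,
    show -(1 / 2) - δ + (1 + δ / 2) = (1 - δ) / 2 by ring]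
  linarith

theorem InAP.mono {p : ℕ} {S S' : Finset (ZMod p)} {t : ℝ} (h : InAP S t) (hS : S' ⊆ S) :
    InAP S' t := by
  obtain ⟨L, x, d, hd, hL, hsub⟩ := h
  exact ⟨L, x, d, hd, hL, hS.trans hsub⟩

theorem exists_subset_logDensity_le {A : Finset ℤ} {N : ℕ} (hN : 0 < N) {Q : Finset ℕ}
    {δ D : ℝ} (hδ : 0 < δ) (hNδ : 4 ≤ (N : ℝ) ^ δ) (hA : (N : ℝ) ^ (1 / 2 - δ) ≤ A.card)
    (hstep : ∀ B ⊆ A, (N : ℝ) ^ (7 / 16 : ℝ) ≤ B.card → ∃ B' ⊆ B,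
      (B.card : ℝ) ^ 2 * (N : ℝ) ^ (-(1 / 2) - δ) ≤ 4 * B'.card ∧
      logDensity Q B' ≤ logDensity Q B - D)
    (K : ℕ) (hK : 4 ^ K * δ ≤ 1 / 16) :
    ∃ B ⊆ A, (N : ℝ) ^ (1 / 2 - 4 ^ K * δ) ≤ B.card ∧
      logDensity Q B ≤ logDensity Q A - K * D := by
  induction K with
  | zero => exact ⟨A, Subset.rfl, by simpa using hA, by simp⟩
  | succ K ih =>
    have hN0 : (0 : ℝ) < N := by exact_mod_cast hN
    have hN1 : (1 : ℝ) ≤ N := by exact_mod_cast hN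
    have h4K : (1 : ℝ) ≤ 4 ^ K := one_le_pow₀ (by norm_num)
    rw [pow_succ] at hK
    obtain ⟨B, hBA, hB, hBQ⟩ := ih (by nlinarith)
    obtain ⟨B', hB', hcard, hdens⟩ := hstep B hBA
      ((Real.rpow_le_rpow_of_exponent_le hN1 (by nlinarith)).trans hB)
    refine ⟨B', hB'.trans hBA, ?_, ?_⟩
    · have h1 := pow_le_pow_left₀ (by positivity) hB 2
      have h2 : (N : ℝ) ^ (1 / 2 - 4 ^ (K + 1) * δ) * 4
          ≤ ((N : ℝ) ^ (1 / 2 - 4 ^ K * δ)) ^ 2 * (N : ℝ) ^ (-(1 / 2) - δ) := by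
        refine (mul_le_mul_of_nonneg_left hNδ (by positivity)).trans ?_
        rw [← Real.rpow_natCast ((N : ℝ) ^ _), ← Real.rpow_mul hN0.le, ← Real.rpow_add hN0,
          ← Real.rpow_add hN0]
        refine Real.rpow_le_rpow_of_exponent_le hN1 ?_
        rw [pow_succ]
        push_cast
        nlinarith
      have h3 := mul_le_mul_of_nonneg_right h1
        (by positivity : (0 : ℝ) ≤ (N : ℝ) ^ (-(1 / 2) - δ))
      linarith
    · push_cast
      linarith

theorem logDensity_nonneg (Q : Finset ℕ) (A : Finset ℤ) : 0 ≤ logDensity Q A :=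
  sum_nonneg fun p _ => mul_nonneg
    (div_nonneg (Real.log_natCast_nonneg p) p.cast_nonneg) (by positivity)

theorem logDensity_le {Q : Finset ℕ} (hQ : ∀ p ∈ Q, p.Prime) (A : Finset ℤ) :
    logDensity Q A ≤ ∑ p ∈ Q, Real.log p / p := by
  refine sum_le_sum fun p hp => ?_
  have : NeZero p := ⟨(hQ p hp).ne_zero⟩
  refine mul_le_of_le_one_right (div_nonneg (Real.log_natCast_nonneg p) p.cast_nonneg) ?_
  refine div_le_one_of_le₀ ?_ p.cast_nonneg
  exact_mod_cast (card_le_univ _).trans (ZMod.card p).le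

theorem sum_log_le_of_le_rpow {Q : Finset ℕ} {N : ℕ} (hQ0 : ∀ p ∈ Q, 0 < p) {r : ℝ}
    (hr : r ≤ 1) (hQ : ∀ p ∈ Q, (p : ℝ) ≤ (N : ℝ) ^ r) (hN : 0 < N) :
    ∑ p ∈ Q, Real.log p ≤ (N : ℝ) ^ r * Real.log N := by
  have hN1 : (1 : ℝ) ≤ N := by exact_mod_cast hN
  have hcard : (Q.card : ℝ) ≤ (N : ℝ) ^ r := by
    have hsub : Q ⊆ Icc 1 ⌊(N : ℝ) ^ r⌋₊ := fun p hp =>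
      mem_Icc.2 ⟨hQ0 p hp, Nat.le_floor (hQ p hp)⟩
    refine le_trans ?_ (Nat.floor_le (by positivity))
    exact_mod_cast (card_le_card hsub).trans (by simp)
  calc ∑ p ∈ Q, Real.log p ≤ ∑ p ∈ Q, Real.log N := by
        refine sum_le_sum fun p hp => Real.log_le_log (by exact_mod_cast hQ0 p hp) ?_
        refine (hQ p hp).trans ?_
        simpa using Real.rpow_le_rpow_of_exponent_le hN1 hr
    _ = Q.card * Real.log N := by rw [sum_const, nsmul_eq_mul]
    _ ≤ _ := mul_le_mul_of_nonneg_right hcard (Real.log_natCast_nonneg N)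

theorem exists_eventually_card_le {k : ℕ} (hk : 2 ≤ k) {ε : ℝ} (hε : 0 < ε) :
    ∃ c > 0, ∀ᶠ N : ℕ in Filter.atTop, ∀ Ps : Finset ℕ,
      (∀ p ∈ Ps, p.Prime ∧ (p : ℝ) ≤ (N : ℝ) ^ ((1 : ℝ) / (2 * k))) →
      (∑ p ∈ primesUpTo ((N : ℝ) ^ ((1 : ℝ) / (2 * k))) with p ∉ Ps, Real.log p / p)
        ≤ c * Real.log N →
      ∀ A : Finset ℤ, A ⊆ Icc 1 (N : ℤ) →
        (∀ p ∈ Ps, InAP (residues A p) ((1 - ε) * p)) →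
        (A.card : ℝ) ≤ (N : ℝ) ^ ((1 : ℝ) / 2 - c) := by
  obtain ⟨C₀, hC₀, hmass⟩ := exists_le_sum_log_div_filter
  have hk0 : (2 : ℝ) ≤ k := by exact_mod_cast hk
  set C : ℕ := 16 * k with hCdef
  have hC : (0 : ℝ) < C := by rw [hCdef]; push_cast; linarith
  set η : ℝ := ε / (8 * C ^ 2) with hη
  have hη0 : 0 < η := by positivity
  obtain ⟨K, hK⟩ := exists_nat_gt (4 / η)
  rw [div_lt_iff₀ hη0] at hK
  set δ : ℝ := 1 / (16 * 4 ^ K) with hδ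
  have h4K : (1 : ℝ) ≤ 4 ^ K := one_le_pow₀ (by norm_num)
  have hδ0 : 0 < δ := by positivity
  have hδK : 4 ^ K * δ ≤ 1 / 16 := by rw [hδ]; field_simp; exact le_rfl
  have hδ16 : δ ≤ 1 / 16 := by nlinarith
  have hcδ : δ / (4 * k) ≤ δ := div_le_self hδ0.le (by linarith)
  have hck : δ / (4 * k) ≤ 1 / (8 * k) := by
    rw [div_le_div_iff₀ (by positivity) (by positivity)]
    nlinarith
  refine ⟨δ / (4 * k), by positivity, ?_⟩
  filter_upwards [eventually_le_diffEnergy (k := k) (by omega) hε hδ0 (by linarith),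
    eventually_mul_log_pow_le 4 0 hδ0,
    eventually_mul_log_pow_le 1 1 (r := 1 / 16) (by norm_num), eventually_le_log 1,
    eventually_le_log ((Real.log (4 * C) + C₀) * (8 * k)), Filter.eventually_gt_atTop 0]
    with N henergy h1 h2 h3 h4 hN Ps hPs hmiss A hA hres
  rw [pow_zero, mul_one] at h1
  rw [pow_one, one_mul] at h2
  set L := Real.log N with hL
  have hN0 : (0 : ℝ) < N := by exact_mod_cast hN
  have hN1 : (1 : ℝ) ≤ N := by exact_mod_cast hN
  by_contra! hbig
  set Q := Ps.filter fun p : ℕ => (4 * C : ℝ) < (p : ℝ) with hQdef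
  have hQmem {p : ℕ} (hp : p ∈ Q) : p ∈ Ps ∧ (4 * C : ℝ) < p := mem_filter.1 hp
  have hQprime : ∀ p ∈ Q, p.Prime := fun p hp => (hPs p (hQmem hp).1).1
  set lam := ∑ p ∈ Q, Real.log p / p with hlam
  have hlamL : L / (4 * k) ≤ lam := by
    have h := hmass ((N : ℝ) ^ ((1 : ℝ) / (2 * k))) (4 * C)
      (Real.one_le_rpow hN1 (by positivity))
      (by rw [hCdef]; push_cast; linarith) Ps fun p hp => (hPs p hp).1
    rw [Real.log_rpow hN0, ← hL] at h
    have h5 : Real.log (4 * C) + C₀ ≤ L / (8 * k) := by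
      rw [le_div_iff₀ (by positivity)]; exact h4
    have h6 := mul_le_mul_of_nonneg_right hck (by linarith : (0 : ℝ) ≤ L)
    have e1 : 1 / (2 * k) * L = 4 * (L / (8 * k)) := by field_simp; ring
    have e2 : L / (4 * k) = 2 * (L / (8 * k)) := by field_simp; ring
    have e3 : 1 / (8 * k) * L = L / (8 * k) := by field_simp
    linarith
  have hlam0 : 0 < lam := lt_of_lt_of_le (by positivity) hlamL
  have hCL : 2 * (L + 1) ≤ C * lam := by
    have : (C : ℝ) * (L / (4 * k)) = 4 * L := by rw [hCdef]; push_cast; field_simp; ring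
    have := mul_le_mul_of_nonneg_left hlamL hC.le
    linarith
  have hAcard : (N : ℝ) ^ (1 / 2 - δ) ≤ A.card :=
    (Real.rpow_le_rpow_of_exponent_le hN1 (by linarith)).trans hbig.le
  have hlogsum : ∑ p ∈ Q, Real.log p ≤ (N : ℝ) ^ (5 / 16 : ℝ) := by
    have h := sum_log_le_of_le_rpow (Q := Q) (N := N) (r := 1 / 4)
      (fun p hp => (hQprime p hp).pos) (by norm_num) (fun p hp => ?_) hN
    · refine h.trans ((mul_le_mul_of_nonneg_left h2 (by positivity)).trans (le_of_eq ?_))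
      rw [← Real.rpow_add hN0]
      norm_num
    · refine (hPs p (hQmem hp).1).2.trans (Real.rpow_le_rpow_of_exponent_le hN1 ?_)
      exact one_div_le_one_div_of_le (by norm_num) (by linarith)
  have hstep : ∀ B ⊆ A, (N : ℝ) ^ (7 / 16 : ℝ) ≤ B.card → ∃ B' ⊆ B,
      (B.card : ℝ) ^ 2 * (N : ℝ) ^ (-(1 / 2) - δ) ≤ 4 * B'.card ∧
      logDensity Q B' ≤ logDensity Q B - η / 4 * lam := by
    intro B hBA hB
    have hB0 : (0 : ℝ) < B.card := lt_of_lt_of_le (by positivity) hB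
    have hresB : ∀ p ∈ Ps, InAP (residues B p) ((1 - ε) * p) := fun p hp =>
      (hres p hp).mono (image_subset_image hBA)
    have hE := henergy Ps hPs hmiss B (hBA.trans hA) hresB
    have hdiag : (B.card : ℝ) ^ 2 * ∑ p ∈ Q, Real.log p ≤ diffEnergy B := by
      refine le_trans ?_ hE
      rw [show (4 : ℕ) = 2 + 2 from rfl, pow_add, mul_assoc]
      refine mul_le_mul_of_nonneg_left (hlogsum.trans ?_) (by positivity)
      refine le_trans ?_ (mul_le_mul_of_nonneg_right (pow_le_pow_left₀ (by positivity) hB 2)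
        (by positivity))
      rw [← Real.rpow_natCast ((N : ℝ) ^ _), ← Real.rpow_mul hN0.le, ← Real.rpow_add hN0]
      refine Real.rpow_le_rpow_of_exponent_le hN1 ?_
      push_cast
      linarith
    obtain ⟨n, hn1, hn2⟩ := exists_shift_logDensity_le (hBA.trans hA)
      (card_pos.1 (by exact_mod_cast hB0)) (Q := Q) (ε := ε) (η := η) (C := C)
      (by omega) hε hη0.le (le_of_eq (by rw [hη]; field_simp; norm_num)) hQprime
      (fun p hp => by exact_mod_cast (hQmem hp).2.le) (fun p hp => (hresB p (hQmem hp).1).card_le)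
      hdiag hCL
    refine ⟨shiftInter B n, shiftInter_subset B n, ?_, hn2⟩
    refine le_of_mul_le_mul_left ?_ (by positivity : (0 : ℝ) < (B.card : ℝ) ^ 2)
    linarith
  obtain ⟨B, -, -, hB⟩ := exists_subset_logDensity_le hN hδ0 h1 hAcard hstep K hδK
  have := logDensity_nonneg Q B
  have := logDensity_le hQprime A
  nlinarith

theorem sieve_ap_large_sieve_regime (k : ℕ) (hk : 0 < k) (ε : ℝ) (hε : 0 < ε) :
    ∃ (c C : ℝ), c > 0 ∧ C > 0 ∧ ∃ N₀ : ℕ, ∀ N : ℕ, N ≥ N₀ →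
      ∀ A : Finset ℕ, A ⊆ Finset.Icc 1 N →
        ∀ Ps : Finset ℕ,
          (∀ p ∈ Ps, p.Prime ∧ (p : ℝ) ≤ (N : ℝ) ^ ((1 : ℝ) / (2 * k))) →
          (∑ p ∈ (primesUpTo ((N : ℝ) ^ ((1 : ℝ) / (2 * k)))).filter
              (fun p => p ∉ Ps), Real.log p / p) < c * Real.log N →
          (∀ p ∈ Ps, InAP (modImage A p) ((1 - ε) * p)) →
          (A.card : ℝ) ≤ C * (N : ℝ) ^ ((1 : ℝ) / 2 - c) := by
  obtain ⟨c, hc, h⟩ := exists_eventually_card_le (k := 2 * k) (by omega) hε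
  obtain ⟨N₀, hN₀⟩ := Filter.eventually_atTop.1 (h.and (Filter.eventually_gt_atTop 0))
  refine ⟨c, 1, hc, one_pos, N₀, fun N hN A hA Ps hPs hmiss hres => ?_⟩
  obtain ⟨hcard, hNpos⟩ := hN₀ N hN
  set y : ℝ := (N : ℝ) ^ ((1 : ℝ) / (2 * (2 * k : ℕ))) with hy
  have hyle : y ≤ (N : ℝ) ^ ((1 : ℝ) / (2 * k)) := by
    have hk0 : (0 : ℝ) < k := by exact_mod_cast hk
    refine Real.rpow_le_rpow_of_exponent_le (by exact_mod_cast hNpos) ?_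
    refine one_div_le_one_div_of_le (by positivity) ?_
    push_cast
    linarith
  have hinj : Function.Injective fun a : ℕ => (a : ℤ) := Nat.cast_injective
  have hresidues (p : ℕ) : residues (A.image fun a : ℕ => (a : ℤ)) p = modImage A p := by
    rw [residues, modImage, image_image]
    refine image_congr fun a _ => ?_
    simp
  rw [one_mul, ← card_image_of_injective A hinj]
  refine hcard (Ps.filter fun p : ℕ => (p : ℝ) ≤ y)
    (fun p hp => ⟨(hPs p (mem_filter.1 hp).1).1, (mem_filter.1 hp).2⟩) ?_ _ ?_ fun p hp => ?_
  · refine le_trans (sum_le_sum_of_subset_of_nonneg ?_ fun p _ _ =>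
      div_nonneg (Real.log_natCast_nonneg p) p.cast_nonneg) hmiss.le
    intro p hp
    obtain ⟨hp1, hp2⟩ := mem_filter.1 hp
    obtain ⟨hpy, hpp⟩ := mem_filter.1 hp1
    have hpf : p ≤ ⌊y⌋₊ := Nat.le_of_lt_succ (mem_range.1 hpy)
    have hpy' : (p : ℝ) ≤ y := (Nat.le_floor_iff (by positivity)).1 hpf
    refine mem_filter.2 ⟨mem_filter.2 ⟨mem_range.2 (Nat.lt_succ_of_le ?_), hpp⟩, fun hpPs => ?_⟩
    · exact hpf.trans (Nat.floor_le_floor hyle)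
    · exact hp2 (mem_filter.2 ⟨hpPs, hpy'⟩)
  · intro a ha
    obtain ⟨b, hb, rfl⟩ := mem_image.1 ha
    have := mem_Icc.1 (hA hb)
    exact mem_Icc.2 ⟨by exact_mod_cast this.1, by exact_mod_cast this.2⟩
  · rw [hresidues]
    exact hres p (mem_filter.1 hp).1
end

section
/- (Lifting additive energy.) For every positive integer k and every real ε > 0 there is a constant c_{k,ε} > 0 such that the following holds for all integers N ≥ 1. Let A ⊆ [N] be a nonempty subset and let 𝒫 be a set of primes p ≤ N^{1/2k} such that for each p ∈ 𝒫 the set A mod p is contained in an arithmetic progression S_p ⊆ ℤ/pℤ of length at most (1−ε)p. Then the additive energy satisfies E(A) ≥ c_{k,ε} · |A|³ · (|A|/√N) · (|𝒫| / N^{1/2k})^{2k−1}. -/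
/-- The additive energy of a finite set of naturals: the number of quadruples
`(a₁, a₂, a₃, a₄) ∈ A⁴` with `a₁ + a₂ = a₃ + a₄`. -/
def addEnergy (A : Finset ℕ) : ℕ :=
  ((A ×ˢ A ×ˢ A ×ˢ A).filter
    (fun q => q.1 + q.2.1 = q.2.2.1 + q.2.2.2)).card

/-- The additive character `x ↦ exp (2πix)`. -/
noncomputable def expChar (x : ℝ) : ℂ := Complex.exp (((2 * Real.pi * x : ℝ) : ℂ) * Complex.I)

lemma expChar_add (x y : ℝ) : expChar (x + y) = expChar x * expChar y := by
  simp only [expChar, ← Complex.exp_add]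
  congr 1
  push_cast
  ring

lemma expChar_zero : expChar 0 = 1 := by simp [expChar]

lemma norm_expChar (x : ℝ) : ‖expChar x‖ = 1 := Complex.norm_exp_ofReal_mul_I _

lemma expChar_intCast (n : ℤ) : expChar n = 1 := by
  rw [expChar, Complex.exp_eq_one_iff]
  exact ⟨n, by push_cast; ring⟩

lemma expChar_add_intCast (x : ℝ) (n : ℤ) : expChar (x + n) = expChar x := by
  rw [expChar_add, expChar_intCast, mul_one]

lemma conj_expChar (x : ℝ) : (starRingEnd ℂ) (expChar x) = expChar (-x) := by
  rw [expChar, expChar, ← Complex.exp_conj, map_mul, Complex.conj_ofReal, Complex.conj_I]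
  congr 1
  push_cast
  ring

lemma expChar_natCast_mul (m : ℕ) (x : ℝ) : expChar (m * x) = expChar x ^ m := by
  rw [expChar, expChar, ← Complex.exp_nat_mul]
  congr 1
  push_cast
  ring

lemma expChar_sum {ι : Type*} (s : Finset ι) (f : ι → ℝ) :
    expChar (∑ i ∈ s, f i) = ∏ i ∈ s, expChar (f i) := by
  simp only [expChar, ← Complex.exp_sum]
  congr 1
  push_cast
  rw [Finset.mul_sum, Finset.sum_mul]

lemma sq_norm_sum_expChar {ι : Type*} (s : Finset ι) (f : ι → ℝ) :
    ((‖∑ i ∈ s, expChar (f i)‖ ^ 2 : ℝ) : ℂ) = ∑ i ∈ s, ∑ j ∈ s, expChar (f i - f j) := by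
  rw [Complex.ofReal_pow, ← Complex.mul_conj', map_sum, Finset.sum_mul_sum]
  refine Finset.sum_congr rfl fun i _ => Finset.sum_congr rfl fun j _ => ?_
  rw [conj_expChar, ← expChar_add, sub_eq_add_neg]

/-- The geometric sum `∑_{m < M} exp (2πimx)`. -/
noncomputable def geomExpSum (M : ℕ) (x : ℝ) : ℂ := ∑ m ∈ Finset.range M, expChar (m * x)

lemma geomExpSum_add_intCast (M : ℕ) (x : ℝ) (n : ℤ) :
    geomExpSum M (x + n) = geomExpSum M x := by
  refine Finset.sum_congr rfl fun m _ => ?_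
  have h : (m : ℝ) * (x + n) = m * x + ((m * n : ℤ) : ℝ) := by push_cast; ring
  rw [h, expChar_add_intCast]

lemma norm_geomExpSum_le (M : ℕ) (x : ℝ) : ‖geomExpSum M x‖ ≤ M := by
  refine (norm_sum_le _ _).trans ?_
  simp [norm_expChar]

lemma sq_norm_geomExpSum (M : ℕ) (x : ℝ) :
    ((‖geomExpSum M x‖ ^ 2 : ℝ) : ℂ) =
      ∑ m ∈ Finset.range M, ∑ m' ∈ Finset.range M, expChar (((m : ℝ) - m') * x) := by
  rw [geomExpSum, sq_norm_sum_expChar]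
  simp only [sub_mul]

lemma norm_expChar_sub_one (x : ℝ) : ‖expChar x - 1‖ = 2 * |Real.sin (Real.pi * x)| := by
  rw [expChar, mul_comm, Complex.norm_exp_I_mul_ofReal_sub_one, norm_mul, Real.norm_eq_abs,
    Real.norm_eq_abs, abs_of_pos (by norm_num : (0 : ℝ) < 2)]
  congr 3
  ring

lemma sq_norm_geomExpSum_le (M : ℕ) {x : ℝ} (h0 : 0 < x) (h1 : x < 1) :
    ‖geomExpSum M x‖ ^ 2 ≤ 1 / 4 * ((x ^ 2)⁻¹ + ((1 - x) ^ 2)⁻¹) := by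
  have key : ∀ u : ℝ, 0 < u → u ≤ 1 / 2 → Real.sin (Real.pi * x) = Real.sin (Real.pi * u) →
      ‖geomExpSum M x‖ ^ 2 ≤ 1 / 4 * (u ^ 2)⁻¹ := by
    intro u hu hu2 hs
    have hpi := Real.pi_pos
    have hsin : 2 * u ≤ Real.sin (Real.pi * u) := by
      have h := Real.mul_le_sin (x := Real.pi * u) (by positivity) (by nlinarith)
      calc 2 * u = 2 / Real.pi * (Real.pi * u) := by field_simp
        _ ≤ _ := h
    have hgeom : ‖geomExpSum M x‖ * ‖expChar x - 1‖ ≤ 2 := by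
      rw [← norm_mul, geomExpSum]
      simp only [expChar_natCast_mul]
      rw [geom_sum_mul]
      refine (norm_sub_le _ _).trans ?_
      rw [norm_pow, norm_expChar]
      norm_num
    rw [norm_expChar_sub_one, hs, abs_of_nonneg (by linarith)] at hgeom
    have hD := norm_nonneg (geomExpSum M x)
    have h2 : ‖geomExpSum M x‖ * (2 * u) ≤ 1 := by nlinarith
    have h3 : (‖geomExpSum M x‖ * (2 * u)) ^ 2 ≤ 1 := pow_le_one₀ (by positivity) h2
    rw [← div_eq_mul_inv, le_div_iff₀ (by positivity)]
    nlinarith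
  have hx : 0 < (x ^ 2)⁻¹ := by positivity
  have hx' : 0 < ((1 - x) ^ 2)⁻¹ := by
    have : 0 < 1 - x := by linarith
    positivity
  rcases le_total x (1 / 2) with h | h
  · have := key x h0 h rfl
    linarith
  · have := key (1 - x) (by linarith) (by linarith) (by
      rw [mul_sub, mul_one, Real.sin_pi_sub])
    linarith

/-- A nonempty set whose residues avoid a positive proportion of an arithmetic progression
modulo a large prime `p` has a large nontrivial Fourier coefficient of denominator `p`. -/
lemma exists_large_fourier_coeff {ε : ℝ} (hε : 0 < ε) :
    ∃ K : ℕ, ∃ c : ℝ, 0 < c ∧ ∀ p : ℕ, p.Prime → K ≤ p → ∀ A : Finset ℕ, A.Nonempty →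
      InAP (modImage A p) ((1 - ε) * p) →
      ∃ b : ℤ, ¬ (p : ℤ) ∣ b ∧ c * (A.card : ℝ) ≤ ‖∑ a ∈ A, expChar (b * a / p)‖ := by
  obtain ⟨K, hK⟩ := exists_nat_gt (4 / ε ^ 2)
  have hK0 : (0 : ℝ) < K := lt_trans (by positivity) hK
  refine ⟨K, 1 / (2 * K), by positivity, ?_⟩
  intro p hp hKp A hA ⟨L, x, d, hd, hL, hS⟩
  have := Fact.mk hp
  have hp0 : (0 : ℝ) < p := by exact_mod_cast hp.pos
  have hAc : (0 : ℝ) < A.card := by exact_mod_cast hA.card_pos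
  set D : ℤ := (d⁻¹.val : ℤ) with hD
  set X : ℤ := (x.val : ℤ) with hX
  have hDd : (D : ZMod p) = d⁻¹ := by simp [hD]
  have hXx : (X : ZMod p) = x := by simp [hX]
  set u : ℕ → ℝ := fun a => (D * (a - X) : ℝ) / p + ε / 2 with hu
  have hbound : ∀ a ∈ A, ‖geomExpSum K (u a)‖ ^ 2 ≤ 2 / ε ^ 2 := by
    intro a ha
    have hmem : (a : ZMod p) ∈ modImage A p := Finset.mem_image_of_mem _ ha
    obtain ⟨j, hj, hja⟩ := Finset.mem_image.1 (hS hmem)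
    rw [Finset.mem_range] at hj
    have hdvd : (p : ℤ) ∣ D * (a - X) - j := by
      rw [← ZMod.intCast_zmod_eq_zero_iff_dvd]
      push_cast
      rw [hDd, hXx, ← hja]
      field_simp
      ring
    obtain ⟨n, hn⟩ := hdvd
    have hn' : (D * (a - X) : ℝ) = j + p * n := by
      have : D * ((a : ℤ) - X) = j + p * n := by linarith
      exact_mod_cast this
    have hua : u a = ((j : ℝ) / p + ε / 2) + n := by
      simp only [hu]
      rw [hn']
      field_simp
      ring
    have hjL : (j : ℝ) < (1 - ε) * p := lt_of_lt_of_le (by exact_mod_cast hj) hL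
    have hjp : (j : ℝ) / p < 1 - ε := by rwa [div_lt_iff₀ hp0]
    have hjp0 : 0 ≤ (j : ℝ) / p := by positivity
    rw [hua, geomExpSum_add_intCast]
    refine (sq_norm_geomExpSum_le K (by linarith) (by linarith)).trans ?_
    have h1 : (((j : ℝ) / p + ε / 2) ^ 2)⁻¹ ≤ ((ε / 2) ^ 2)⁻¹ := by
      gcongr
      linarith
    have h2 : ((1 - ((j : ℝ) / p + ε / 2)) ^ 2)⁻¹ ≤ ((ε / 2) ^ 2)⁻¹ := by
      gcongr
      linarith
    have h3 : ((ε / 2) ^ 2)⁻¹ = 4 / ε ^ 2 := by field_simp; norm_num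
    rw [h3] at h1 h2
    have h4 : 2 / ε ^ 2 = 1 / 4 * (4 / ε ^ 2 + 4 / ε ^ 2) := by ring
    rw [h4]
    gcongr
  by_contra! hcon
  have hoff : ∀ m ∈ Finset.range K, ∀ m' ∈ Finset.range K, m ≠ m' →
      ‖∑ a ∈ A, expChar (((m : ℝ) - m') * u a)‖ ≤ 1 / (2 * K) * A.card := by
    intro m hm m' hm' hne
    rw [Finset.mem_range] at hm hm'
    have hb : ¬ (p : ℤ) ∣ ((m : ℤ) - m') * D := by
      intro h
      rcases (Nat.prime_iff_prime_int.1 hp).dvd_or_dvd h with h | h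
      · have := Int.eq_zero_of_abs_lt_dvd h (by rw [abs_lt]; constructor <;> omega)
        omega
      · rw [← ZMod.intCast_zmod_eq_zero_iff_dvd, hDd] at h
        exact hd (inv_eq_zero.1 h)
    have heq : ∑ a ∈ A, expChar (((m : ℝ) - m') * u a) =
        expChar (((m : ℝ) - m') * (ε / 2 - D * X / p)) *
          ∑ a ∈ A, expChar (((((m : ℤ) - m') * D : ℤ) : ℝ) * a / p) := by
      rw [Finset.mul_sum]
      refine Finset.sum_congr rfl fun a _ => ?_
      rw [← expChar_add]
      congr 1
      simp only [hu]
      push_cast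
      ring
    rw [heq, norm_mul, norm_expChar, one_mul]
    exact (hcon _ hb).le
  have hsum : ((∑ a ∈ A, ‖geomExpSum K (u a)‖ ^ 2 : ℝ) : ℂ) =
      ∑ m ∈ Finset.range K, ∑ m' ∈ Finset.range K, ∑ a ∈ A, expChar (((m : ℝ) - m') * u a) := by
    rw [Complex.ofReal_sum]
    simp only [sq_norm_geomExpSum]
    rw [Finset.sum_comm]
    exact Finset.sum_congr rfl fun m _ => Finset.sum_comm
  have hdiag : ((∑ a ∈ A, ‖geomExpSum K (u a)‖ ^ 2 : ℝ) : ℂ) - ((K * A.card : ℝ) : ℂ) =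
      ∑ m ∈ Finset.range K, ∑ m' ∈ Finset.range K,
        if m = m' then 0 else ∑ a ∈ A, expChar (((m : ℝ) - m') * u a) := by
    have hd' : ((K * A.card : ℝ) : ℂ) =
        ∑ m ∈ Finset.range K, ∑ m' ∈ Finset.range K, if m = m' then (A.card : ℂ) else 0 := by
      have : ∀ m ∈ Finset.range K, (∑ m' ∈ Finset.range K, if m = m' then (A.card : ℂ) else 0) = A.card := by
        intro m hm
        rw [Finset.sum_ite_eq, if_pos hm]
      rw [Finset.sum_congr rfl this]
      simp
    rw [hsum, hd', ← Finset.sum_sub_distrib]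
    refine Finset.sum_congr rfl fun m _ => ?_
    rw [← Finset.sum_sub_distrib]
    refine Finset.sum_congr rfl fun m' _ => ?_
    split_ifs with h
    · subst h
      simp [expChar_zero]
    · simp
  have hnorm : |∑ a ∈ A, ‖geomExpSum K (u a)‖ ^ 2 - K * A.card| ≤
      K * (K * (1 / (2 * K) * A.card)) := by
    rw [← Real.norm_eq_abs, ← Complex.norm_real, Complex.ofReal_sub, hdiag]
    have h2 : ∀ m ∈ Finset.range K, ‖∑ m' ∈ Finset.range K,
        if m = m' then 0 else ∑ a ∈ A, expChar (((m : ℝ) - m') * u a)‖ ≤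
          K * (1 / (2 * K) * A.card) := by
      intro m hm
      refine (norm_sum_le_of_le _ (f := fun m' => _) (n := fun _ => 1 / (2 * K) * (A.card : ℝ))
        fun m' hm' => ?_).trans ?_
      · split_ifs with h
        · rw [norm_zero]; positivity
        · exact hoff m hm m' hm' h
      · simp
    refine (norm_sum_le_of_le _ h2).trans ?_
    simp
  have hup : ∑ a ∈ A, ‖geomExpSum K (u a)‖ ^ 2 ≤ A.card * (2 / ε ^ 2) := by
    refine (Finset.sum_le_sum hbound).trans ?_
    simp
  have h1 := (abs_le.1 hnorm).1
  have h2 : (K : ℝ) * (K * (1 / (2 * K) * A.card)) = K * A.card / 2 := by field_simp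
  rw [h2] at h1
  have h3 : (2 / ε ^ 2 : ℝ) < K / 2 := by
    have : 4 / ε ^ 2 = 2 * (2 / ε ^ 2) := by ring
    linarith
  nlinarith

lemma sum_inv_sq_le_of_fiber_card_le {ι : Type*} (s : Finset ι) (j : ι → ℕ) (B : ℕ)
    (hpos : ∀ i ∈ s, 1 ≤ j i) (hB : ∀ i ∈ s, (s.filter fun i' => j i' = j i).card ≤ B) :
    ∑ i ∈ s, (((j i : ℝ)) ^ 2)⁻¹ ≤ 2 * B := by
  classical
  obtain ⟨n, hn⟩ : ∃ n, ∀ i ∈ s, j i ≤ n :=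
    ⟨s.sup j, fun i hi => Finset.le_sup (f := j) hi⟩
  have hmaps : ∀ i ∈ s, j i ∈ Finset.Ioc 0 n := fun i hi =>
    Finset.mem_Ioc.2 ⟨hpos i hi, hn i hi⟩
  rw [← Finset.sum_fiberwise_of_maps_to hmaps]
  have hfib : ∀ m ∈ Finset.Ioc 0 n,
      ∑ i ∈ s.filter (fun i => j i = m), (((j i : ℝ)) ^ 2)⁻¹ ≤ B * ((m : ℝ) ^ 2)⁻¹ := by
    intro m _
    have : ∀ i ∈ s.filter (fun i => j i = m), (((j i : ℝ)) ^ 2)⁻¹ = ((m : ℝ) ^ 2)⁻¹ := by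
      intro i hi
      rw [(Finset.mem_filter.1 hi).2]
    rw [Finset.sum_congr rfl this, Finset.sum_const, nsmul_eq_mul]
    refine mul_le_mul_of_nonneg_right ?_ (by positivity)
    rcases (s.filter (fun i => j i = m)).eq_empty_or_nonempty with h | ⟨i, hi⟩
    · rw [h]; simp
    · obtain ⟨hi, him⟩ := Finset.mem_filter.1 hi
      have := hB i hi
      rw [him] at this
      exact_mod_cast this
  refine (Finset.sum_le_sum hfib).trans ?_
  rw [← Finset.mul_sum, mul_comm]
  refine mul_le_mul_of_nonneg_right ?_ (by positivity)
  have h := sum_Ioo_inv_sq_le (α := ℝ) 0 (n + 1)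
  have hset : Finset.Ioo 0 (n + 1) = Finset.Ioc 0 n := by ext; simp
  rw [hset] at h
  simpa using h

lemma sum_inv_sq_fract_le {ι : Type*} (s : Finset ι) (γ : ι → ℝ) {δ : ℝ} (hδ : 0 < δ) (B : ℕ)
    (hzero : ∀ i ∈ s, δ ≤ Int.fract (γ i))
    (hsep : ∀ i ∈ s, ∀ i' ∈ s, (∃ n : ℤ, γ i' - γ i = n) ∨ ∀ n : ℤ, δ ≤ |γ i' - γ i - n|)
    (hB : ∀ i ∈ s, ∀ t ⊆ s, (∀ i' ∈ t, ∃ n : ℤ, γ i' - γ i = n) → t.card ≤ B) :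
    ∑ i ∈ s, ((Int.fract (γ i)) ^ 2)⁻¹ ≤ 2 * B * (δ ^ 2)⁻¹ := by
  set j : ι → ℕ := fun i => ⌊Int.fract (γ i) / δ⌋₊ with hj
  have hj1 : ∀ i ∈ s, 1 ≤ j i := fun i hi =>
    Nat.le_floor (by rw [Nat.cast_one, one_le_div hδ]; exact hzero i hi)
  have hj2 : ∀ i, (j i : ℝ) * δ ≤ Int.fract (γ i) := fun i => by
    rw [← le_div_iff₀ hδ]
    exact Nat.floor_le (div_nonneg (Int.fract_nonneg _) hδ.le)
  have hj3 : ∀ i, Int.fract (γ i) < (j i + 1 : ℝ) * δ := fun i => by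
    rw [← div_lt_iff₀ hδ]
    exact Nat.lt_floor_add_one _
  have hfib : ∀ i ∈ s, (s.filter fun i' => j i' = j i).card ≤ B := by
    intro i hi
    refine hB i hi _ (Finset.filter_subset _ _) fun i' hi' => ?_
    obtain ⟨hi's, hjj⟩ := Finset.mem_filter.1 hi'
    refine (hsep i hi i' hi's).resolve_right fun h => ?_
    have h1 := h (⌊γ i'⌋ - ⌊γ i⌋)
    have h2 : γ i' - γ i - ((⌊γ i'⌋ - ⌊γ i⌋ : ℤ) : ℝ) = Int.fract (γ i') - Int.fract (γ i) := by
      rw [Int.fract, Int.fract]; push_cast; ring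
    rw [h2] at h1
    have h3 := hj2 i
    have h4 := hj3 i
    have h5 := hj2 i'
    have h6 := hj3 i'
    rw [hjj] at h5 h6
    have : |Int.fract (γ i') - Int.fract (γ i)| < δ := by
      rw [abs_lt]; constructor <;> nlinarith
    linarith
  calc ∑ i ∈ s, ((Int.fract (γ i)) ^ 2)⁻¹
      ≤ ∑ i ∈ s, (((j i : ℝ)) ^ 2)⁻¹ * (δ ^ 2)⁻¹ := by
        refine Finset.sum_le_sum fun i hi => ?_
        have : (1 : ℝ) ≤ j i := by exact_mod_cast hj1 i hi
        rw [← mul_inv, ← mul_pow]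
        gcongr
        exact hj2 i
    _ ≤ _ := by
        rw [← Finset.sum_mul]
        exact mul_le_mul_of_nonneg_right (sum_inv_sq_le_of_fiber_card_le s j B hj1 hfib)
          (by positivity)

/-- A dual large sieve inequality for well-spaced points taken with multiplicity at most `B`. -/
lemma sum_sq_norm_expChar_le {ι : Type*} (T : Finset ι) (α : ι → ℝ) {N : ℕ} (hN : 1 ≤ N) (B : ℕ)
    (hsep : ∀ i ∈ T, ∀ i' ∈ T,
      (∃ n : ℤ, α i' - α i = n) ∨ ∀ n : ℤ, (1 : ℝ) / N ≤ |α i' - α i - n|)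
    (hB : ∀ i ∈ T, ∀ t ⊆ T, (∀ i' ∈ t, ∃ n : ℤ, α i' - α i = n) → t.card ≤ B) :
    ∑ n ∈ Finset.Icc (-(N : ℤ)) N, ‖∑ i ∈ T, expChar (n * α i)‖ ^ 2 ≤ 5 * N * B * T.card := by
  classical
  have hN0 : (0 : ℝ) < N := by exact_mod_cast hN
  set M : ℕ := 2 * N with hM
  have hMr : (M : ℝ) = 2 * N := by rw [hM]; push_cast; ring
  set G : ℤ → ℝ := fun n => ‖∑ i ∈ T, expChar (n * α i)‖ ^ 2 with hG
  have hweight : N * ∑ n ∈ Finset.Icc (-(N : ℤ)) N, G n ≤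
      ∑ x ∈ Finset.range M ×ˢ Finset.range M, G ((x.1 : ℤ) - x.2) := by
    have hfib : ∀ n ∈ Finset.Icc (-(N : ℤ)) N, (N : ℝ) * G n ≤
        ∑ x ∈ (Finset.range M ×ˢ Finset.range M).filter (fun x => (x.1 : ℤ) - x.2 = n),
          G ((x.1 : ℤ) - x.2) := by
      intro n hn
      rw [Finset.mem_Icc] at hn
      have h1 : ∀ x ∈ (Finset.range M ×ˢ Finset.range M).filter (fun x => (x.1 : ℤ) - x.2 = n),
          G ((x.1 : ℤ) - x.2) = G n := fun x hx => by rw [(Finset.mem_filter.1 hx).2]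
      rw [Finset.sum_congr rfl h1, Finset.sum_const, nsmul_eq_mul]
      refine mul_le_mul_of_nonneg_right ?_ (by positivity)
      have h2 : (Finset.range N).card ≤
          ((Finset.range M ×ˢ Finset.range M).filter (fun x => (x.1 : ℤ) - x.2 = n)).card := by
        refine Finset.card_le_card_of_injOn
          (fun m => (m + n.toNat, m + (-n).toNat)) (fun m hm => ?_) (fun m _ m' _ h => ?_)
        · have hm' := Finset.mem_range.1 hm
          simp only [Finset.coe_filter, Finset.mem_product, Finset.mem_range, Set.mem_ofPred_eq]
          push_cast
          omega
        · simp only [Prod.mk.injEq] at h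
          omega
      rw [Finset.card_range] at h2
      exact_mod_cast h2
    rw [Finset.mul_sum]
    refine (Finset.sum_le_sum hfib).trans ?_
    exact Finset.sum_fiberwise_le_sum_of_sum_fiber_nonneg
      (fun n _ => Finset.sum_nonneg fun x _ => by positivity)
  have hexpand : ∑ x ∈ Finset.range M ×ˢ Finset.range M, G ((x.1 : ℤ) - x.2) =
      ∑ i ∈ T, ∑ i' ∈ T, ‖geomExpSum M (α i' - α i)‖ ^ 2 := by
    have : ((∑ x ∈ Finset.range M ×ˢ Finset.range M, G ((x.1 : ℤ) - x.2) : ℝ) : ℂ) =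
        ((∑ i ∈ T, ∑ i' ∈ T, ‖geomExpSum M (α i' - α i)‖ ^ 2 : ℝ) : ℂ) := by
      simp only [hG, Complex.ofReal_sum, sq_norm_sum_expChar, sq_norm_geomExpSum]
      rw [Finset.sum_comm' (t' := T) (s' := fun _ => Finset.range M ×ˢ Finset.range M) (by simp),
        Finset.sum_comm' (s := T) (t' := T) (s' := fun _ => T) (by simp)]
      refine Finset.sum_congr rfl fun i _ => ?_
      rw [Finset.sum_comm]
      refine Finset.sum_congr rfl fun i' _ => ?_
      rw [Finset.sum_product]
      refine Finset.sum_congr rfl fun m _ => Finset.sum_congr rfl fun m' _ => ?_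
      congr 1
      push_cast
      ring
    exact_mod_cast this
  have hrow : ∀ i ∈ T, ∑ i' ∈ T, ‖geomExpSum M (α i' - α i)‖ ^ 2 ≤ 5 * N ^ 2 * B := by
    intro i hi
    set Z := T.filter (fun i' => ∃ n : ℤ, α i' - α i = n) with hZ
    set Y := T.filter (fun i' => ¬ ∃ n : ℤ, α i' - α i = n) with hY
    have hYT : Y ⊆ T := Finset.filter_subset _ _
    have hZsum : ∑ i' ∈ Z, ‖geomExpSum M (α i' - α i)‖ ^ 2 ≤ B * (M : ℝ) ^ 2 := by
      have hZB : Z.card ≤ B := hB i hi Z (Finset.filter_subset _ _)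
        fun i' hi' => (Finset.mem_filter.1 hi').2
      calc ∑ i' ∈ Z, ‖geomExpSum M (α i' - α i)‖ ^ 2 ≤ ∑ i' ∈ Z, (M : ℝ) ^ 2 :=
            Finset.sum_le_sum fun i' _ =>
              pow_le_pow_left₀ (norm_nonneg _) (norm_geomExpSum_le _ _) 2
        _ = Z.card * (M : ℝ) ^ 2 := by rw [Finset.sum_const, nsmul_eq_mul]
        _ ≤ _ := by gcongr
    have hYfar : ∀ i' ∈ Y, ∀ n : ℤ, (1 : ℝ) / N ≤ |α i' - α i - n| := fun i' hi' =>
      (hsep i hi i' (hYT hi')).resolve_left (Finset.mem_filter.1 hi').2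
    have hd : (0 : ℝ) < 1 / N := by positivity
    have hY1 : ∑ i' ∈ Y, ((Int.fract (α i' - α i)) ^ 2)⁻¹ ≤ 2 * B * (((1 : ℝ) / N) ^ 2)⁻¹ := by
      refine sum_inv_sq_fract_le Y (fun i' => α i' - α i) hd B (fun i' hi' => ?_)
        (fun i₁ h₁ i₂ h₂ => ?_) (fun i₁ h₁ t ht hh => ?_)
      · have := hYfar i' hi' ⌊α i' - α i⌋
        rwa [Int.self_sub_floor, abs_of_nonneg (Int.fract_nonneg _)] at this
      · simpa only [sub_sub_sub_cancel_right] using hsep i₁ (hYT h₁) i₂ (hYT h₂)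
      · exact hB i₁ (hYT h₁) t (ht.trans hYT)
          (by simpa only [sub_sub_sub_cancel_right] using hh)
    have hY2 : ∑ i' ∈ Y, ((Int.fract (α i - α i')) ^ 2)⁻¹ ≤ 2 * B * (((1 : ℝ) / N) ^ 2)⁻¹ := by
      refine sum_inv_sq_fract_le Y (fun i' => α i - α i') hd B (fun i' hi' => ?_)
        (fun i₁ h₁ i₂ h₂ => ?_) (fun i₁ h₁ t ht hh => ?_)
      · have := hYfar i' hi' (-⌊α i - α i'⌋)
        rw [← abs_neg] at this
        have heq : -(α i' - α i - ((-⌊α i - α i'⌋ : ℤ) : ℝ)) = Int.fract (α i - α i') := by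
          rw [Int.fract]; push_cast; ring
        rwa [heq, abs_of_nonneg (Int.fract_nonneg _)] at this
      · simpa only [sub_sub_sub_cancel_left] using hsep i₂ (hYT h₂) i₁ (hYT h₁)
      · refine hB i₁ (hYT h₁) t (ht.trans hYT) fun i' hi' => ?_
        obtain ⟨n, hn⟩ := hh i' hi'
        exact ⟨-n, by push_cast; linarith⟩
    have hYsum : ∑ i' ∈ Y, ‖geomExpSum M (α i' - α i)‖ ^ 2 ≤
        1 / 4 * (2 * B * (((1 : ℝ) / N) ^ 2)⁻¹ + 2 * B * (((1 : ℝ) / N) ^ 2)⁻¹) := by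
      refine le_trans ?_ (mul_le_mul_of_nonneg_left (add_le_add hY1 hY2) (by norm_num))
      rw [← Finset.sum_add_distrib, Finset.mul_sum]
      refine Finset.sum_le_sum fun i' hi' => ?_
      have hfr : Int.fract (α i' - α i) ≠ 0 := fun h0 =>
        (Finset.mem_filter.1 hi').2 (by
          obtain ⟨n, hn⟩ := Int.fract_eq_zero_iff.1 h0
          exact ⟨n, hn.symm⟩)
      have hneg : Int.fract (α i - α i') = 1 - Int.fract (α i' - α i) := by
        rw [← neg_sub (α i') (α i), Int.fract_neg hfr]
      have hper : geomExpSum M (α i' - α i) = geomExpSum M (Int.fract (α i' - α i)) := by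
        conv_lhs => rw [← Int.fract_add_floor (α i' - α i)]
        exact geomExpSum_add_intCast _ _ _
      rw [hneg, hper]
      exact sq_norm_geomExpSum_le M (lt_of_le_of_ne (Int.fract_nonneg _) hfr.symm)
        (Int.fract_lt_one _)
    rw [← Finset.sum_filter_add_sum_filter_not T (fun i' => ∃ n : ℤ, α i' - α i = n)]
    refine (add_le_add hZsum hYsum).trans (le_of_eq ?_)
    rw [hMr]
    field_simp
    ring
  have htotal : N * ∑ n ∈ Finset.Icc (-(N : ℤ)) N, G n ≤ N * (5 * N * B * T.card) := by
    refine hweight.trans ?_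
    rw [hexpand]
    refine (Finset.sum_le_sum hrow).trans (le_of_eq ?_)
    rw [Finset.sum_const, nsmul_eq_mul]
    ring
  exact le_of_mul_le_mul_left htotal hN0

/-- Cauchy–Schwarz for sums over differences, in terms of the additive energy. -/
lemma sq_sum_sub_le_addEnergy (A : Finset ℕ) {N : ℕ} (hA : A ⊆ Finset.Icc 1 N) (G : ℤ → ℝ) :
    (∑ x ∈ A ×ˢ A, G ((x.1 : ℤ) - x.2)) ^ 2 ≤
      addEnergy A * ∑ n ∈ Finset.Icc (-(N : ℤ)) N, G n ^ 2 := by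
  classical
  set F : ℤ → Finset (ℕ × ℕ) := fun n => (A ×ˢ A).filter (fun x => (x.1 : ℤ) - x.2 = n) with hF
  have hmaps : ∀ x ∈ A ×ˢ A, (x.1 : ℤ) - x.2 ∈ Finset.Icc (-(N : ℤ)) N := by
    intro x hx
    obtain ⟨h1, h2⟩ := Finset.mem_product.1 hx
    have h1 := Finset.mem_Icc.1 (hA h1)
    have h2 := Finset.mem_Icc.1 (hA h2)
    rw [Finset.mem_Icc]
    omega
  have hsum : ∑ x ∈ A ×ˢ A, G ((x.1 : ℤ) - x.2) =
      ∑ n ∈ Finset.Icc (-(N : ℤ)) N, ((F n).card : ℝ) * G n := by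
    rw [← Finset.sum_fiberwise_of_maps_to hmaps]
    refine Finset.sum_congr rfl fun n _ => ?_
    rw [Finset.sum_congr rfl (g := fun _ => G n)
      (fun x hx => by rw [(Finset.mem_filter.1 hx).2]), Finset.sum_const, nsmul_eq_mul]
  have henergy : ∑ n ∈ Finset.Icc (-(N : ℤ)) N, (F n).card ^ 2 ≤ addEnergy A := by
    rw [addEnergy, Finset.card_eq_sum_card_fiberwise
      (f := fun q : ℕ × ℕ × ℕ × ℕ => (q.1 : ℤ) - q.2.2.1) (t := Finset.Icc (-(N : ℤ)) N)]
    · refine Finset.sum_le_sum fun n _ => ?_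
      rw [sq, ← Finset.card_product]
      refine Finset.card_le_card_of_injOn (fun y => (y.1.1, y.2.2, y.1.2, y.2.1))
        (fun y hy => ?_) (fun y _ z _ h => ?_)
      · simp only [hF, Finset.coe_product, Set.mem_prod, Finset.mem_coe, Finset.mem_filter,
          Finset.mem_product] at hy ⊢
        obtain ⟨⟨⟨h1, h2⟩, h3⟩, ⟨h4, h5⟩, h6⟩ := hy
        refine ⟨⟨⟨h1, h5, h2, h4⟩, ?_⟩, h3⟩
        omega
      · simp only [Prod.mk.injEq] at h
        ext <;> simp [h]
    · intro q hq
      have hq := Finset.mem_product.1 (Finset.mem_filter.1 (Finset.mem_coe.1 hq)).1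
      have h3 := Finset.mem_product.1 (Finset.mem_product.1 hq.2).2
      exact hmaps (q.1, q.2.2.1) (Finset.mem_product.2 ⟨hq.1, h3.1⟩)
  rw [hsum]
  refine (Finset.sum_mul_sq_le_sq_mul_sq _ _ _).trans ?_
  refine mul_le_mul_of_nonneg_right ?_ (Finset.sum_nonneg fun n _ => sq_nonneg _)
  exact_mod_cast henergy

lemma card_pow_four_le_addEnergy (A : Finset ℕ) {N : ℕ} (hN : 1 ≤ N)
    (hA : A ⊆ Finset.Icc 1 N) : (A.card : ℝ) ^ 4 ≤ addEnergy A * (3 * N) := by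
  have h := sq_sum_sub_le_addEnergy A hA (fun _ => 1)
  simp only [Finset.sum_const, Finset.card_product, nsmul_eq_mul, Int.card_Icc, mul_one,
    one_pow] at h
  have h1 : (((N : ℤ) + 1 - -N).toNat : ℝ) ≤ 3 * N := by
    have : ((N : ℤ) + 1 - -N).toNat ≤ 3 * N := by omega
    exact_mod_cast this
  calc (A.card : ℝ) ^ 4 = ((A.card * A.card : ℕ) : ℝ) ^ 2 := by push_cast; ring
    _ ≤ _ := h
    _ ≤ _ := by gcongr

section FractionSums

variable {k N : ℕ} {P : Finset ℕ} {b : ℕ → ℤ}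

/-- If two sums of `k` fractions `b p / p` with `p > k` agree modulo one, then the same
denominators occur in both. -/
lemma exists_eq_of_sum_div_sub_eq_int (hP : ∀ p ∈ P, p.Prime) (hk : ∀ p ∈ P, k < p)
    (hb : ∀ p ∈ P, ¬ (p : ℤ) ∣ b p) {t s : Fin k → ℕ} (ht : ∀ i, t i ∈ P) (hs : ∀ i, s i ∈ P)
    {n : ℤ} (h : ∑ i, (b (s i) : ℝ) / s i - ∑ i, (b (t i) : ℝ) / t i = n) (i : Fin k) :
    ∃ j, t j = s i := by
  classical
  have hcount : ∀ u : Fin k → ℕ, (∀ i, u i ∈ P) → ∑ i, (b (u i) : ℝ) / u i =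
      ∑ p ∈ P, ((Finset.univ.filter (fun i => u i = p)).card : ℝ) * ((b p : ℝ) / p) := by
    intro u hu
    rw [← Finset.sum_fiberwise_of_maps_to (s := Finset.univ) (t := P) (g := u) (fun i _ => hu i)]
    refine Finset.sum_congr rfl fun p _ => ?_
    rw [Finset.sum_congr rfl (g := fun _ => (b p : ℝ) / p)
      (fun x hx => by rw [(Finset.mem_filter.1 hx).2]), Finset.sum_const, nsmul_eq_mul]
  set m : (Fin k → ℕ) → ℕ → ℤ := fun u p => ((Finset.univ.filter (fun i => u i = p)).card : ℤ)
    with hm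
  set p := s i with hp
  have hpP : p ∈ P := hs i
  have hpp := Nat.prime_iff_prime_int.1 (hP p hpP)
  have hne : ∀ q ∈ P, (q : ℝ) ≠ 0 := fun q hq => by exact_mod_cast (hP q hq).ne_zero
  have hprod : ∀ q ∈ P, (b q : ℝ) / q * ∏ r ∈ P, (r : ℝ) = b q * ∏ r ∈ P.erase q, (r : ℝ) := by
    intro q hq
    rw [← Finset.mul_prod_erase P _ hq]
    have := hne q hq
    field_simp
  have hint : ∑ q ∈ P, (m s q - m t q) * (b q * ∏ r ∈ P.erase q, (r : ℤ)) =
      n * ∏ r ∈ P, (r : ℤ) := by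
    have : (∑ q ∈ P, ((m s q : ℝ) - m t q) * (b q * ∏ r ∈ P.erase q, (r : ℝ))) =
        n * ∏ r ∈ P, (r : ℝ) := by
      rw [← h, hcount s hs, hcount t ht, ← Finset.sum_sub_distrib, Finset.sum_mul]
      refine Finset.sum_congr rfl fun q hq => ?_
      rw [← hprod q hq]
      simp only [hm]
      push_cast
      ring
    have h' : (((∑ q ∈ P, (m s q - m t q) * (b q * ∏ r ∈ P.erase q, (r : ℤ)) : ℤ)) : ℝ) =
        ((n * ∏ r ∈ P, (r : ℤ) : ℤ) : ℝ) := by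
      push_cast
      exact this
    exact Int.cast_injective h'
  have hdvd : (p : ℤ) ∣ (m s p - m t p) * (b p * ∏ r ∈ P.erase p, (r : ℤ)) := by
    rw [← Finset.add_sum_erase P _ hpP] at hint
    have h1 : (p : ℤ) ∣ ∑ q ∈ P.erase p, (m s q - m t q) * (b q * ∏ r ∈ P.erase q, (r : ℤ)) := by
      refine Finset.dvd_sum fun q hq => Dvd.dvd.mul_left (Dvd.dvd.mul_left ?_ _) _
      exact Finset.dvd_prod_of_mem (fun r : ℕ => (r : ℤ))
        (Finset.mem_erase.2 ⟨(Finset.ne_of_mem_erase hq).symm, hpP⟩)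
    have h2 : (p : ℤ) ∣ n * ∏ r ∈ P, (r : ℤ) :=
      Dvd.dvd.mul_left (Finset.dvd_prod_of_mem (fun r : ℕ => (r : ℤ)) hpP) _
    rw [← hint] at h2
    exact (dvd_add_left h1).1 h2
  have hnotprod : ¬ (p : ℤ) ∣ ∏ r ∈ P.erase p, (r : ℤ) := by
    intro hd
    obtain ⟨r, hr, hdr⟩ := hpp.exists_mem_finset_dvd hd
    obtain ⟨hrp, hrP⟩ := Finset.mem_erase.1 hr
    exact hrp ((Nat.prime_dvd_prime_iff_eq (hP p hpP) (hP r hrP)).1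
      (Int.natCast_dvd_natCast.1 hdr)).symm
  have hmdvd : (p : ℤ) ∣ m s p - m t p := by
    rcases hpp.dvd_or_dvd hdvd with h | h
    · exact h
    · rcases hpp.dvd_or_dvd h with h | h
      · exact absurd h (hb p hpP)
      · exact absurd h hnotprod
  have hle : ∀ u : Fin k → ℕ, m u p ≤ k := fun u => by
    have := Finset.card_le_univ (Finset.univ.filter (fun i => u i = p))
    rw [Fintype.card_fin] at this
    simp only [hm]
    exact_mod_cast this
  have hnn : ∀ u : Fin k → ℕ, 0 ≤ m u p := fun u => Int.natCast_nonneg _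
  have hkp := hk p hpP
  have heq : m s p - m t p = 0 := Int.eq_zero_of_abs_lt_dvd hmdvd (by
    have h1 := hle s
    have h2 := hle t
    have h3 := hnn s
    have h4 := hnn t
    rw [abs_lt]
    constructor <;> omega)
  have hspos : 0 < m s p := by
    have : 0 < (Finset.univ.filter (fun i => s i = p)).card :=
      Finset.card_pos.2 ⟨i, Finset.mem_filter.2 ⟨Finset.mem_univ _, rfl⟩⟩
    simp only [hm]
    exact_mod_cast this
  have htpos : 0 < (Finset.univ.filter (fun i => t i = p)).card := by
    have : 0 < m t p := by omega
    simp only [hm] at this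
    exact_mod_cast this
  obtain ⟨j, hj⟩ := Finset.card_pos.1 htpos
  exact ⟨j, (Finset.mem_filter.1 hj).2⟩

lemma exists_int_eq_sum_div_mul_prod {t : Fin k → ℕ} (ht : ∀ i, t i ≠ 0) :
    ∃ z : ℤ, (∑ i, (b (t i) : ℝ) / t i) * ∏ i, (t i : ℝ) = z := by
  refine ⟨∑ i, b (t i) * ∏ j ∈ Finset.univ.erase i, (t j : ℤ), ?_⟩
  rw [Finset.sum_mul]
  push_cast
  refine Finset.sum_congr rfl fun i _ => ?_
  rw [← Finset.mul_prod_erase Finset.univ _ (Finset.mem_univ i)]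
  have : (t i : ℝ) ≠ 0 := by exact_mod_cast ht i
  field_simp

/-- Sums of `k` fractions with denominators at most `N ^ (1 / 2k)` are `1 / N`-spaced
modulo one. -/
lemma sum_div_sub_int_or_far (hN : 1 ≤ N) (hP : ∀ p ∈ P, p.Prime)
    (hPN : ∀ p ∈ P, p ^ (2 * k) ≤ N) {t s : Fin k → ℕ} (ht : ∀ i, t i ∈ P) (hs : ∀ i, s i ∈ P) :
    (∃ n : ℤ, ∑ i, (b (s i) : ℝ) / s i - ∑ i, (b (t i) : ℝ) / t i = n) ∨
      ∀ n : ℤ, (1 : ℝ) / N ≤ |∑ i, (b (s i) : ℝ) / s i - ∑ i, (b (t i) : ℝ) / t i - n| := by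
  rw [or_iff_not_imp_left]
  intro hno n
  obtain ⟨z, hz⟩ := exists_int_eq_sum_div_mul_prod (b := b) (t := t)
    (fun i => (hP _ (ht i)).ne_zero)
  obtain ⟨w, hw⟩ := exists_int_eq_sum_div_mul_prod (b := b) (t := s)
    (fun i => (hP _ (hs i)).ne_zero)
  set x := ∑ i, (b (s i) : ℝ) / s i
  set y := ∑ i, (b (t i) : ℝ) / t i
  have hsq : ∀ u : Fin k → ℕ, (∀ i, u i ∈ P) → (∏ i, u i) ^ 2 ≤ N ^ 1 ∧ 0 < ∏ i, u i := by
    intro u hu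
    refine ⟨?_, Finset.prod_pos fun i _ => (hP _ (hu i)).pos⟩
    rcases Nat.eq_zero_or_pos k with rfl | hk
    · simpa using hN
    · have h1 : ((∏ i, u i) ^ 2) ^ k ≤ N ^ k := by
        rw [← pow_mul, ← Finset.prod_pow]
        calc ∏ i, u i ^ (2 * k) ≤ ∏ _i : Fin k, N := Finset.prod_le_prod' fun i _ => hPN _ (hu i)
          _ = N ^ k := by simp
      rw [pow_one]
      exact (Nat.pow_le_pow_iff_left hk.ne').1 h1
  obtain ⟨htN, ht0⟩ := hsq t ht
  obtain ⟨hsN, hs0⟩ := hsq s hs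
  have hprod : (∏ i, t i) * ∏ i, s i ≤ N := by
    have : ((∏ i, t i) * ∏ i, s i) ^ 2 ≤ N ^ 2 := by
      rw [mul_pow, sq N]
      rw [pow_one] at htN hsN
      exact Nat.mul_le_mul htN hsN
    exact (Nat.pow_le_pow_iff_left two_ne_zero).1 this
  set a : ℝ := ∏ i, (t i : ℝ) with ha
  set c : ℝ := ∏ i, (s i : ℝ) with hc
  have ha0 : 0 < a := by rw [ha]; exact_mod_cast ht0
  have hc0 : 0 < c := by rw [hc]; exact_mod_cast hs0
  have hac : a * c ≤ N := by rw [ha, hc]; exact_mod_cast hprod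
  have hint : (x - y - n) * (a * c) =
      ((w * ∏ i, (t i : ℤ) - z * ∏ i, (s i : ℤ) - n * ((∏ i, (t i : ℤ)) * ∏ i, (s i : ℤ)) : ℤ) :
        ℝ) := by
    push_cast
    rw [← ha, ← hc, ← hz, ← hw]
    ring
  set v : ℤ := w * ∏ i, (t i : ℤ) - z * ∏ i, (s i : ℤ) -
    n * ((∏ i, (t i : ℤ)) * ∏ i, (s i : ℤ))
  have hv : v ≠ 0 := by
    intro h0
    rw [h0, Int.cast_zero] at hint
    rcases mul_eq_zero.1 hint with h | h
    · exact hno ⟨n, by linarith⟩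
    · exact absurd h (by positivity)
  have hv1 : (1 : ℝ) ≤ |(v : ℝ)| := by exact_mod_cast Int.one_le_abs hv
  rw [← hint, abs_mul, abs_of_pos (mul_pos ha0 hc0)] at hv1
  have hN0 : (0 : ℝ) < N := by exact_mod_cast hN
  rw [div_le_iff₀ hN0]
  exact hv1.trans (mul_le_mul_of_nonneg_left hac (abs_nonneg _))

/-- A bound for the `2k`-th moment of an exponential sum over prime denominators. -/
lemma sum_pow_norm_sum_expChar_le (hN : 1 ≤ N) (hP : ∀ p ∈ P, p.Prime) (hk : ∀ p ∈ P, k < p)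
    (hPN : ∀ p ∈ P, p ^ (2 * k) ≤ N) (hb : ∀ p ∈ P, ¬ (p : ℤ) ∣ b p) :
    ∑ n ∈ Finset.Icc (-(N : ℤ)) N, (‖∑ p ∈ P, expChar (n * ((b p : ℝ) / p))‖ ^ k) ^ 2 ≤
      5 * N * (k ^ k : ℕ) * (P.card : ℝ) ^ k := by
  classical
  set T := Fintype.piFinset (fun _ : Fin k => P) with hT
  have hmem : ∀ t ∈ T, ∀ i, t i ∈ P := fun t ht => Fintype.mem_piFinset.1 ht
  have h := sum_sq_norm_expChar_le T (fun t => ∑ i, (b (t i) : ℝ) / t i) hN (k ^ k)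
    (fun t ht s hs => sum_div_sub_int_or_far hN hP hPN (hmem t ht) (hmem s hs))
    (fun t ht U hU hall => by
      have hsub : U ⊆ Fintype.piFinset (fun _ : Fin k => Finset.univ.image t) := by
        intro s hs
        rw [Fintype.mem_piFinset]
        intro i
        obtain ⟨n, hn⟩ := hall s hs
        obtain ⟨j, hj⟩ := exists_eq_of_sum_div_sub_eq_int hP hk hb (hmem t ht)
          (hmem s (hU hs)) hn i
        exact Finset.mem_image.2 ⟨j, Finset.mem_univ _, hj⟩
      refine (Finset.card_le_card hsub).trans ?_
      rw [Fintype.card_piFinset_const]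
      refine Nat.pow_le_pow_left ?_ k
      simpa using Finset.card_image_le (s := (Finset.univ : Finset (Fin k))) (f := t))
  have hcard : (T.card : ℝ) = (P.card : ℝ) ^ k := by
    rw [hT, Fintype.card_piFinset_const]
    push_cast
    rfl
  rw [hcard] at h
  refine le_trans (le_of_eq (Finset.sum_congr rfl fun n _ => ?_)) h
  rw [← norm_pow]
  congr 2
  have := Finset.sum_pow' P (fun p => expChar (n * ((b p : ℝ) / p))) k
  rw [this]
  refine Finset.sum_congr rfl fun t _ => ?_
  rw [Finset.mul_sum, expChar_sum]

end FractionSums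

/-- Large Fourier coefficients at fractions with many prime denominators force large
additive energy. -/
lemma addEnergy_ge_of_large_fourier_coeff {k N : ℕ} {P : Finset ℕ} {b : ℕ → ℤ} (hk0 : 0 < k)
    (hN : 1 ≤ N) (hP : ∀ p ∈ P, p.Prime) (hk : ∀ p ∈ P, k < p) (hPN : ∀ p ∈ P, p ^ (2 * k) ≤ N)
    (hb : ∀ p ∈ P, ¬ (p : ℤ) ∣ b p) {A : Finset ℕ} (hA : A ⊆ Finset.Icc 1 N)
    (hA0 : A.Nonempty) {c : ℝ} (hc : 0 < c)
    (hlarge : ∀ p ∈ P, c * (A.card : ℝ) ≤ ‖∑ a ∈ A, expChar (b p * a / p)‖) :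
    c ^ (4 * k) * (A.card : ℝ) ^ 4 * (P.card : ℝ) ^ k ≤ addEnergy A * (5 * N * (k ^ k : ℕ)) := by
  have hA1 : (0 : ℝ) < A.card := by exact_mod_cast hA0.card_pos
  rcases P.eq_empty_or_nonempty with rfl | hPne
  · rw [Finset.card_empty, Nat.cast_zero, zero_pow hk0.ne', mul_zero]
    positivity
  have hP1 : (0 : ℝ) < P.card := by exact_mod_cast hPne.card_pos
  set g : ℤ → ℂ := fun n => ∑ p ∈ P, expChar (n * ((b p : ℝ) / p)) with hg
  have hident : ∑ x ∈ A ×ˢ A, g ((x.1 : ℤ) - x.2) =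
      ((∑ p ∈ P, ‖∑ a ∈ A, expChar (b p * a / p)‖ ^ 2 : ℝ) : ℂ) := by
    simp only [hg, Complex.ofReal_sum, sq_norm_sum_expChar]
    rw [Finset.sum_comm]
    refine Finset.sum_congr rfl fun p _ => ?_
    rw [Finset.sum_product]
    refine Finset.sum_congr rfl fun a _ => Finset.sum_congr rfl fun a' _ => ?_
    congr 1
    push_cast
    ring
  have hlower : P.card * (c * A.card) ^ 2 ≤ ∑ x ∈ A ×ˢ A, ‖g ((x.1 : ℤ) - x.2)‖ := by
    refine le_trans ?_ (norm_sum_le _ _)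
    rw [hident, Complex.norm_real, Real.norm_eq_abs]
    refine le_trans ?_ (le_abs_self _)
    rw [← nsmul_eq_mul, ← Finset.sum_const]
    exact Finset.sum_le_sum fun p hp => pow_le_pow_left₀ (by positivity) (hlarge p hp) 2
  obtain ⟨l, rfl⟩ : ∃ l, k = l + 1 := ⟨k - 1, by omega⟩
  set W := ∑ x ∈ A ×ˢ A, ‖g ((x.1 : ℤ) - x.2)‖ ^ (l + 1) with hW
  have hmean := pow_sum_le_card_mul_sum_pow (s := A ×ˢ A)
    (f := fun x => ‖g ((x.1 : ℤ) - x.2)‖) (fun x _ => norm_nonneg _) l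
  rw [← hW, Finset.card_product] at hmean
  have hWlower : (P.card : ℝ) ^ (l + 1) * c ^ (2 * (l + 1)) * (A.card : ℝ) ^ 2 ≤ W := by
    have h1 := (pow_le_pow_left₀ (by positivity) hlower (l + 1)).trans hmean
    have h2 : ((P.card : ℝ) * (c * A.card) ^ 2) ^ (l + 1) = ((A.card * A.card : ℕ) : ℝ) ^ l *
        ((P.card : ℝ) ^ (l + 1) * c ^ (2 * (l + 1)) * (A.card : ℝ) ^ 2) := by
      push_cast
      ring
    rw [h2] at h1
    exact le_of_mul_le_mul_left h1 (by push_cast; positivity)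
  have hWupper : W ^ 2 ≤
      addEnergy A * (5 * N * ((l + 1) ^ (l + 1) : ℕ) * (P.card : ℝ) ^ (l + 1)) := by
    refine (sq_sum_sub_le_addEnergy A hA fun n => ‖g n‖ ^ (l + 1)).trans ?_
    exact mul_le_mul_of_nonneg_left (sum_pow_norm_sum_expChar_le hN hP hk hPN hb) (by positivity)
  have hfinal := (pow_le_pow_left₀ (by positivity) hWlower 2).trans hWupper
  refine le_of_mul_le_mul_right (le_trans (le_of_eq ?_) (hfinal.trans (le_of_eq ?_)))
    (pow_pos hP1 (l + 1))
  · ring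
  · ring

theorem lifting_additive_energy (k : ℕ) (hk : 0 < k) (ε : ℝ) (hε : 0 < ε) :
    ∃ c : ℝ, c > 0 ∧ ∀ N : ℕ, 1 ≤ N →
      ∀ A : Finset ℕ, A ⊆ Finset.Icc 1 N → A.Nonempty →
        ∀ Ps : Finset ℕ,
          (∀ p ∈ Ps, p.Prime ∧ (p : ℝ) ≤ (N : ℝ) ^ ((1 : ℝ) / (2 * k))) →
          (∀ p ∈ Ps, InAP (modImage A p) ((1 - ε) * p)) →
          (addEnergy A : ℝ) ≥
            c * (A.card : ℝ) ^ 3 * ((A.card : ℝ) / Real.sqrt N) *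
              ((Ps.card : ℝ) / (N : ℝ) ^ ((1 : ℝ) / (2 * k))) ^ (2 * k - 1) := by
  obtain ⟨K, c₀, hc₀, hcoeff⟩ := exists_large_fourier_coeff hε
  obtain ⟨l, rfl⟩ : ∃ l, k = l + 1 := ⟨k - 1, by omega⟩
  set K₀ := max K (l + 2) with hK₀
  have hK₀pos : (0 : ℝ) < K₀ := by
    have : 0 < K₀ := lt_of_lt_of_le (by omega) (le_max_right K (l + 2))
    exact_mod_cast this
  set c₁ : ℝ := c₀ ^ (4 * (l + 1)) / (5 * ((l + 1) ^ (l + 1) : ℕ)) with hc₁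
  have hc₁pos : 0 < c₁ := by positivity
  refine ⟨min (1 / (3 * (2 * K₀) ^ (2 * l + 1))) (c₁ / 2 ^ (l + 1)),
    lt_min (by positivity) (by positivity), ?_⟩
  intro N hN A hA hAne Ps hPs hAP
  set c : ℝ := min (1 / (3 * (2 * K₀) ^ (2 * l + 1))) (c₁ / 2 ^ (l + 1)) with hc
  have hcpos : 0 < c := lt_min (by positivity) (by positivity)
  have hN0 : (0 : ℝ) < N := by exact_mod_cast hN
  have hN1 : (1 : ℝ) ≤ N := by exact_mod_cast hN
  set Q : ℝ := (N : ℝ) ^ ((1 : ℝ) / (2 * ((l + 1 : ℕ) : ℝ))) with hQ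
  have hQ1 : 1 ≤ Q := Real.one_le_rpow hN1 (by positivity)
  have hQ0 : 0 < Q := by linarith
  have hQN : Q ^ (2 * (l + 1)) = N := by
    rw [hQ, ← Real.rpow_natCast, ← Real.rpow_mul hN0.le]
    have : (1 : ℝ) / (2 * ((l + 1 : ℕ) : ℝ)) * ((2 * (l + 1) : ℕ) : ℝ) = 1 := by
      push_cast
      field_simp
    rw [this, Real.rpow_one]
  have hsqrt : Real.sqrt N = Q ^ (l + 1) := by
    rw [← hQN, mul_comm, pow_mul, Real.sqrt_sq (by positivity)]
  have hPQ : (Ps.card : ℝ) ≤ Q := by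
    have hsub : Ps ⊆ Finset.Ioc 0 ⌊Q⌋₊ := fun p hp =>
      Finset.mem_Ioc.2 ⟨(hPs p hp).1.pos, Nat.le_floor (hPs p hp).2⟩
    have := Finset.card_le_card hsub
    rw [Nat.card_Ioc, Nat.sub_zero] at this
    exact le_trans (by exact_mod_cast this) (Nat.floor_le hQ0.le)
  have reduction : ∀ x : ℝ, x * (A.card : ℝ) ^ 4 ≤ addEnergy A * N →
      c * (Ps.card : ℝ) ^ (2 * l + 1) ≤ x * Q ^ l →
      c * (A.card : ℝ) ^ 3 * ((A.card : ℝ) / Real.sqrt N) *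
        ((Ps.card : ℝ) / Q) ^ (2 * (l + 1) - 1) ≤ addEnergy A := by
    intro x h1 h2
    have hexp : 2 * (l + 1) - 1 = 2 * l + 1 := by omega
    rw [hexp, hsqrt]
    rw [← hQN] at h1
    have hQl : 0 < Q ^ (3 * l + 2) := by positivity
    calc c * (A.card : ℝ) ^ 3 * ((A.card : ℝ) / Q ^ (l + 1)) * ((Ps.card : ℝ) / Q) ^ (2 * l + 1)
        = (c * (Ps.card : ℝ) ^ (2 * l + 1)) * (A.card : ℝ) ^ 4 / Q ^ (3 * l + 2) := by
          rw [div_pow]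
          field_simp
          ring
      _ ≤ (x * Q ^ l) * (A.card : ℝ) ^ 4 / Q ^ (3 * l + 2) := by gcongr
      _ = (x * (A.card : ℝ) ^ 4) * Q ^ l / Q ^ (3 * l + 2) := by ring
      _ ≤ (addEnergy A * Q ^ (2 * (l + 1))) * Q ^ l / Q ^ (3 * l + 2) := by gcongr
      _ = addEnergy A := by
          rw [div_eq_iff hQl.ne']
          ring
  rcases le_total (Ps.card : ℝ) (2 * K₀) with hsmall | hbig
  · refine reduction (1 / 3) ?_ ?_
    · have := card_pow_four_le_addEnergy A hN hA
      linarith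
    · calc c * (Ps.card : ℝ) ^ (2 * l + 1)
          ≤ 1 / (3 * (2 * K₀) ^ (2 * l + 1)) * (2 * K₀) ^ (2 * l + 1) := by
            gcongr
            exact min_le_left _ _
        _ = 1 / 3 * 1 := by field_simp
        _ ≤ 1 / 3 * Q ^ l := by
            gcongr
            exact one_le_pow₀ hQ1
  · set P := Ps.filter (fun p => K₀ ≤ p) with hP
    have hPPs : ∀ p ∈ P, p ∈ Ps := fun p hp => (Finset.mem_filter.1 hp).1
    have hPK : ∀ p ∈ P, K₀ ≤ p := fun p hp => (Finset.mem_filter.1 hp).2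
    have hcard : (Ps.card : ℝ) / 2 ≤ P.card := by
      have h1 : Ps.card ≤ P.card + K₀ := by
        rw [← Finset.card_filter_add_card_filter_not (s := Ps) (fun p => K₀ ≤ p)]
        refine Nat.add_le_add_left ?_ _
        have hsub : Ps.filter (fun p => ¬ K₀ ≤ p) ⊆ Finset.range K₀ := fun p hp =>
          Finset.mem_range.2 (not_le.1 (Finset.mem_filter.1 hp).2)
        simpa using Finset.card_le_card hsub
      have h2 : (Ps.card : ℝ) ≤ P.card + K₀ := by exact_mod_cast h1
      linarith
    have hex : ∀ p : ℕ, ∃ b : ℤ, p ∈ P → ¬ (p : ℤ) ∣ b ∧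
        c₀ * (A.card : ℝ) ≤ ‖∑ a ∈ A, expChar (b * a / p)‖ := by
      intro p
      by_cases hp : p ∈ P
      · obtain ⟨b, hb⟩ := hcoeff p (hPs p (hPPs p hp)).1
          ((le_max_left _ _).trans (hPK p hp)) A hAne (hAP p (hPPs p hp))
        exact ⟨b, fun _ => hb⟩
      · exact ⟨0, fun h => absurd h hp⟩
    choose b hb using hex
    have hmain := addEnergy_ge_of_large_fourier_coeff (P := P) (b := b) hk hN
      (fun p hp => (hPs p (hPPs p hp)).1)
      (fun p hp => lt_of_lt_of_le (by omega) ((le_max_right _ _).trans (hPK p hp)))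
      (fun p hp => by
        have h := pow_le_pow_left₀ (Nat.cast_nonneg p) (hPs p (hPPs p hp)).2 (2 * (l + 1))
        rw [hQN] at h
        exact_mod_cast h)
      (fun p hp => (hb p hp).1) hA hAne hc₀ (fun p hp => (hb p hp).2)
    refine reduction (c₁ * (P.card : ℝ) ^ (l + 1)) ?_ ?_
    · have h5 : (0 : ℝ) < 5 * ((l + 1) ^ (l + 1) : ℕ) := by positivity
      rw [hc₁, div_mul_eq_mul_div, div_mul_eq_mul_div, div_le_iff₀ h5]
      calc _ = _ := by ring
        _ ≤ _ := hmain
        _ = _ := by ring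
    · calc c * (Ps.card : ℝ) ^ (2 * l + 1)
          ≤ c₁ / 2 ^ (l + 1) * ((Ps.card : ℝ) ^ (l + 1) * (Ps.card : ℝ) ^ l) := by
            rw [← pow_add, show l + 1 + l = 2 * l + 1 by ring]
            gcongr
            exact min_le_right _ _
        _ ≤ c₁ / 2 ^ (l + 1) * ((Ps.card : ℝ) ^ (l + 1) * Q ^ l) := by gcongr
        _ = c₁ * ((Ps.card : ℝ) / 2) ^ (l + 1) * Q ^ l := by
            rw [div_pow]
            ring
        _ ≤ c₁ * (P.card : ℝ) ^ (l + 1) * Q ^ l := by gcongr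
end

section
/- For every real ε > 0 there is an integer N₀ such that for all N ≥ N₀ the following holds: if A₁, A₂, A₃ ⊆ [N] are subsets with |A₁|, |A₂|, |A₃| ≥ N^{1/3+ε}, then the sumset A₁ + A₂ + A₃ = {a₁ + a₂ + a₃ : a₁ ∈ A₁, a₂ ∈ A₂, a₃ ∈ A₃} contains a composite number, i.e., an integer n > 1 that is not prime. -/
/-- Cauchy–Schwarz lower bound for the number of pairs of elements in the same fibre. -/
lemma card_sq_le_card_image_mul_card_filter {α β : Type*} [DecidableEq β]
    (A : Finset α) (f : α → β) :
    A.card ^ 2 ≤ (A.image f).card * ((A ×ˢ A).filter fun x ↦ f x.1 = f x.2).card := by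
  have hpairs : ((A ×ˢ A).filter fun x ↦ f x.1 = f x.2).card
      = ∑ b ∈ A.image f, (A.filter fun a ↦ f a = b).card ^ 2 := by
    rw [Finset.card_eq_sum_card_fiberwise (f := fun x ↦ f x.1) (t := A.image f)]
    · refine Finset.sum_congr rfl fun b _ ↦ ?_
      rw [sq, ← Finset.card_product]
      congr 1
      ext x
      simp only [Finset.mem_filter, Finset.mem_product]
      grind
    · intro x hx
      simp only [Finset.coe_filter, Finset.mem_product, Set.mem_ofPred_eq] at hx
      exact Finset.mem_coe.2 (Finset.mem_image_of_mem f hx.1.1)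
  rw [hpairs, Finset.card_eq_sum_card_image f A]
  exact sq_sum_le_card_mul_sum_sq

lemma sum_log_filter_dvd_le {P : Finset ℕ} (hP : ∀ p ∈ P, p.Prime) {d : ℕ} (hd : d ≠ 0) :
    ∑ p ∈ P.filter (· ∣ d), Real.log p ≤ Real.log d := by
  have hprime : ∀ p ∈ P.filter (· ∣ d), p.Prime := fun p hp ↦ hP p (Finset.mem_filter.1 hp).1
  rw [← Real.log_prod fun p hp ↦ Nat.cast_ne_zero.2 (hprime p hp).ne_zero]
  have hdvd : ∏ p ∈ P.filter (· ∣ d), p ∣ d :=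
    Finset.prod_primes_dvd d (fun p hp ↦ (hprime p hp).prime)
      fun p hp ↦ (Finset.mem_filter.1 hp).2
  have hpos : 0 < ∏ p ∈ P.filter (· ∣ d), p := Finset.prod_pos fun p hp ↦ (hprime p hp).pos
  rw [← Nat.cast_prod]
  exact Real.log_le_log (by exact_mod_cast hpos)
    (by exact_mod_cast Nat.le_of_dvd (Nat.pos_of_ne_zero hd) hdvd)

lemma sum_log_filter_cast_eq_le {P : Finset ℕ} (hP : ∀ p ∈ P, p.Prime) {N a b : ℕ}
    (ha : a ∈ Finset.Icc 1 N) (hb : b ∈ Finset.Icc 1 N) (hab : a ≠ b) :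
    ∑ p ∈ P, (if (a : ZMod p) = b then Real.log p else 0) ≤ Real.log N := by
  rw [Finset.mem_Icc] at ha hb
  wlog hlt : a < b generalizing a b
  · simpa only [eq_comm] using this hb ha hab.symm (by omega)
  have hdvd : ∀ p, (a : ZMod p) = b ↔ p ∣ b - a := fun p ↦ by
    rw [ZMod.natCast_eq_natCast_iff, Nat.modEq_iff_dvd' hlt.le]
  simp only [hdvd, ← Finset.sum_filter]
  refine (sum_log_filter_dvd_le hP (by omega)).trans ?_
  exact Real.log_le_log (by exact_mod_cast (by omega : 0 < b - a))
    (by exact_mod_cast (by omega : b - a ≤ N))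

/-- **Gallagher's larger sieve.** -/
lemma larger_sieve {P : Finset ℕ} (hP : ∀ p ∈ P, p.Prime) {N : ℕ} {A : Finset ℕ}
    (hA : A ⊆ Finset.Icc 1 N) :
    (A.card : ℝ) * (∑ p ∈ P, Real.log p / (A.image (Nat.cast : ℕ → ZMod p)).card - Real.log N)
      ≤ ∑ p ∈ P, Real.log p := by
  have hlog : ∀ p ∈ P, 0 ≤ Real.log p := fun p _ ↦ Real.log_natCast_nonneg p
  rcases A.eq_empty_or_nonempty with rfl | hne
  · simpa using Finset.sum_nonneg hlog
  have hcard : (0 : ℝ) < A.card := by exact_mod_cast hne.card_pos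
  have hlower : (A.card : ℝ) ^ 2 *
      ∑ p ∈ P, Real.log p / (A.image (Nat.cast : ℕ → ZMod p)).card
      ≤ ∑ p ∈ P, ∑ x ∈ A ×ˢ A, if (x.1 : ZMod p) = x.2 then Real.log p else 0 := by
    rw [Finset.mul_sum]
    refine Finset.sum_le_sum fun p hp ↦ ?_
    rw [← Finset.sum_filter, Finset.sum_const, nsmul_eq_mul]
    have hν : (0 : ℝ) < (A.image (Nat.cast : ℕ → ZMod p)).card := by
      exact_mod_cast (hne.image _).card_pos
    rw [← mul_div_assoc, div_le_iff₀ hν]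
    have h : (A.card : ℝ) ^ 2 ≤ (A.image (Nat.cast : ℕ → ZMod p)).card *
        ((A ×ˢ A).filter fun x ↦ (x.1 : ZMod p) = x.2).card := by
      exact_mod_cast card_sq_le_card_image_mul_card_filter A (Nat.cast : ℕ → ZMod p)
    nlinarith [mul_le_mul_of_nonneg_right h (hlog p hp)]
  have hupper : ∑ p ∈ P, ∑ x ∈ A ×ˢ A, (if (x.1 : ZMod p) = x.2 then Real.log p else 0)
      ≤ A.card * ∑ p ∈ P, Real.log p + (A.card : ℝ) ^ 2 * Real.log N := by
    rw [Finset.sum_comm, Finset.sum_product]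
    have hrow : ∀ a ∈ A, ∑ b ∈ A, ∑ p ∈ P, (if (a : ZMod p) = b then Real.log p else 0)
        ≤ ∑ p ∈ P, Real.log p + A.card * Real.log N := by
      intro a ha
      rw [← Finset.add_sum_erase A _ ha]
      refine add_le_add (by simp) ?_
      refine (Finset.sum_le_card_nsmul _ _ (Real.log N) fun b hb ↦ ?_).trans ?_
      · exact sum_log_filter_cast_eq_le hP (hA ha) (hA (Finset.mem_of_mem_erase hb))
          (Finset.ne_of_mem_erase hb).symm
      · rw [nsmul_eq_mul]
        gcongr
        exact Finset.erase_subset a A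
    refine (Finset.sum_le_card_nsmul _ _ _ hrow).trans (le_of_eq ?_)
    rw [nsmul_eq_mul]
    ring
  nlinarith [hlower.trans hupper]

/-- Three nonempty sets of residues with no sum equal to zero occupy at most `p + 1` classes
in total. -/
lemma ZMod.card_add_card_add_card_le {p : ℕ} (hp : p.Prime) {S T U : Finset (ZMod p)}
    (hS : S.Nonempty) (hT : T.Nonempty) (hU : U.Nonempty)
    (h : ∀ s ∈ S, ∀ t ∈ T, ∀ u ∈ U, s + t + u ≠ 0) :
    S.card + T.card + U.card ≤ p + 1 := by
  classical
  have : Fact p.Prime := ⟨hp⟩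
  open scoped Pointwise in
  have h₁ := ZMod.cauchy_davenport hp hS hT
  open scoped Pointwise in
  have h₂ := ZMod.cauchy_davenport hp (hS.add hT) hU
  open scoped Pointwise in
  have h₃ : (S + T + U).card < p := by
    refine (Finset.card_lt_univ_of_notMem (x := 0) fun h0 ↦ ?_).trans_eq (ZMod.card p)
    obtain ⟨x, hx, u, hu, hxu⟩ := Finset.mem_add.1 h0
    obtain ⟨s, hs, t, ht, rfl⟩ := Finset.mem_add.1 hx
    exact h s hs t ht u hu hxu
  have := hS.card_pos
  have := hT.card_pos
  have := hU.card_pos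
  omega

lemma nine_div_add_le {a b c : ℝ} (ha : 0 < a) (hb : 0 < b) (hc : 0 < c) :
    9 / (a + b + c) ≤ 1 / a + 1 / b + 1 / c := by
  have h : 0 ≤ (a * (b - c) ^ 2 + b * (a - c) ^ 2 + c * (a - b) ^ 2) /
      (a * b * c * (a + b + c)) := by
    positivity
  have h' : 1 / a + 1 / b + 1 / c - 9 / (a + b + c)
      = (a * (b - c) ^ 2 + b * (a - c) ^ 2 + c * (a - b) ^ 2) / (a * b * c * (a + b + c)) := by
    field_simp
    ring
  linarith

lemma log_le_sum_primesLE_log_div_sub_one {n : ℕ} (hn : n ≠ 0) :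
    Real.log n - 1 ≤ ∑ p ∈ Nat.primesLE n, Real.log p / (p - 1) := by
  have hn' : (0 : ℝ) < n := by exact_mod_cast Nat.pos_of_ne_zero hn
  have hlower : n * Real.log n - n ≤ Real.log (n.factorial) := by
    have h := Real.pow_div_factorial_le_exp (x := n) hn'.le n
    have h2 := Real.log_le_log (by positivity) h
    rw [Real.log_exp, Real.log_div (by positivity) (by positivity), Real.log_pow] at h2
    linarith
  have hfact : Real.log (n.factorial)
      = ∑ p ∈ Nat.primesLE n, n.factorial.factorization p * Real.log p := by
    rw [Real.log_nat_eq_sum_factorization, Finsupp.sum]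
    refine Finset.sum_subset (fun p hp ↦ ?_) fun p _ hp ↦ ?_
    · rw [Nat.support_factorization, Nat.mem_primeFactors] at hp
      exact Nat.mem_primesLE.2 ⟨(hp.1.dvd_factorial).1 hp.2.1, hp.1⟩
    · rw [Finsupp.notMem_support_iff.1 hp]
      simp
  have hupper : Real.log (n.factorial) ≤ n * ∑ p ∈ Nat.primesLE n, Real.log p / (p - 1) := by
    rw [hfact, Finset.mul_sum]
    refine Finset.sum_le_sum fun p hp ↦ ?_
    have hpp := (Nat.mem_primesLE.1 hp).2
    have hp1 : (1 : ℝ) < p := by exact_mod_cast hpp.one_lt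
    have h : (p - 1) * n.factorial.factorization p ≤ n := by
      rw [Nat.sub_one_mul_factorization_factorial hpp]
      exact Nat.sub_le _ _
    have h' : ((p : ℝ) - 1) * n.factorial.factorization p ≤ n := by
      have h2 : (((p - 1 : ℕ) : ℝ)) * n.factorial.factorization p ≤ n := by exact_mod_cast h
      rwa [Nat.cast_sub hpp.one_le, Nat.cast_one] at h2
    rw [← mul_div_assoc, le_div_iff₀ (by linarith)]
    nlinarith [mul_le_mul_of_nonneg_right h' (Real.log_natCast_nonneg p)]
  nlinarith [hlower.trans hupper]

/-- A lower bound of Mertens type. -/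
lemma exists_log_sub_le_sum_primesLE_log_div_add_one :
    ∃ C : ℝ, ∀ n : ℕ, n ≠ 0 →
      Real.log n - C ≤ ∑ p ∈ Nat.primesLE n, Real.log p / (p + 1) := by
  have hsum : Summable fun p : ℕ ↦ 8 * (p : ℝ) ^ (-(3 / 2) : ℝ) :=
    (Real.summable_nat_rpow.2 (by norm_num)).mul_left 8
  refine ⟨1 + ∑' p : ℕ, 8 * (p : ℝ) ^ (-(3 / 2) : ℝ), fun n hn ↦ ?_⟩
  have hbound : ∑ p ∈ Nat.primesLE n, 8 * (p : ℝ) ^ (-(3 / 2) : ℝ)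
      ≤ ∑' p : ℕ, 8 * (p : ℝ) ^ (-(3 / 2) : ℝ) :=
    hsum.sum_le_tsum _ fun p _ ↦ by positivity
  have hterm : ∑ p ∈ Nat.primesLE n, Real.log p / (p - 1)
      ≤ ∑ p ∈ Nat.primesLE n, (Real.log p / (p + 1) + 8 * (p : ℝ) ^ (-(3 / 2) : ℝ)) := by
    refine Finset.sum_le_sum fun p hp ↦ ?_
    have hp2 : (2 : ℝ) ≤ p := by exact_mod_cast (Nat.mem_primesLE.1 hp).2.two_le
    have hp0 : (0 : ℝ) < p := by linarith
    have hlog : Real.log p ≤ 2 * (p : ℝ) ^ (1 / 2 : ℝ) := by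
      have := Real.log_le_rpow_div hp0.le (ε := 1 / 2) (by norm_num)
      linarith
    have hdiff : Real.log p / (p - 1) - Real.log p / (p + 1)
        = 2 * Real.log p / ((p : ℝ) ^ 2 - 1) := by
      have h1 : (p : ℝ) - 1 ≠ 0 := by linarith
      have h2 : (p : ℝ) + 1 ≠ 0 := by linarith
      have h3 : (p : ℝ) ^ 2 - 1 ≠ 0 := by nlinarith
      field_simp
      ring
    have hpow : (p : ℝ) ^ (1 / 2 : ℝ) = (p : ℝ) ^ (-(3 / 2) : ℝ) * (p : ℝ) ^ 2 := by
      rw [← Real.rpow_natCast, ← Real.rpow_add hp0]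
      norm_num
    have hr : 0 < (p : ℝ) ^ (-(3 / 2) : ℝ) := by positivity
    have : 2 * Real.log p / ((p : ℝ) ^ 2 - 1) ≤ 8 * (p : ℝ) ^ (-(3 / 2) : ℝ) := by
      rw [div_le_iff₀ (by nlinarith)]
      rw [hpow] at hlog
      have hsq : (p : ℝ) ^ 2 ≤ 2 * ((p : ℝ) ^ 2 - 1) := by nlinarith
      nlinarith [mul_le_mul_of_nonneg_left hsq hr.le]
    linarith
  rw [Finset.sum_add_distrib] at hterm
  linarith [log_le_sum_primesLE_log_div_sub_one hn]

/-- If all elements of `A₁ + A₂ + A₃` are free of prime factors up to `q`, then one of the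
sets has at most `q` elements as soon as `q` is sufficiently large in terms of `N`. -/
lemma exists_card_le_of_sum_not_dvd {N q : ℕ} {A : Fin 3 → Finset ℕ}
    (hA : ∀ i, A i ⊆ Finset.Icc 1 N)
    (hq : 3 * Real.log N + 3 * Real.log 4
      ≤ 9 * ∑ p ∈ Nat.primesLE q, Real.log p / (p + 1))
    (hdvd : ∀ p ≤ q, p.Prime → ∀ a ∈ A 0, ∀ b ∈ A 1, ∀ c ∈ A 2, ¬ p ∣ a + b + c) :
    ∃ i, (A i).card ≤ q := by
  by_contra! hcard
  have hne : ∀ i, (A i).Nonempty := fun i ↦ Finset.card_pos.1 (by have := hcard i; omega)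
  have hprime : ∀ p ∈ Nat.primesLE q, p.Prime := fun p hp ↦ (Nat.mem_primesLE.1 hp).2
  set X : Fin 3 → ℝ := fun i ↦
    ∑ p ∈ Nat.primesLE q, Real.log p / ((A i).image (Nat.cast : ℕ → ZMod p)).card with hX
  have hsum : 9 * ∑ p ∈ Nat.primesLE q, Real.log p / (p + 1) ≤ X 0 + X 1 + X 2 := by
    simp only [hX]
    rw [← Finset.sum_add_distrib, ← Finset.sum_add_distrib, Finset.mul_sum]
    refine Finset.sum_le_sum fun p hp ↦ ?_
    have hpos : ∀ i, (0 : ℝ) < ((A i).image (Nat.cast : ℕ → ZMod p)).card := fun i ↦ by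
      exact_mod_cast ((hne i).image _).card_pos
    have hle : ((A 0).image (Nat.cast : ℕ → ZMod p)).card
        + ((A 1).image (Nat.cast : ℕ → ZMod p)).card
        + ((A 2).image (Nat.cast : ℕ → ZMod p)).card ≤ p + 1 := by
      refine ZMod.card_add_card_add_card_le (hprime p hp) ((hne 0).image _) ((hne 1).image _)
        ((hne 2).image _) ?_
      simp only [Finset.forall_mem_image]
      intro a ha b hb c hc h
      refine hdvd p (Nat.mem_primesLE.1 hp).1 (hprime p hp) a ha b hb c hc ?_
      rw [← ZMod.natCast_eq_zero_iff]
      exact_mod_cast h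
    have hle' : (((A 0).image (Nat.cast : ℕ → ZMod p)).card : ℝ)
        + ((A 1).image (Nat.cast : ℕ → ZMod p)).card
        + ((A 2).image (Nat.cast : ℕ → ZMod p)).card ≤ p + 1 := by exact_mod_cast hle
    have h9 := (div_le_div_of_nonneg_left (by norm_num : (0 : ℝ) ≤ 9)
      (add_pos (add_pos (hpos 0) (hpos 1)) (hpos 2)) hle').trans
      (nine_div_add_le (hpos 0) (hpos 1) (hpos 2))
    calc 9 * (Real.log p / (p + 1)) = Real.log p * (9 / (p + 1)) := by ring
      _ ≤ _ := mul_le_mul_of_nonneg_left h9 (Real.log_natCast_nonneg p)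
      _ = _ := by ring
  have hlog4 : 0 < Real.log 4 := Real.log_pos (by norm_num)
  have hsmall : ∀ i, X i - Real.log N < Real.log 4 := by
    intro i
    by_contra! hi
    have h1 := larger_sieve hprime (hA i)
    rw [← Chebyshev.theta_eq_sum_primesLE_log] at h1
    have h2 := h1.trans (Chebyshev.theta_le_log4_mul_x q.cast_nonneg)
    have h3 := (mul_le_mul_of_nonneg_left hi (Nat.cast_nonneg (α := ℝ) (A i).card)).trans h2
    have h4 : ((A i).card : ℝ) ≤ q := by nlinarith
    exact absurd (by exact_mod_cast h4) (hcard i).not_ge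
  linarith [hsmall 0, hsmall 1, hsmall 2]

theorem ternary_goldbach_larger_sieve (ε : ℝ) (hε : 0 < ε) :
    ∃ N₀ : ℕ, ∀ N : ℕ, N ≥ N₀ →
      ∀ A₁ A₂ A₃ : Finset ℕ,
        A₁ ⊆ Finset.Icc 1 N → A₂ ⊆ Finset.Icc 1 N → A₃ ⊆ Finset.Icc 1 N →
        (A₁.card : ℝ) ≥ (N : ℝ) ^ ((1:ℝ)/3 + ε) →
        (A₂.card : ℝ) ≥ (N : ℝ) ^ ((1:ℝ)/3 + ε) →
        (A₃.card : ℝ) ≥ (N : ℝ) ^ ((1:ℝ)/3 + ε) →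
        ∃ n : ℕ, (∃ a₁ ∈ A₁, ∃ a₂ ∈ A₂, ∃ a₃ ∈ A₃, n = a₁ + a₂ + a₃) ∧
          1 < n ∧ ¬ n.Prime := by
  obtain ⟨C, hC⟩ := exists_log_sub_le_sum_primesLE_log_div_add_one
  have hlarge : ∀ᶠ N : ℕ in Filter.atTop,
      (9 * (C + Real.log 2) + 3 * Real.log 4) / (9 / 2 * ε) ≤ Real.log N :=
    (Real.tendsto_log_atTop.comp tendsto_natCast_atTop_atTop).eventually_ge_atTop _
  have hgap : ∀ᶠ N : ℕ in Filter.atTop, 2 < (N : ℝ) ^ (ε / 2) :=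
    ((tendsto_rpow_atTop (by positivity)).comp tendsto_natCast_atTop_atTop).eventually_gt_atTop _
  obtain ⟨N₀, hN₀⟩ := Filter.eventually_atTop.1
    (hlarge.and (hgap.and (Filter.eventually_ge_atTop 1)))
  refine ⟨N₀, fun N hN A₁ A₂ A₃ hA₁ hA₂ hA₃ hc₁ hc₂ hc₃ ↦ ?_⟩
  obtain ⟨hlog, hpow, hN1⟩ := hN₀ N hN
  have hN1' : (1 : ℝ) ≤ N := by exact_mod_cast hN1
  set x : ℝ := (N : ℝ) ^ (1 / 3 + ε / 2) with hx
  set q : ℕ := ⌊x⌋₊ with hq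
  have hx1 : 1 ≤ x := Real.one_le_rpow hN1' (by positivity)
  have hq0 : q ≠ 0 := (Nat.floor_pos.2 hx1).ne'
  have hqx : (q : ℝ) ≤ x := Nat.floor_le (by linarith)
  have hxq : x / 2 ≤ q := by
    have h1 : x < q + 1 := Nat.lt_floor_add_one x
    have h2 : (1 : ℝ) ≤ q := by exact_mod_cast Nat.one_le_iff_ne_zero.2 hq0
    linarith
  have hlogq : (1 / 3 + ε / 2) * Real.log N - Real.log 2 ≤ Real.log q := by
    rw [← Real.log_rpow (by linarith), ← Real.log_div (by positivity) (by norm_num)]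
    exact Real.log_le_log (by positivity) hxq
  have hsum : 3 * Real.log N + 3 * Real.log 4
      ≤ 9 * ∑ p ∈ Nat.primesLE q, Real.log p / (p + 1) := by
    rw [div_le_iff₀ (by positivity)] at hlog
    linarith [hC q hq0]
  have hbig : ∀ B : Finset ℕ, (B.card : ℝ) ≥ (N : ℝ) ^ ((1:ℝ)/3 + ε) → 2 * q < B.card := by
    intro B hB
    have h : (N : ℝ) ^ ((1:ℝ)/3 + ε) = x * (N : ℝ) ^ (ε / 2) := by
      rw [hx, ← Real.rpow_add (by linarith)]
      ring_nf
    rw [h] at hB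
    have : (2 * q : ℝ) < B.card := by nlinarith
    exact_mod_cast this
  by_contra! hcomp
  obtain ⟨i, hi⟩ := exists_card_le_of_sum_not_dvd (N := N) (q := q)
    (A := ![A₁ \ Finset.Icc 1 q, A₂, A₃])
    (Fin.forall_fin_succ.2 ⟨Finset.sdiff_subset.trans hA₁,
      Fin.forall_fin_two.2 ⟨hA₂, hA₃⟩⟩) hsum (by
      intro p hp hpp a ha b hb c hc hdvd
      simp only [Matrix.cons_val_zero, Finset.mem_sdiff, Finset.mem_Icc] at ha
      have ha1 := Finset.mem_Icc.1 (hA₁ ha.1)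
      have hprime := hcomp (a + b + c) ⟨a, ha.1, b, hb, c, hc, rfl⟩
        (by have := Finset.mem_Icc.1 (hA₂ hb); omega)
      have := (Nat.prime_dvd_prime_iff_eq hpp hprime).1 hdvd
      omega)
  have hdiff : q < (A₁ \ Finset.Icc 1 q).card := by
    have h1 := Finset.le_card_sdiff (Finset.Icc 1 q) A₁
    have h2 := hbig A₁ hc₁
    rw [Nat.card_Icc] at h1
    omega
  have h2 := hbig A₂ hc₂
  have h3 := hbig A₃ hc₃
  fin_cases i <;> simp at hi <;> omega
end
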